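/- Let X = π_p(X̃) ⊂ P^{n+c} be a variety of almost minimal degree (degree c+2) obtained as the projection of a smooth variety of minimal degree X̃ ⊂ P^{n+c+1} (not a cone) from a point p ∉ X̃, with c ≥ 3. If depth(X) = n (where depth is the arithmetic depth of the homogeneous coordinate ring), then n ≤ 4. -/

import Mathlib

/-!
Common framework: a projective variety `X ⊆ ℙ^N` over a field `k` is represented by its
affine cone `C ⊆ (ι → k)` (with `ι` the index type of homogeneous coordinates,
`Fintype.card ι = N + 1`).  All projective notions (vanishing ideal, `a₂`, Hilbert
function, dimension, degree, depth, base locus of quadrics, irreducible components,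
scrolls and divisors on them, sectional genus, maximal sectional regularity) are
defined concretely below.
-/

open MvPolynomial

noncomputable section

namespace PaperQuadrics

variable (k : Type) [Field k] (ι : Type) [Fintype ι] [DecidableEq ι]

/-- The vanishing ideal of a subset `C` of the affine cone `ι → k`. -/
def vanIdeal (C : Set (ι → k)) : Ideal (MvPolynomial ι k) :=
  ⨅ x ∈ C, RingHom.ker (MvPolynomial.eval x)

/-- The degree-`m` graded piece of an ideal of the polynomial ring. -/
def idealPiece (I : Ideal (MvPolynomial ι k)) (m : ℕ) : Submodule k (MvPolynomial ι k) :=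
  Submodule.restrictScalars k I ⊓ homogeneousSubmodule ι k m

/-- The space of quadrics vanishing on `C`, i.e. `H⁰(ℙ^N, I_C(2))`. -/
def quadrics (C : Set (ι → k)) : Submodule k (MvPolynomial ι k) :=
  idealPiece k ι (vanIdeal k ι C) 2

/-- `a₂(C) = h⁰(ℙ^N, I_C(2))`, the number of linearly independent quadrics through `C`. -/
def a2 (C : Set (ι → k)) : ℕ := Module.finrank k (quadrics k ι C)

/-- The Hilbert function of `R/I` in degree `m`. -/
def idealHilb (I : Ideal (MvPolynomial ι k)) (m : ℕ) : ℕ :=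
  Module.finrank k (homogeneousSubmodule ι k m) - Module.finrank k (idealPiece k ι I m)

/-- The Hilbert function of the homogeneous coordinate ring of `C`. -/
def hilb (C : Set (ι → k)) (m : ℕ) : ℕ := idealHilb k ι (vanIdeal k ι C) m

/-- `C ⊆ ι → k` is the affine cone of an irreducible projective variety:
it is a Zariski-closed cone whose vanishing ideal is prime. -/
structure IsProjVariety (C : Set (ι → k)) : Prop where
  zero_mem : (0 : ι → k) ∈ C
  smul_mem : ∀ x ∈ C, ∀ t : k, t • x ∈ C
  closed : C = {x | ∀ f ∈ vanIdeal k ι C, MvPolynomial.eval x f = 0}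
  prime : (vanIdeal k ι C).IsPrime

/-- Nondegenerate: no nonzero linear form vanishes identically on `C`. -/
def Nondeg (C : Set (ι → k)) : Prop :=
  ∀ f ∈ homogeneousSubmodule ι k 1, (∀ x ∈ C, MvPolynomial.eval x f = 0) → f = 0

/-- The projective variety with cone `C` has dimension `n`
(so the affine cone has Krull dimension `n + 1`). -/
def HasDim (C : Set (ι → k)) (n : ℕ) : Prop :=
  ringKrullDim (MvPolynomial ι k ⧸ vanIdeal k ι C) = (n + 1 : ℕ)

/-- `C` (of projective dimension `n`) has degree `d`:
the Hilbert function satisfies `hF(m) · n! / mⁿ → d`. -/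
def HasDegree (C : Set (ι → k)) (n d : ℕ) : Prop :=
  Filter.Tendsto (fun m : ℕ => (hilb k ι C m : ℝ) * (Nat.factorial n : ℝ) / (m : ℝ) ^ n)
    Filter.atTop (nhds (d : ℝ))

/-- `Q(C)`: the common zero set (base locus) of all quadrics through `C`. -/
def quadZero (C : Set (ι → k)) : Set (ι → k) :=
  {x | ∀ f ∈ quadrics k ι C, MvPolynomial.eval x f = 0}

/-- `fs` is a regular sequence on `R/I`. -/
def IsRegSeqOn (I : Ideal (MvPolynomial ι k)) (fs : List (MvPolynomial ι k)) : Prop :=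
  (∀ i : Fin fs.length, ∀ g : MvPolynomial ι k,
      fs.get i * g ∈ I ⊔ Ideal.span {h | ∃ j : Fin fs.length, j < i ∧ fs.get j = h} →
      g ∈ I ⊔ Ideal.span {h | ∃ j : Fin fs.length, j < i ∧ fs.get j = h}) ∧
  I ⊔ Ideal.span {h | ∃ j : Fin fs.length, fs.get j = h} ≠ ⊤

/-- Arithmetic depth of the homogeneous coordinate ring of `C`: the supremum of lengths of
regular sequences of elements of the irrelevant maximal ideal. -/
def arithDepth (C : Set (ι → k)) : ℕ :=
  sSup {l : ℕ | ∃ fs : List (MvPolynomial ι k), fs.length = l ∧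
    (∀ f ∈ fs, MvPolynomial.coeff 0 f = 0) ∧ IsRegSeqOn k ι (vanIdeal k ι C) fs}

/-- `Z` is an irreducible Zariski-closed cone. -/
def IsIrredClosed (Z : Set (ι → k)) : Prop :=
  Z = {x | ∀ f ∈ vanIdeal k ι Z, MvPolynomial.eval x f = 0} ∧ (vanIdeal k ι Z).IsPrime

/-- `Z` is an irreducible component of `Q`: an irreducible closed subset of `Q`, maximal
among the irreducible closed subsets of `Q`. -/
def IsComponentOf (Z Q : Set (ι → k)) : Prop :=
  IsIrredClosed k ι Z ∧ Z ⊆ Q ∧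
    ∀ Z' : Set (ι → k), IsIrredClosed k ι Z' → Z ⊆ Z' → Z' ⊆ Q → Z' = Z

/-- `C` is smooth away from the cone vertex, of codimension `c`: at each nonzero point the
Jacobian of the vanishing ideal has rank `c` (valid criterion in characteristic `0`). -/
def IsSmoothOfCodim (C : Set (ι → k)) (c : ℕ) : Prop :=
  ∀ x ∈ C, x ≠ (0 : ι → k) →
    Module.finrank k (Submodule.span k
      {v : ι → k | ∃ f ∈ vanIdeal k ι C,
        v = fun i => MvPolynomial.eval x (MvPolynomial.pderiv i f)}) = c

/-- The projective variety with affine cone `C` is a cone (in the projective sense):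
there is a vertex point `[v]` such that `C` is stable under the join with `[v]`. -/
def IsConeVariety (C : Set (ι → k)) : Prop :=
  ∃ v ∈ C, v ≠ 0 ∧ ∀ x ∈ C, ∀ s t : k, s • x + t • v ∈ C

/-- `C` (an `n`-dimensional variety of degree `d`) has sectional genus `g`: a general linear
curve section (cut by `n - 1` general hyperplanes) has Hilbert polynomial `d·m + 1 - g`. -/
def SectionalGenus (n : ℕ) (C : Set (ι → k)) (d g : ℕ) : Prop :=
  ∃ P : MvPolynomial (Fin (n - 1) × ι) k, P ≠ 0 ∧
    ∀ w : Fin (n - 1) → ι → k, MvPolynomial.eval (fun q => w q.1 q.2) P ≠ 0 →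
      ∀ᶠ m in Filter.atTop,
        (hilb k ι (C ∩ {x | ∀ j, ∑ i, w j i * x i = 0}) m : ℤ) = d * m + 1 - g

/-- `C` (an `n`-dimensional variety of degree `c + 3`) is a variety of maximal sectional
regularity: there is an `n`-dimensional linear subspace `F(X) = ℙ(L)` such that
`X ∩ F(X)` is (scheme-theoretically) a hypersurface of degree `4` in `F(X) ≅ ℙⁿ`,
detected by the Hilbert function of the ideal sum. -/
def IsVMSR (n : ℕ) (C : Set (ι → k)) : Prop :=
  ∃ L : Submodule k (ι → k), Module.finrank k L = n + 1 ∧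
    ∀ᶠ m in Filter.atTop,
      idealHilb k ι (vanIdeal k ι C ⊔ vanIdeal k ι (L : Set (ι → k))) m =
        Nat.choose (m + n) n - Nat.choose (m - 4 + n) n

end PaperQuadrics

namespace PaperQuadrics

variable {k : Type} [Field k]

/-- The parametrization of the rational normal scroll `S(a₀, …, aₙ)` (so the scroll has
dimension `n + 1`): homogeneous coordinates are indexed by `(i, j)`, `0 ≤ j ≤ aᵢ`,
and the point of parameters `(s : t) ∈ ℙ¹`, `λ` has coordinates `λᵢ sʲ t^{aᵢ - j}`. -/
def scrollParam (n : ℕ) (a : Fin (n + 1) → ℕ) (s t : k) (lam : Fin (n + 1) → k) :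
    ((i : Fin (n + 1)) × Fin (a i + 1)) → k :=
  fun x => lam x.1 * s ^ (x.2 : ℕ) * t ^ (a x.1 - (x.2 : ℕ))

/-- The affine cone of the scroll `S(a₀, …, aₙ) ⊆ ℙ^{n+1+c-1}`, `c = Σ aᵢ`. -/
def scrollCone (n : ℕ) (a : Fin (n + 1) → ℕ) :
    Set (((i : Fin (n + 1)) × Fin (a i + 1)) → k) :=
  {v | ∃ s t lam, v = scrollParam n a s t lam}

/-- Global sections of `O_Y(A·H + b·F)` on the scroll `Y = S(a₀, …, aₙ)`, realized as
bihomogeneous polynomials in `s, t` (the `ℙ¹`-coordinates) and `T₀, …, Tₙ` (the fiber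
coordinates): each monomial has total `T`-degree `A` and `(s,t)`-degree `b + Σ mᵢ aᵢ`. -/
def sectionSpace (k : Type) [Field k] (n : ℕ) (a : Fin (n + 1) → ℕ) (A b : ℤ) :
    Submodule k (MvPolynomial (Fin 2 ⊕ Fin (n + 1)) k) where
  carrier := {F | ∀ m ∈ F.support,
    ((∑ i, m (Sum.inr i) : ℕ) : ℤ) = A ∧
    ((m (Sum.inl 0) + m (Sum.inl 1) : ℕ) : ℤ)
      = b + ∑ i, (m (Sum.inr i) : ℤ) * (a i : ℤ)}
  add_mem' := by
    intro p q hp hq m hm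
    rcases Finset.mem_union.mp (MvPolynomial.support_add hm) with h | h
    · exact hp m h
    · exact hq m h
  zero_mem' := by
    intro m hm
    simp at hm
  smul_mem' := by
    intro c p hp m hm
    exact hp m (MvPolynomial.support_smul hm)

/-- The affine cone of the effective divisor `X ≡ A·H + b·F` on the scroll cut out by a
section `F`: the points of the scroll whose parameters are zeros of `F`. -/
def divisorCone (n : ℕ) (a : Fin (n + 1) → ℕ)
    (F : MvPolynomial (Fin 2 ⊕ Fin (n + 1)) k) :
    Set (((i : Fin (n + 1)) × Fin (a i + 1)) → k) :=
  {v | ∃ s t lam, v = scrollParam n a s t lam ∧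
     MvPolynomial.eval (Sum.elim (fun j : Fin 2 => if j = 0 then s else t) lam) F = 0}

end PaperQuadrics

set_option linter.unusedSectionVars false

namespace PaperQuadrics

section Height

variable {k : Type} [Field k] [IsAlgClosed k]

/-- The maximal ideal of a point of affine space has height equal to the number of variables. -/
theorem height_ker_algHom_mvPolynomial (s : ℕ) (φ : MvPolynomial (Fin s) k →ₐ[k] k) :
    (RingHom.ker φ).height = s := by
  have key : ∀ x y : Fin s → k,
      (RingHom.ker (aeval x : MvPolynomial (Fin s) k →ₐ[k] k)).height =
      (RingHom.ker (aeval y : MvPolynomial (Fin s) k →ₐ[k] k)).height := by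
    intro x y
    let τ : (Fin s → k) → (MvPolynomial (Fin s) k →ₐ[k] MvPolynomial (Fin s) k) :=
      fun z => aeval fun i => X i + C (z i)
    let e : MvPolynomial (Fin s) k ≃ₐ[k] MvPolynomial (Fin s) k :=
      AlgEquiv.ofAlgHom (τ (x - y)) (τ (y - x)) (by ext; simp [τ]; ring) (by ext; simp [τ]; ring)
    rw [← RingEquiv.height_comap e.toRingEquiv (RingHom.ker (aeval y))]
    congr 1
    have : (aeval y : MvPolynomial (Fin s) k →ₐ[k] k).comp (e : _ →ₐ[k] _) = aeval x := by
      ext i; simp [e, τ]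
    rw [← this]
    ext f
    simp [RingHom.mem_ker]
  have hφ : ∀ ψ : MvPolynomial (Fin s) k →ₐ[k] k,
      (RingHom.ker ψ).height = (RingHom.ker φ).height := by
    intro ψ
    rw [aeval_unique φ, aeval_unique ψ]
    exact key _ _
  have h1 := Ideal.sup_isMaximal_height_eq_ringKrullDim (R := MvPolynomial (Fin s) k)
  rw [MvPolynomial.ringKrullDim_of_isNoetherianRing, ringKrullDim_eq_zero_of_field] at h1
  have h2 : (⨆ (I : Ideal (MvPolynomial (Fin s) k)) (_ : I.IsMaximal), I.height) =
      (RingHom.ker φ).height := by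
    apply le_antisymm
    · refine iSup₂_le fun I hI => ?_
      obtain ⟨x, rfl⟩ := (isMaximal_iff_eq_vanishingIdeal_singleton (K := k)).1 hI
      rw [← hφ (aeval x)]
      refine le_of_eq (congrArg _ ?_)
      ext f; simp [RingHom.mem_ker]
    · refine le_iSup₂_of_le (RingHom.ker φ) ?_ le_rfl
      exact RingHom.ker_isMaximal_of_surjective _ fun c => ⟨C c, by simp⟩
  rw [h2] at h1
  have : ((RingHom.ker φ).height : WithBot ℕ∞) = ((s : ℕ∞) : WithBot ℕ∞) := by
    rw [h1]; simp
  exact_mod_cast this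

theorem ringKrullDim_le_of_isIntegral {R S : Type*} [CommRing R] [CommRing S] [Algebra R S]
    [Algebra.IsIntegral R S] : ringKrullDim S ≤ ringKrullDim R := by
  refine Order.krullDim_le_of_strictMono
    (fun P : PrimeSpectrum S => PrimeSpectrum.comap (algebraMap R S) P) ?_
  intro P Q h
  exact Ideal.IsIntegral.comap_lt_comap (R := R) (I := P.asIdeal) (J := Q.asIdeal) h

theorem ringKrullDim_le_height_ker {A : Type} [CommRing A] [IsDomain A] [Algebra k A]
    [Algebra.FiniteType k A] (φ : A →ₐ[k] k) : ringKrullDim A ≤ (RingHom.ker φ).height := by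
  obtain ⟨s, g, hg, hintegral⟩ := exists_integral_inj_algHom_of_fg k A
  have : IsNoetherianRing A := Algebra.FiniteType.isNoetherianRing k A
  algebraize [g.toRingHom]
  have hd : ringKrullDim A ≤ ringKrullDim (MvPolynomial (Fin s) k) := by
    have : Algebra.IsIntegral (MvPolynomial (Fin s) k) A := ⟨hintegral⟩
    exact ringKrullDim_le_of_isIntegral
  have : Algebra.IsIntegral (MvPolynomial (Fin s) k) A := ⟨hintegral⟩
  have : FaithfulSMul (MvPolynomial (Fin s) k) A :=
    (faithfulSMul_iff_algebraMap_injective _ _).2 hg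
  have hP : (RingHom.ker φ).IsPrime := RingHom.ker_isPrime _
  have hp : (RingHom.ker (φ.comp g)).IsPrime := RingHom.ker_isPrime _
  have hl : (RingHom.ker φ).LiesOver (RingHom.ker (φ.comp g)) := by
    constructor
    ext f
    simp only [RingHom.mem_ker, Ideal.mem_comap]
    rfl
  have := Ideal.height_eq_height_add_of_liesOver_of_hasGoingDown (RingHom.ker (φ.comp g))
      (RingHom.ker φ)
  rw [height_ker_algHom_mvPolynomial] at this
  rw [this]
  refine hd.trans ?_
  rw [MvPolynomial.ringKrullDim_of_isNoetherianRing, ringKrullDim_eq_zero_of_field]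
  simp only [Nat.card_eq_fintype_card, Fintype.card_fin, zero_add]
  exact_mod_cast (le_self_add : ((s : ℕ∞) ≤ _ ))

end Height

end PaperQuadrics

namespace PaperQuadrics

section LocalAlgebra

variable {B : Type*} [CommRing B]

theorem aeval_sub_mem_pow {k ι : Type*} [CommRing k] [Algebra k B] (m : Ideal B) (a b : ι → B)
    (ha : ∀ i, a i ∈ m) (hb : ∀ i, b i ∈ m) (hab : ∀ i, a i - b i ∈ m ^ 2)
    {G : MvPolynomial ι k} {j : ℕ} (hG : G.IsHomogeneous j) :
    aeval a G - aeval b G ∈ m ^ (j + 1) := by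
  have key : ∀ d : ι →₀ ℕ, (d.prod fun i n => a i ^ n) ∈ m ^ d.degree ∧
      (d.prod fun i n => b i ^ n) ∈ m ^ d.degree ∧
      (d.prod fun i n => a i ^ n) - (d.prod fun i n => b i ^ n) ∈ m ^ (d.degree + 1) := by
    have hstep : ∀ (p q : ℕ) (a₁ a₂ b₁ b₂ : B),
        (a₁ ∈ m ^ p ∧ b₁ ∈ m ^ p ∧ a₁ - b₁ ∈ m ^ (p + 1)) →
        (a₂ ∈ m ^ q ∧ b₂ ∈ m ^ q ∧ a₂ - b₂ ∈ m ^ (q + 1)) →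
        (a₁ * a₂ ∈ m ^ (p + q) ∧ b₁ * b₂ ∈ m ^ (p + q) ∧
          a₁ * a₂ - b₁ * b₂ ∈ m ^ (p + q + 1)) := by
      rintro p q a₁ a₂ b₁ b₂ ⟨h1, h2, h3⟩ ⟨h4, h5, h6⟩
      refine ⟨?_, ?_, ?_⟩
      · rw [pow_add]; exact Ideal.mul_mem_mul h1 h4
      · rw [pow_add]; exact Ideal.mul_mem_mul h2 h5
      · have e : a₁ * a₂ - b₁ * b₂ = (a₁ - b₁) * a₂ + b₁ * (a₂ - b₂) := by ring
        rw [e]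
        refine Ideal.add_mem _ ?_ ?_
        · rw [show p + q + 1 = (p + 1) + q by ring, pow_add]; exact Ideal.mul_mem_mul h3 h4
        · rw [show p + q + 1 = p + (q + 1) by ring, pow_add]; exact Ideal.mul_mem_mul h2 h6
    intro d
    induction d using Finsupp.induction_linear with
    | zero => simp
    | add f g hf hg =>
      classical
      rw [Finsupp.prod_add_index' (by simp) (by intros; rw [pow_add]),
        Finsupp.prod_add_index' (by simp) (by intros; rw [pow_add]), map_add]
      exact hstep _ _ _ _ _ _ hf hg
    | single i n =>
      rw [Finsupp.prod_single_index (by simp), Finsupp.prod_single_index (by simp),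
        Finsupp.degree_single]
      induction n with
      | zero => simp
      | succ n ih =>
        rw [pow_succ (a i), pow_succ (b i)]
        refine hstep n 1 _ _ _ _ ih ⟨?_, ?_, ?_⟩
        · simpa using ha i
        · simpa using hb i
        · exact hab i
  rw [aeval_def, aeval_def, eval₂_eq, eval₂_eq, ← Finset.sum_sub_distrib]
  refine Ideal.sum_mem _ fun d hd => ?_
  rw [← mul_sub]
  refine Ideal.mul_mem_left _ _ ?_
  have hd' := hG (mem_support_iff.1 hd)
  have hd' : d.degree = j := by rw [Finsupp.degree_eq_weight_one]; exact hd'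
  have := (key d).2.2
  rwa [hd'] at this

theorem exists_notMem_smul_pow_eq_zero [IsNoetherianRing B] (m : Ideal B) [m.IsPrime]
    (η : B) (j : ℕ)
    (hη : η ∈ m) (h : m ≤ Ideal.span {η} ⊔ m ^ 2) (hj : η ^ j ∈ m ^ (j + 1)) :
    ∃ r ∉ m, ∀ a ∈ m ^ j, r * a = 0 := by
  have h1 : ∀ i, m ^ i ≤ Ideal.span {η ^ i} ⊔ m ^ (i + 1) := by
    intro i
    induction i with
    | zero => simp
    | succ i ih =>
      have hηi : η ^ i ∈ m ^ i := Ideal.pow_mem_pow hη i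
      have hle : Ideal.span {η} ≤ m := (Ideal.span_singleton_le_iff_mem _).2 hη
      have hle' : Ideal.span {η ^ i} ≤ m ^ i := (Ideal.span_singleton_le_iff_mem _).2 hηi
      calc m ^ (i + 1) = m ^ i * m := pow_succ _ _
        _ ≤ (Ideal.span {η ^ i} ⊔ m ^ (i + 1)) * (Ideal.span {η} ⊔ m ^ 2) := Ideal.mul_mono ih h
        _ ≤ _ := by
          rw [Ideal.sup_mul, Ideal.mul_sup, Ideal.mul_sup, Ideal.span_singleton_mul_span_singleton,
            ← pow_succ]
          refine sup_le (sup_le le_sup_left (le_sup_of_le_right ?_)) (sup_le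
            (le_sup_of_le_right ?_) (le_sup_of_le_right ?_))
          · calc _ ≤ m ^ i * m ^ 2 := Ideal.mul_mono_left hle'
              _ = _ := by rw [← pow_add]
          · calc _ ≤ m ^ (i + 1) * m := Ideal.mul_mono_right hle
              _ = _ := by rw [← pow_succ]
          · rw [← pow_add]; exact Ideal.pow_le_pow_right (by omega)
  have h2 : m ^ j ≤ m • m ^ j := by
    rw [smul_eq_mul, ← pow_succ']
    refine (h1 j).trans (sup_le ((Ideal.span_singleton_le_iff_mem _).2 hj) le_rfl)
  obtain ⟨r, hr, hr'⟩ := Submodule.exists_sub_one_mem_and_smul_eq_zero_of_fg_of_le_smul m (m ^ j)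
    (IsNoetherian.noetherian _) h2
  refine ⟨r, fun hrm => ?_, hr'⟩
  exact Ideal.IsPrime.ne_top ‹_› ((Ideal.eq_top_iff_one _).2 (by simpa using m.sub_mem hrm hr))

end LocalAlgebra

section Setup

variable {k : Type} [Field k] {ι : Type} [Fintype ι] [DecidableEq ι]

theorem mem_vanIdeal {X : Set (ι → k)} {f : MvPolynomial ι k} :
    f ∈ vanIdeal k ι X ↔ ∀ x ∈ X, eval x f = 0 := by
  simp [vanIdeal, RingHom.mem_ker]

/-- The linear form on affine space attached to a dual vector. -/
def linForm : Module.Dual k (ι → k) →ₗ[k] MvPolynomial ι k where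
  toFun φ := ∑ i, φ (Pi.single i 1) • X i
  map_add' φ ψ := by simp [add_smul, Finset.sum_add_distrib]
  map_smul' c φ := by simp [mul_smul, Finset.smul_sum]

omit [DecidableEq ι] in
theorem dual_apply_eq_sum [DecidableEq ι] (φ : Module.Dual k (ι → k)) (x : ι → k) :
    ∑ i, φ (Pi.single i 1) * x i = φ x := by
  conv_rhs => rw [← Finset.univ_sum_single x]
  rw [map_sum]
  refine Finset.sum_congr rfl fun i _ => ?_
  rw [show (Pi.single i (x i) : ι → k) = x i • Pi.single i 1 by
    rw [← Pi.single_smul]; simp, map_smul, smul_eq_mul, mul_comm]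

@[simp] theorem eval_linForm (φ : Module.Dual k (ι → k)) (x : ι → k) :
    eval x (linForm φ) = φ x := by
  simp [linForm, smul_eval, dual_apply_eq_sum]

theorem aeval_linForm {A : Type*} [CommRing A] [Algebra k A] (φ : Module.Dual k (ι → k))
    (a : ι → A) : aeval a (linForm φ) = ∑ i, φ (Pi.single i 1) • a i := by
  simp [linForm]

theorem linForm_proj (i : ι) : linForm (LinearMap.proj i : Module.Dual k (ι → k)) = X i := by
  rw [linForm]
  simp [Pi.single_apply]

theorem linForm_isHomogeneous (φ : Module.Dual k (ι → k)) : (linForm φ).IsHomogeneous 1 := by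
  rw [← mem_homogeneousSubmodule]
  exact Submodule.sum_mem _ fun i _ => Submodule.smul_mem _ _ (isHomogeneous_X _ _)

/-- The homogeneous coordinate ring of a cone. -/
def CoordRing (Z : Set (ι → k)) : Type := MvPolynomial ι k ⧸ vanIdeal k ι Z

instance (Z : Set (ι → k)) : CommRing (CoordRing Z) :=
  inferInstanceAs (CommRing (MvPolynomial ι k ⧸ vanIdeal k ι Z))

instance (Z : Set (ι → k)) : Algebra k (CoordRing Z) :=
  inferInstanceAs (Algebra k (MvPolynomial ι k ⧸ vanIdeal k ι Z))

/-- The quotient map onto the coordinate ring. -/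
def mkR (Z : Set (ι → k)) : MvPolynomial ι k →ₐ[k] CoordRing Z :=
  Ideal.Quotient.mkₐ k (vanIdeal k ι Z)

theorem mkR_surjective (Z : Set (ι → k)) : Function.Surjective (mkR Z) :=
  Ideal.Quotient.mkₐ_surjective k _

theorem mkR_eq_zero {Z : Set (ι → k)} {f : MvPolynomial ι k} :
    mkR Z f = 0 ↔ f ∈ vanIdeal k ι Z := Ideal.Quotient.eq_zero_iff_mem

instance (Z : Set (ι → k)) : Algebra.FiniteType k (CoordRing Z) :=
  Algebra.FiniteType.of_surjective (mkR Z) (mkR_surjective Z)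

instance (Z : Set (ι → k)) : IsNoetherianRing (CoordRing Z) :=
  Algebra.FiniteType.isNoetherianRing k _

theorem isDomain_coordRing {Z : Set (ι → k)} (h : (vanIdeal k ι Z).IsPrime) :
    IsDomain (CoordRing Z) := Ideal.Quotient.isDomain (vanIdeal k ι Z)

variable (Z : Set (ι → k))

/-- The linear form attached to a dual vector, in the coordinate ring. -/
def lin : Module.Dual k (ι → k) →ₗ[k] CoordRing Z :=
  (mkR Z).toLinearMap ∘ₗ linForm

theorem mk_linForm (φ : Module.Dual k (ι → k)) :
    mkR Z (linForm φ) = lin Z φ := rfl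

variable {Z}

/-- Evaluation of elements of the coordinate ring at a point of the cone. -/
def ev {x : ι → k} (hx : x ∈ Z) : CoordRing Z →ₐ[k] k :=
  Ideal.Quotient.liftₐ (vanIdeal k ι Z) (aeval x) fun f hf => by
    simpa [aeval_eq_eval] using mem_vanIdeal.1 hf x hx

@[simp] theorem ev_mk {x : ι → k} (hx : x ∈ Z) (f : MvPolynomial ι k) :
    ev hx (mkR Z f) = eval x f := by
  rw [← aeval_eq_eval]; rfl

@[simp] theorem ev_lin {x : ι → k} (hx : x ∈ Z) (φ : Module.Dual k (ι → k)) :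
    ev hx (lin Z φ) = φ x := by
  rw [← mk_linForm, ev_mk, eval_linForm]

/-- The maximal ideal of a point. -/
def mI {x : ι → k} (hx : x ∈ Z) : Ideal (CoordRing Z) := RingHom.ker (ev hx)

theorem mem_mI {x : ι → k} {hx : x ∈ Z} {a : CoordRing Z} : a ∈ mI hx ↔ ev hx a = 0 :=
  RingHom.mem_ker

instance {x : ι → k} (hx : x ∈ Z) : (mI hx).IsPrime := RingHom.ker_isPrime _

variable (Z) in
/-- The linear form attached to a dual vector, recentred so as to vanish at `x`. -/
def clin (x : ι → k) : Module.Dual k (ι → k) →ₗ[k] CoordRing Z :=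
  lin Z - (Algebra.linearMap k (CoordRing Z)) ∘ₗ (LinearMap.applyₗ x)

theorem clin_apply (x : ι → k) (φ : Module.Dual k (ι → k)) :
    clin Z x φ = lin Z φ - algebraMap k _ (φ x) := rfl

theorem clin_mem_mI {x : ι → k} (hx : x ∈ Z) (φ : Module.Dual k (ι → k)) :
    clin Z x φ ∈ mI hx := by
  simp [mem_mI, clin_apply]

/-- The differential of a polynomial at a point. -/
def dif (x : ι → k) : MvPolynomial ι k →ₗ[k] Module.Dual k (ι → k) where
  toFun f := ∑ i, eval x (pderiv i f) • LinearMap.proj i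
  map_add' f g := by simp [add_smul, Finset.sum_add_distrib]
  map_smul' c f := by simp [mul_smul, Finset.smul_sum, smul_eval]

theorem dif_apply (x : ι → k) (f : MvPolynomial ι k) (v : ι → k) :
    dif x f v = ∑ i, eval x (pderiv i f) * v i := by
  simp [dif]

theorem dif_mul (x : ι → k) (f g : MvPolynomial ι k) :
    dif x (f * g) = eval x f • dif x g + eval x g • dif x f := by
  ext i
  simp [dif, Pi.single_apply, Derivation.leibniz]
  

theorem dif_X (x : ι → k) (i : ι) : dif x (X i : MvPolynomial ι k) = LinearMap.proj i := by
  ext j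
  simp [dif, pderiv_X, Pi.single_apply]

theorem dif_C (x : ι → k) (c : k) : dif x (C c : MvPolynomial ι k) = 0 := by
  ext j
  simp [dif]

/-- First-order Taylor expansion in the coordinate ring. -/
theorem taylor_mem {x : ι → k} (hx : x ∈ Z) (f : MvPolynomial ι k) :
    mkR Z f - algebraMap k (CoordRing Z) (eval x f) - clin Z x (dif x f)
      ∈ mI hx ^ 2 := by
  induction f using MvPolynomial.induction_on with
  | C a =>
    rw [dif_C, map_zero, eval_C]
    convert (mI hx ^ 2).zero_mem using 1
    rw [sub_zero, ← algebraMap_eq, AlgHom.commutes, sub_self]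
  | add f g hf hg =>
    convert Ideal.add_mem _ hf hg using 1
    simp only [map_add]
    ring
  | mul_X f i hf =>
    have h1 : mkR Z (X i) = clin Z x (LinearMap.proj i)
        + algebraMap k _ (x i) := by
      rw [clin_apply, ← mk_linForm, linForm_proj]; simp
    have hf' : mkR Z f - algebraMap k (CoordRing Z) (eval x f)
        ∈ mI hx := by simp [mem_mI]
    have h2 := Ideal.add_mem _ (Ideal.mul_mem_left _ (algebraMap k _ (x i)) hf)
      (pow_two (mI hx) ▸ Ideal.mul_mem_mul hf' (clin_mem_mI hx (LinearMap.proj i)))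
    convert h2 using 1
    rw [dif_mul, dif_X, map_mul, h1, map_add, map_smul, map_smul, eval_X, Algebra.smul_def,
      Algebra.smul_def]
    simp only [map_mul, eval_X]
    ring

variable (Z) in
/-- The conormal space at `x`. -/
def conormal (x : ι → k) : Submodule k (Module.Dual k (ι → k)) :=
  (Submodule.restrictScalars k (vanIdeal k ι Z)).map (dif x)

variable (Z) in
/-- The tangent space at `x`. -/
def tang (x : ι → k) : Submodule k (ι → k) := (conormal Z x).dualCoannihilator

theorem mem_tang {x v : ι → k} : v ∈ tang Z x ↔ ∀ f ∈ vanIdeal k ι Z, dif x f v = 0 := by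
  simp [tang, conormal, Submodule.mem_dualCoannihilator]

theorem tang_dualAnnihilator (x : ι → k) : (tang Z x).dualAnnihilator = conormal Z x :=
  Subspace.dualCoannihilator_dualAnnihilator_eq

theorem clin_mem_sq {x : ι → k} (hx : x ∈ Z) {φ : Module.Dual k (ι → k)}
    (hφ : φ ∈ (tang Z x).dualAnnihilator) : clin Z x φ ∈ mI hx ^ 2 := by
  rw [tang_dualAnnihilator] at hφ
  obtain ⟨f, hf, rfl⟩ := hφ
  have := taylor_mem hx f
  rw [mkR_eq_zero.2 hf, mem_vanIdeal.1 hf x hx] at this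
  simpa using this

theorem mI_eq_span {x : ι → k} (hx : x ∈ Z) : mI hx = Ideal.span (Set.range (clin Z x)) := by
  apply le_antisymm
  · intro a ha
    obtain ⟨f, rfl⟩ := mkR_surjective Z a
    rw [mem_mI, ev_mk] at ha
    have key : ∀ f : MvPolynomial ι k, mkR Z f - algebraMap k _ (eval x f)
        ∈ Ideal.span (Set.range (clin Z x)) := by
      intro f
      induction f using MvPolynomial.induction_on with
      | C a => rw [eval_C, ← algebraMap_eq, AlgHom.commutes, sub_self]; exact Ideal.zero_mem _
      | add f g hf hg =>
        convert Ideal.add_mem _ hf hg using 1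
        simp only [map_add]; ring
      | mul_X f i hf =>
        have h1 : mkR Z (X i) = clin Z x (LinearMap.proj i)
            + algebraMap k _ (x i) := by
          rw [clin_apply, ← mk_linForm, linForm_proj]; simp
        have h2 := Ideal.add_mem _ (Ideal.mul_mem_left _ (algebraMap k _ (x i)) hf)
          (Ideal.mul_mem_left _ (mkR Z f) (Ideal.subset_span ⟨LinearMap.proj i, rfl⟩))
        convert h2 using 1
        simp only [map_mul, eval_X, h1]
        ring
    simpa [ha] using key f
  · rw [Ideal.span_le]
    rintro _ ⟨φ, rfl⟩
    exact clin_mem_mI hx φ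

end Setup

end PaperQuadrics

namespace PaperQuadrics

section Setup

variable {k : Type} [Field k] {ι : Type} [Fintype ι] [DecidableEq ι]

/-- A smooth nondegenerate projective variety of dimension `n`, codimension `e` and
degree `e + 1`. -/
structure IsSmoothMinimal (Z : Set (ι → k)) (n e : ℕ) : Prop where
  proj : IsProjVariety k ι Z
  nondeg : Nondeg k ι Z
  dim : HasDim k ι Z n
  deg : HasDegree k ι Z n (e + 1)
  smooth : IsSmoothOfCodim k ι Z e
  card : Fintype.card ι = n + e + 1

variable {Z : Set (ι → k)} {n e : ℕ}

theorem IsSmoothMinimal.isDomain (h : IsSmoothMinimal Z n e) : IsDomain (CoordRing Z) :=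
  isDomain_coordRing h.proj.prime

theorem IsSmoothMinimal.finrank_conormal (h : IsSmoothMinimal Z n e) {x : ι → k} (hx : x ∈ Z)
    (hx0 : x ≠ 0) : Module.finrank k (conormal Z x) = e := by
  rw [← h.smooth x hx hx0]
  let D : (ι → k) →ₗ[k] Module.Dual k (ι → k) :=
    { toFun := fun v => ∑ i, v i • LinearMap.proj i
      map_add' := fun v w => by simp [add_smul, Finset.sum_add_distrib]
      map_smul' := fun c v => by simp [mul_smul, Finset.smul_sum] }
  have hD : Function.Injective D := by
    refine (injective_iff_map_eq_zero _).2 fun v hv => ?_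
    ext i
    have := LinearMap.congr_fun hv (Pi.single i 1)
    simpa [D, Pi.single_apply] using this
  have : conormal Z x = (Submodule.span k
      {v : ι → k | ∃ f ∈ vanIdeal k ι Z,
        v = fun i => MvPolynomial.eval x (MvPolynomial.pderiv i f)}).map D := by
    rw [Submodule.map_span]
    apply le_antisymm
    · rintro _ ⟨f, hf, rfl⟩
      exact Submodule.subset_span ⟨_, ⟨f, hf, rfl⟩, rfl⟩
    · rw [Submodule.span_le]
      rintro _ ⟨_, ⟨f, hf, rfl⟩, rfl⟩
      exact ⟨f, hf, rfl⟩
  rw [this]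
  exact (Submodule.equivMapOfInjective D hD _).finrank_eq.symm

theorem IsSmoothMinimal.finrank_tang (h : IsSmoothMinimal Z n e) {x : ι → k} (hx : x ∈ Z)
    (hx0 : x ≠ 0) : Module.finrank k (tang Z x) = n + 1 := by
  have h1 := Subspace.finrank_add_finrank_dualAnnihilator_eq (tang Z x)
  rw [tang_dualAnnihilator, h.finrank_conormal hx hx0, Module.finrank_fintype_fun_eq_card,
    h.card] at h1
  omega

theorem IsSmoothMinimal.lt_height [IsAlgClosed k] (h : IsSmoothMinimal Z n e) {x : ι → k}
    (hx : x ∈ Z) : (n : ℕ∞) < (mI hx).height := by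
  have := h.isDomain
  have h1 := ringKrullDim_le_height_ker (ev hx)
  have h2 : ringKrullDim (CoordRing Z) = (n + 1 : ℕ) := h.dim
  rw [h2] at h1
  have h3 : ((n + 1 : ℕ) : ℕ∞) ≤ (mI hx).height := by
    change ((n + 1 : ℕ) : ℕ∞) ≤ (RingHom.ker (ev hx)).height
    exact_mod_cast h1
  refine lt_of_lt_of_le ?_ h3
  exact_mod_cast Nat.lt_succ_self n

theorem exists_complement_annihilator_aux {V : Type*} [AddCommGroup V] [Module k V]
    [FiniteDimensional k V] (T : Submodule k V) (v : V) (hv : v ∈ T) (hv0 : v ≠ 0) :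
    ∃ N : Submodule k (Module.Dual k V), (∀ φ ∈ N, φ v = 0) ∧
      (∀ φ : Module.Dual k V, φ v = 0 → φ ∈ N ⊔ T.dualAnnihilator) ∧
      Module.finrank k N + 1 = Module.finrank k T := by
  obtain ⟨N₀, hN₀⟩ := exists_isCompl T.dualAnnihilator
  let S : Submodule k V := Submodule.span k {v}
  have hS : S ≤ T := (Submodule.span_singleton_le_iff_mem _ _).2 hv
  have hS' : T.dualAnnihilator ≤ S.dualAnnihilator := Submodule.dualAnnihilator_anti hS
  have hmem : ∀ φ : Module.Dual k V, φ ∈ S.dualAnnihilator ↔ φ v = 0 := by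
    intro φ
    rw [Submodule.mem_dualAnnihilator]
    refine ⟨fun h => h v (Submodule.mem_span_singleton_self v), fun h w hw => ?_⟩
    obtain ⟨c, rfl⟩ := Submodule.mem_span_singleton.1 hw
    simp [h]
  have hsup : T.dualAnnihilator ⊔ N₀ ⊓ S.dualAnnihilator = S.dualAnnihilator := by
    rw [← sup_inf_assoc_of_le _ hS', hN₀.sup_eq_top, top_inf_eq]
  refine ⟨N₀ ⊓ S.dualAnnihilator, fun φ hφ => (hmem φ).1 hφ.2, fun φ hφ => ?_, ?_⟩
  · rw [sup_comm, hsup]; exact (hmem φ).2 hφ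
  · have h1 := Submodule.finrank_sup_add_finrank_inf_eq T.dualAnnihilator (N₀ ⊓ S.dualAnnihilator)
    have h2 : T.dualAnnihilator ⊓ (N₀ ⊓ S.dualAnnihilator) = ⊥ := by
      rw [← inf_assoc, hN₀.inf_eq_bot, bot_inf_eq]
    rw [hsup, h2, finrank_bot] at h1
    have h3 := Subspace.finrank_add_finrank_dualAnnihilator_eq T
    have h4 := Subspace.finrank_add_finrank_dualAnnihilator_eq S
    have h5 : Module.finrank k S = 1 := finrank_span_singleton hv0
    omega

/-- A dual vector space is spanned modulo the annihilator of `T` by few vectors of `v^⊥`. -/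
theorem exists_complement_annihilator {V : Type*} [AddCommGroup V] [Module k V]
    [FiniteDimensional k V] (T : Submodule k V) (v : V) (hv : v ∈ T) (hv0 : v ≠ 0) {r : ℕ}
    (hr : Module.finrank k T = r + 1) :
    ∃ b : Fin r → Module.Dual k V, (∀ i, b i v = 0) ∧
      (∀ φ : Module.Dual k V, φ v = 0 → φ ∈ Submodule.span k
          (Set.range b) ⊔ T.dualAnnihilator) := by
  obtain ⟨N, h0, h1, h2⟩ := exists_complement_annihilator_aux T v hv hv0
  have : Module.Free k N := Module.Free.of_divisionRing k N
  let b := Module.finBasisOfFinrankEq k N (n := r) (by omega)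
  refine ⟨fun i => b i, fun i => h0 _ (b i).2, ?_⟩
  have : Submodule.span k (Set.range fun i => (b i : Module.Dual k V)) = N := by
    rw [Set.range_comp' (Subtype.val) b]
    change Submodule.span k (N.subtype '' _) = _
    rw [← Submodule.map_span, b.span_eq, Submodule.map_top, Submodule.range_subtype]
  rw [this]
  exact h1

theorem aeval_mul_const {R A σ : Type*} [CommRing R] [CommRing A] [Algebra R A]
    {G : MvPolynomial σ R} {j : ℕ} (hG : G.IsHomogeneous j) (a : σ → A) (t : A) :
    aeval (fun i => a i * t) G = aeval a G * t ^ j := by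
  rw [aeval_def, aeval_def, eval₂_eq, eval₂_eq, Finset.sum_mul]
  refine Finset.sum_congr rfl fun d hd => ?_
  have hd' : d.degree = j := by
    rw [Finsupp.degree_eq_weight_one]; exact hG (mem_support_iff.1 hd)
  simp_rw [mul_pow]
  rw [Finset.prod_mul_distrib, Finset.prod_pow_eq_pow_sum, mul_assoc]
  congr 3

theorem mem_minimalPrimes_of_aeval_mem {A σ : Type*} [CommRing A] [IsNoetherianRing A] [Algebra k A]
    (m 𝔞 : Ideal A) [m.IsPrime] (h𝔞 : 𝔞 ≤ m) (a : σ → A) (ha : ∀ i, a i ∈ m) (η : A) (hη : η ∈ m)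
    (v : σ → k) (hav : ∀ i, a i - algebraMap k A (v i) * η ∈ 𝔞 ⊔ m ^ 2)
    (hm : m ≤ Ideal.span {η} ⊔ (𝔞 ⊔ m ^ 2)) {G : MvPolynomial σ k} {j : ℕ} (hG : G.IsHomogeneous j)
    (hGm : aeval a G ∈ m ^ (j + 1)) (hne : eval v G ≠ 0) : m ∈ 𝔞.minimalPrimes := by
  let q := Ideal.Quotient.mkₐ k 𝔞
  have hq : Function.Surjective q := Ideal.Quotient.mkₐ_surjective k 𝔞
  have hker : RingHom.ker q = 𝔞 := Ideal.Quotient.mkₐ_ker k 𝔞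
  let M := m.map q
  have hMp : M.IsPrime := Ideal.map_isPrime_of_surjective hq (by rw [hker]; exact h𝔞)
  have hMpow : ∀ i, ∀ a ∈ m ^ i, q a ∈ M ^ i := by
    intro i a ha
    rw [← Ideal.map_pow]
    exact Ideal.mem_map_of_mem q ha
  have hq𝔞 : ∀ a ∈ 𝔞, q a = 0 := fun a ha => by
    have : a ∈ RingHom.ker q := by rw [hker]; exact ha
    exact this
  have hqsup : ∀ a ∈ 𝔞 ⊔ m ^ 2, q a ∈ M ^ 2 := by
    intro a ha
    obtain ⟨α, hα, β, hβ, rfl⟩ := Submodule.mem_sup.1 ha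
    rw [map_add, hq𝔞 α hα, zero_add]
    exact hMpow 2 β hβ
  have hηM : q η ∈ M := Ideal.mem_map_of_mem q hη
  have hM1 : M ≤ Ideal.span {q η} ⊔ M ^ 2 := by
    refine Ideal.map_le_iff_le_comap.2 (hm.trans (sup_le ?_ fun a ha => ?_))
    · rw [Ideal.span_singleton_le_iff_mem]
      exact Ideal.mem_sup_left (Ideal.mem_span_singleton_self (q η))
    · exact Ideal.mem_sup_right (hqsup a ha)
  have hM2 : q η ^ j ∈ M ^ (j + 1) := by
    have h1 := aeval_sub_mem_pow (k := k) M (fun i => q (a i))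
      (fun i => algebraMap k _ (v i) * q η)
      (fun i => Ideal.mem_map_of_mem q (ha i)) (fun i => Ideal.mul_mem_left _ _ hηM)
      (fun i => by
        have := hqsup _ (hav i)
        rwa [map_sub, map_mul, AlgHom.commutes] at this) hG
    have h2 : aeval (fun i => q (a i)) G ∈ M ^ (j + 1) := by
      have := hMpow _ _ hGm
      rwa [comp_aeval_apply] at this
    have h3 : aeval (fun i => algebraMap k _ (v i) * q η) G ∈ M ^ (j + 1) := by
      have := Ideal.sub_mem _ h2 h1
      rwa [sub_sub_cancel] at this
    rw [aeval_mul_const hG (fun i => algebraMap k (A ⧸ 𝔞) (v i))] at h3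
    have h4 : aeval (fun i => algebraMap k (A ⧸ 𝔞) (v i)) G = algebraMap k _ (eval v G) := by
      rw [← aeval_eq_eval]
      exact aeval_algebraMap_apply _ v G
    rw [h4] at h3
    have h5 := Ideal.mul_mem_left _ (algebraMap k _ (eval v G)⁻¹) h3
    rwa [← mul_assoc, ← map_mul, inv_mul_cancel₀ hne, map_one, one_mul] at h5
  obtain ⟨r, hr, hr'⟩ := exists_notMem_smul_pow_eq_zero M (q η) j hηM hM1 hM2
  obtain ⟨r, rfl⟩ := hq r
  have hrm : r ∉ m := fun h => hr (Ideal.mem_map_of_mem q h)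
  refine ⟨⟨inferInstance, h𝔞⟩, ?_⟩
  rintro P ⟨hP, hP𝔞⟩ hPm
  intro a ha
  have h1 : r * a ^ j ∈ P := by
    apply hP𝔞
    rw [← hker, RingHom.mem_ker, map_mul]
    exact hr' _ (hMpow j _ (Ideal.pow_mem_pow ha j))
  rcases hP.mem_or_mem h1 with h2 | h2
  · exact absurd (hPm h2) hrm
  · exact hP.mem_of_pow_mem _ h2

/-- Local independence: a form in the recentred coordinates which vanishes to order higher than
its degree vanishes on the tangent space. -/
theorem IsSmoothMinimal.eval_eq_zero_of_mem_pow [IsAlgClosed k] (h : IsSmoothMinimal Z n e)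
    {x : ι → k} (hx : x ∈ Z) (hx0 : x ≠ 0) {G : MvPolynomial ι k} {j : ℕ} (hG : G.IsHomogeneous j)
    (hGm : aeval (fun i => clin Z x (LinearMap.proj i)) G ∈ mI hx ^ (j + 1))
    {v : ι → k} (hv : v ∈ tang Z x) : eval v G = 0 := by
  by_contra hne
  have hmtop : mI hx ≠ ⊤ := Ideal.IsPrime.ne_top inferInstance
  by_cases hv0 : v = 0
  · subst hv0
    obtain rfl | hj := Nat.eq_zero_or_pos j
    · obtain ⟨c, rfl⟩ : ∃ c, G = C c :=
        ⟨_, totalDegree_eq_zero_iff_eq_C.1 ((totalDegree_zero_iff_isHomogeneous _).2 hG)⟩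
      rw [zero_add, pow_one, ← algebraMap_eq, AlgHom.commutes, mem_mI, AlgHom.commutes] at hGm
      apply hne
      rw [eval_C]
      exact hGm
    · apply hne
      have := aeval_mul_const hG (0 : ι → k) 0
      rw [zero_pow hj.ne', mul_zero] at this
      convert this using 1
      simp
  obtain ⟨b, hb0, hb⟩ := exists_complement_annihilator (tang Z x) v hv hv0
    (h.finrank_tang hx hx0)
  obtain ⟨ξ, hξ⟩ : ∃ ξ : Module.Dual k (ι → k), ξ v = 1 := by
    obtain ⟨i, hi⟩ := Function.ne_iff.1 hv0
    exact ⟨(v i)⁻¹ • LinearMap.proj i, by simpa using inv_mul_cancel₀ hi⟩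
  set 𝔞 : Ideal (CoordRing Z) := Ideal.span (Set.range fun i => clin Z x (b i)) with h𝔞
  have hN𝔞 : ∀ φ ∈ Submodule.span k (Set.range b), clin Z x φ ∈ 𝔞 := by
    intro φ hφ
    have : Submodule.span k (Set.range b) ≤ (𝔞.restrictScalars k).comap (clin Z x) := by
      rw [Submodule.span_le]
      rintro _ ⟨i, rfl⟩
      exact Ideal.subset_span ⟨i, rfl⟩
    exact this hφ
  have h𝔞m : 𝔞 ≤ mI hx := by
    rw [h𝔞, Ideal.span_le]
    rintro _ ⟨i, rfl⟩
    exact clin_mem_mI hx _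
  have hdec : ∀ φ : Module.Dual k (ι → k),
      clin Z x φ - algebraMap k _ (φ v) * clin Z x ξ ∈ 𝔞 ⊔ mI hx ^ 2 := by
    intro φ
    obtain ⟨α, hα, β, hβ, hαβ⟩ := Submodule.mem_sup.1 (hb (φ - φ v • ξ) (by simp [hξ]))
    have h2 : clin Z x φ - algebraMap k _ (φ v) * clin Z x ξ = clin Z x α + clin Z x β := by
      rw [← map_add, hαβ, map_sub, map_smul, Algebra.smul_def]
    rw [h2]
    exact Submodule.add_mem_sup (hN𝔞 α hα) (clin_mem_sq hx hβ)
  have hm : mI hx ≤ Ideal.span {clin Z x ξ} ⊔ (𝔞 ⊔ mI hx ^ 2) := by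
    refine (mI_eq_span hx).trans_le (Ideal.span_le.2 ?_)
    rintro _ ⟨φ, rfl⟩
    have := Submodule.add_mem_sup (Ideal.mul_mem_left _ (algebraMap k _ (φ v))
      (Ideal.mem_span_singleton_self (clin Z x ξ))) (hdec φ)
    rwa [add_sub_cancel] at this
  have hav : ∀ i, clin Z x (LinearMap.proj i) - algebraMap k _ (v i) * clin Z x ξ ∈
      𝔞 ⊔ mI hx ^ 2 := fun i => hdec (LinearMap.proj i)
  have hmin : mI hx ∈ 𝔞.minimalPrimes :=
    mem_minimalPrimes_of_aeval_mem (k := k) (σ := ι) (mI hx) 𝔞 h𝔞m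
      (fun i => clin Z x (LinearMap.proj i)) (fun i => clin_mem_mI hx _)
      (clin Z x ξ) (clin_mem_mI hx ξ) v hav hm (G := G) (j := j) hG hGm hne
  have h1 := Ideal.height_le_card_of_mem_minimalPrimes_span (Set.finite_range _) hmin
  have h2 := h.lt_height hx
  have h3 : (Set.range fun i => clin Z x (b i)).ncard ≤ n := by
    rw [← Nat.card_coe_set_eq]
    refine (Finite.card_range_le _).trans ?_
    rw [Nat.card_eq_fintype_card, Fintype.card_fin]
  exact absurd (h2.trans_le (h1.trans (by exact_mod_cast h3))) (lt_irrefl _)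

end Setup

end PaperQuadrics

namespace PaperQuadrics

section Counting

variable {k : Type} [Field k]

/-- The number of monomials of degree `m` in `r` variables. -/
def formDim (r m : ℕ) : ℕ := (r + m - 1).choose m

theorem finrank_homogeneousSubmodule (σ : Type*) [Fintype σ] (m : ℕ) :
    Module.finrank k (homogeneousSubmodule σ k m) = formDim (Fintype.card σ) m := by
  classical
  rw [homogeneousSubmodule_eq_finsupp_supported,
    (AddMonoidAlgebra.supportedEquivFinsupp (R := k) (S := k)
        {d : σ →₀ ℕ | d.degree = m}).finrank_eq]
  have hset : {d : σ →₀ ℕ | d.degree = m} = ↑(Finset.univ.finsuppAntidiag m : Finset (σ →₀ ℕ)) := by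
    ext d
    simp [Finset.mem_finsuppAntidiag, Finsupp.degree_eq_sum]
  rw [hset, Module.finrank_finsupp_self, ← Nat.card_eq_fintype_card, Nat.card_coe_set_eq,
      Set.ncard_coe_finset,
    Finset.card_finsuppAntidiag_nat_eq_choose, formDim, Finset.card_univ]

theorem formDim_succ_mono (n : ℕ) : Monotone (formDim (n + 1)) := by
  intro a b h
  have : ∀ m, formDim (n + 1) m = (n + m).choose n := by
    intro m
    rw [formDim, show n + 1 + m - 1 = n + m by omega, Nat.choose_symm_add]
  rw [this, this]
  exact Nat.choose_le_choose _ (by omega)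

theorem pow_le_formDim (n m : ℕ) : (m : ℝ) ^ n ≤ n.factorial * formDim (n + 1) m := by
  have h := Nat.pow_le_choose (α := ℝ) n (n + m)
  rw [formDim, show n + 1 + m - 1 = n + m by omega, ← Nat.choose_symm_add]
  rw [show n + m + 1 - n = m + 1 by omega, div_le_iff₀ (by positivity)] at h
  push_cast at h
  calc (m : ℝ) ^ n ≤ (m + 1) ^ n := by gcongr; linarith
    _ ≤ _ := by rw [mul_comm]; exact h

end Counting

theorem degree_eq_of_mem_support {σ R : Type*} [CommSemiring R] {G : MvPolynomial σ R} {m : ℕ}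
    (hG : G.IsHomogeneous m) {d : σ →₀ ℕ} (hd : d ∈ G.support) : d.degree = m := by
  rw [Finsupp.degree_eq_weight_one]
  exact hG (mem_support_iff.1 hd)

theorem totalDegree_aeval_le_of_isHomogeneous {σ τ R : Type*} [CommRing R]
    {f : σ → MvPolynomial τ R}
    (hf : ∀ i, (f i).totalDegree ≤ 1) {G : MvPolynomial σ R} {m : ℕ} (hG : G.IsHomogeneous m) :
    (aeval f G).totalDegree ≤ m := by
  rw [aeval_def, eval₂_eq]
  refine totalDegree_finsetSum_le fun d hd => ?_
  rw [← Algebra.smul_def]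
  refine (totalDegree_smul_le _ _).trans ((totalDegree_finsetProd _ _).trans ?_)
  rw [← degree_eq_of_mem_support hG hd, Finsupp.degree]
  refine Finset.sum_le_sum fun i _ => (totalDegree_pow _ _).trans ?_
  simpa using Nat.mul_le_mul_left (d i) (hf i)

section LinAlg

variable {k : Type} [Field k] {V : Type*} [AddCommGroup V] [Module k V] [FiniteDimensional k V]

theorem exists_dual_family (T U : Submodule k V) (h : Disjoint T U) {r : ℕ}
    (hr : Module.finrank k T = r) :
    ∃ φ : Fin r → Module.Dual k V, (∀ i, φ i ∈ U.dualAnnihilator) ∧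
      ∀ w : Fin r → k, ∃ v ∈ T, ∀ i, φ i v = w i := by
  obtain ⟨Q, hUQ, hQ⟩ := h.symm.exists_isCompl
  let e := (Module.finBasisOfFinrankEq k T hr).equivFun
  let Φ : V →ₗ[k] (Fin r → k) := LinearMap.ofIsCompl hQ.symm e.toLinearMap 0
  refine ⟨fun i => LinearMap.proj i ∘ₗ Φ, fun i => ?_, fun w => ⟨e.symm w, (e.symm w).2,
      fun i => ?_⟩⟩
  · rw [Submodule.mem_dualAnnihilator]
    intro u hu
    have : Φ u = 0 := LinearMap.ofIsCompl_apply_right hQ.symm ⟨u, hUQ hu⟩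
    simp [this]
  · have : Φ (e.symm w) = e (e.symm w) := LinearMap.ofIsCompl_apply_left hQ.symm _
    simp [this]

theorem exists_dual_eq_one {U : Submodule k V} {x : V} (h : x ∉ U) :
    ∃ φ ∈ U.dualAnnihilator, φ x = 1 := by
  obtain ⟨f, hf, hf'⟩ := Submodule.exists_dual_map_eq_bot_of_notMem h inferInstance
  refine ⟨(f x)⁻¹ • f, ?_, by simpa using inv_mul_cancel₀ hf⟩
  rw [Submodule.mem_dualAnnihilator]
  intro u hu
  have : f u ∈ U.map f := Submodule.mem_map_of_mem hu
  rw [hf', Submodule.mem_bot] at this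
  simp [this]

end LinAlg

section Setup

variable {k : Type} [Field k] {ι : Type} [Fintype ι] [DecidableEq ι] {Z : Set (ι → k)}

theorem aeval_clin_aeval_linForm {σ : Type*} (x : ι → k) (φ : σ → Module.Dual k (ι → k))
    (G : MvPolynomial σ k) :
    aeval (fun i => clin Z x (LinearMap.proj i)) (aeval (fun i => linForm (φ i)) G) =
      aeval (fun i => clin Z x (φ i)) G := by
  rw [comp_aeval_apply]
  congr 2
  funext i
  rw [aeval_linForm]
  simp_rw [← map_smul]
  rw [← map_sum]
  congr 1
  ext j
  simp [Pi.single_apply]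

theorem IsSmoothMinimal.eval_eq_zero_of_mem_pow' [IsAlgClosed k] {n e : ℕ}
    (h : IsSmoothMinimal Z n e) {σ : Type*}
    {x : ι → k} (hx : x ∈ Z) (hx0 : x ≠ 0) (φ : σ → Module.Dual k (ι → k))
    {G : MvPolynomial σ k} {j : ℕ} (hG : G.IsHomogeneous j)
    (hGm : aeval (fun i => clin Z x (φ i)) G ∈ mI hx ^ (j + 1))
    {v : ι → k} (hv : v ∈ tang Z x) : eval (fun i => φ i v) G = 0 := by
  have := h.eval_eq_zero_of_mem_pow hx hx0
    (G := aeval (fun i => linForm (φ i)) G) (j := j) ?_ ?_ hv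
  · rw [← aeval_eq_eval, comp_aeval_apply] at this
    simpa [aeval_eq_eval] using this
  · have := hG.aeval (g := fun i => linForm (φ i)) (n := 1) (fun i => linForm_isHomogeneous _)
    rwa [one_mul] at this
  · rwa [aeval_clin_aeval_linForm]

theorem IsSmoothMinimal.eq_zero_of_aeval_clin_mem [IsAlgClosed k] {n e : ℕ}
    (h : IsSmoothMinimal Z n e) {σ : Type*} 
    {x : ι → k} (hx : x ∈ Z) (hx0 : x ≠ 0) (φ : σ → Module.Dual k (ι → k))
    (hφ : ∀ w : σ → k, ∃ v ∈ tang Z x, ∀ i, φ i v = w i)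
    {P : MvPolynomial σ k} {m : ℕ} (hPm : P.totalDegree < m)
    (hP : aeval (fun i => clin Z x (φ i)) P ∈ mI hx ^ m) : P = 0 := by
  have : Infinite k := IsAlgClosed.instInfinite
  have key : ∀ j, ∀ i < j, homogeneousComponent i P = 0 := by
    intro j
    induction j with
    | zero => intro i hi; omega
    | succ j ih =>
      intro i hi
      rcases Nat.lt_succ_iff_lt_or_eq.1 hi with hi | rfl
      · exact ih i hi
      by_cases hjm : m ≤ i
      · exact homogeneousComponent_eq_zero _ _ (hPm.trans_le hjm)
      push Not at hjm
      have hG := homogeneousComponent_isHomogeneous i P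
      have hmem : aeval (fun i => clin Z x (φ i)) (homogeneousComponent i P) ∈ mI hx ^ (i + 1) := by
        have h1 := sum_homogeneousComponent P
        have h2 : ∀ l, l ≠ i → aeval (fun i => clin Z x (φ i)) (homogeneousComponent l P)
            ∈ mI hx ^ (i + 1) := by
          intro l hl
          rcases lt_or_gt_of_ne hl with hl | hl
          · rw [ih l hl, map_zero]; exact Ideal.zero_mem _
          · refine Ideal.pow_le_pow_right (show i + 1 ≤ l by omega) ?_
            rw [aeval_def, eval₂_eq]
            refine Ideal.sum_mem _ fun d hd => Ideal.mul_mem_left _ _ ?_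
            have hd' := degree_eq_of_mem_support (homogeneousComponent_isHomogeneous l P) hd
            clear hd
            subst hd'
            rw [Finsupp.degree_apply, ← Finset.prod_pow_eq_pow_sum]
            exact Ideal.prod_mem_prod fun i _ => Ideal.pow_mem_pow (clin_mem_mI hx _) _
        have h3 : homogeneousComponent i P = P -
            ∑ l ∈ (Finset.range (P.totalDegree + 1)).erase i, homogeneousComponent l P := by
          rw [eq_sub_iff_add_eq]
          conv_rhs => rw [← h1]
          by_cases hi : i ∈ Finset.range (P.totalDegree + 1)
          · exact Finset.add_sum_erase _ (fun l => homogeneousComponent l P) hi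
          · rw [Finset.erase_eq_of_notMem hi, homogeneousComponent_eq_zero, zero_add]
            simp at hi; omega
        rw [h3, map_sub, map_sum]
        refine Ideal.sub_mem _ (Ideal.pow_le_pow_right (by omega) hP)
            (Ideal.sum_mem _ fun l hl => ?_)
        exact h2 l (Finset.ne_of_mem_erase hl)
      refine hG.eq_zero_of_forall_eval_eq_zero fun w => ?_
      obtain ⟨v, hv, hvw⟩ := hφ w
      rw [← funext hvw]
      exact h.eval_eq_zero_of_mem_pow' hx hx0 φ hG hmem hv
  rw [← sum_homogeneousComponent P]
  exact Finset.sum_eq_zero fun i _ => key (i + 1) i (Nat.lt_succ_self i)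

variable (Z) in
/-- The space of linear forms on the cone vanishing on a linear subspace. -/
def linSub (U : Submodule k (ι → k)) : Submodule k (CoordRing Z) := U.dualAnnihilator.map (lin Z)

theorem lin_mem_linSub {U : Submodule k (ι → k)} {φ : Module.Dual k (ι → k)}
    (h : φ ∈ U.dualAnnihilator) : lin Z φ ∈ linSub Z U := Submodule.mem_map_of_mem h

theorem linSub_anti {U U' : Submodule k (ι → k)} (h : U ≤ U') : linSub Z U' ≤ linSub Z U :=
  Submodule.map_mono (Submodule.dualAnnihilator_anti h)

instance (U : Submodule k (ι → k)) (m : ℕ) : FiniteDimensional k ↥(linSub Z U ^ m) := by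
  have : (linSub Z U).FG := (IsNoetherian.noetherian U.dualAnnihilator).map _
  exact Module.Finite.of_fg (this.pow m)

theorem lin_injective (h : Nondeg k ι Z) : Function.Injective (lin Z) := by
  refine (injective_iff_map_eq_zero _).2 fun φ hφ => ?_
  rw [← mk_linForm, mkR_eq_zero, mem_vanIdeal] at hφ
  have := h (linForm φ) (linForm_isHomogeneous φ) hφ
  ext i
  rw [LinearMap.comp_apply, ← eval_linForm, this]
  simp

theorem aeval_mem_pow {σ A : Type*} [CommRing A] [Algebra k A] (W : Submodule k A) {a : σ → A}
    (ha : ∀ i, a i ∈ W) {G : MvPolynomial σ k} {m : ℕ} (hG : G.IsHomogeneous m) :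
    aeval a G ∈ W ^ m := by
  rw [aeval_def, eval₂_eq]
  refine Submodule.sum_mem _ fun d hd => ?_
  rw [← Algebra.smul_def]
  refine Submodule.smul_mem _ _ ?_
  have hd' := degree_eq_of_mem_support hG hd
  clear hG hd
  subst hd'
  rw [Finsupp.degree_apply]
  induction d.support using Finset.cons_induction with
  | empty => simpa using ⟨1, map_one _⟩
  | cons i s hi ih =>
    rw [Finset.prod_cons, Finset.sum_cons, pow_add]
    exact Submodule.mul_mem_mul (Submodule.pow_mem_pow _ (ha i) _) ih

theorem mem_pow_of_mul_mem_pow {A : Type*} [CommRing A] {I : Ideal A} {y a : A} (hy : y - 1 ∈ I)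
    {m : ℕ} (h : y * a ∈ I ^ m) : a ∈ I ^ m := by
  have h1 : IsCoprime (Ideal.span {y}) (I ^ m) := by
    refine IsCoprime.pow_right (Ideal.isCoprime_iff_exists.2
      ⟨y, Ideal.mem_span_singleton_self y, 1 - y, ?_, by ring⟩)
    rw [← neg_sub]; exact I.neg_mem hy
  obtain ⟨i, hi, j, hj, hij⟩ := Ideal.isCoprime_iff_exists.1 h1
  obtain ⟨b, rfl⟩ := Ideal.mem_span_singleton'.1 hi
  have : a = b * (y * a) + j * a := by linear_combination (-a) * hij
  rw [this]
  exact Ideal.add_mem _ (Ideal.mul_mem_left _ _ h) (Ideal.mul_mem_right _ _ hj)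

theorem linSub_pow_le_mI_pow {x : ι → k} (hx : x ∈ Z) {U : Submodule k (ι → k)} (hxU : x ∈ U)
    (m : ℕ) {a : CoordRing Z} (ha : a ∈ linSub Z U ^ m) : a ∈ mI hx ^ m := by
  have h1 : linSub Z U ≤ (mI hx).restrictScalars k := by
    rintro _ ⟨φ, hφ, rfl⟩
    change lin Z φ ∈ mI hx
    rw [mem_mI, ev_lin]
    exact (Submodule.mem_dualAnnihilator _).1 hφ x hxU
  induction m generalizing a with
  | zero => simp
  | succ m ih =>
    rw [pow_succ] at ha
    induction ha using Submodule.mul_induction_on' with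
    | mem_mul_mem a ha b hb => rw [pow_succ]; exact Ideal.mul_mem_mul (ih ha) (h1 hb)
    | add a _ b _ ha hb => exact Ideal.add_mem _ ha hb

/-- Projecting from a point whose tangent space misses the centre of projection drops the
Hilbert function at least by the full contribution of that point. -/
theorem IsSmoothMinimal.finrank_linSub_pow_ge [IsAlgClosed k] {n e : ℕ}
    (h : IsSmoothMinimal Z n e) {x : ι → k} (hx : x ∈ Z) (hx0 : x ≠ 0)
    {U : Submodule k (ι → k)} (hxT : x ∈ tang Z x) (hU : Disjoint (tang Z x) U) (m : ℕ) :
    Module.finrank k ↥(linSub Z (U ⊔ Submodule.span k {x}) ^ (m + 1)) + formDim (n + 1) m ≤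
      Module.finrank k ↥(linSub Z U ^ (m + 1)) := by
  obtain ⟨φ, hφU, hφ⟩ := exists_dual_family (tang Z x) U hU (h.finrank_tang hx hx0)
  obtain ⟨y, hyU, hyx⟩ := exists_dual_eq_one
    (fun hxU : x ∈ U => hx0 (Submodule.disjoint_def.1 hU x hxT hxU))
  set U' := U ⊔ Submodule.span k {x}
  have hxU' : x ∈ U' := Submodule.mem_sup_right (Submodule.mem_span_singleton_self x)
  let L : homogeneousSubmodule (Fin (n + 1)) k m →ₗ[k] CoordRing Z :=
    LinearMap.mulLeft k (lin Z y) ∘ₗ (aeval fun i => lin Z (φ i)).toLinearMap ∘ₗ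
      (homogeneousSubmodule (Fin (n + 1)) k m).subtype
  have hL : ∀ G, L G = lin Z y * aeval (fun i => lin Z (φ i)) G.1 := fun G => rfl
  have hLU : LinearMap.range L ≤ linSub Z U ^ (m + 1) := by
    rintro _ ⟨G, rfl⟩
    rw [hL, pow_succ']
    exact Submodule.mul_mem_mul (lin_mem_linSub hyU)
      (aeval_mem_pow _ (fun i => lin_mem_linSub (hφU i)) G.2)
  have hL0 : ∀ G, L G ∈ mI hx ^ (m + 1) → G = 0 := by
    intro G hG
    have h1 : aeval (fun i => lin Z (φ i)) G.1 ∈ mI hx ^ (m + 1) :=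
      mem_pow_of_mul_mem_pow (y := lin Z y) (by simp [mem_mI, hyx]) hG
    let τ : MvPolynomial (Fin (n + 1)) k →ₐ[k] MvPolynomial (Fin (n + 1)) k :=
      aeval fun i => X i + C (φ i x)
    let τ' : MvPolynomial (Fin (n + 1)) k →ₐ[k] MvPolynomial (Fin (n + 1)) k :=
      aeval fun i => X i - C (φ i x)
    have hτ : ∀ G, τ' (τ G) = G := by
      intro G
      have : τ'.comp τ = AlgHom.id k _ := by ext i; simp [τ, τ']
      exact DFunLike.congr_fun this G
    have h2 : aeval (fun i => clin Z x (φ i)) (τ G.1) = aeval (fun i => lin Z (φ i)) G.1 := by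
      simp only [τ]
      rw [comp_aeval_apply]
      congr 2
      funext i
      rw [map_add, aeval_X, aeval_C, clin_apply, sub_add_cancel]
    have h3 : τ G.1 = 0 := by
      refine h.eq_zero_of_aeval_clin_mem hx hx0 φ hφ (m := m + 1) ?_ (by rwa [h2])
      rw [Nat.lt_succ_iff]
      refine totalDegree_aeval_le_of_isHomogeneous (fun i => ?_) G.2
      refine (totalDegree_add _ _).trans (max_le ?_ ?_)
      · rw [totalDegree_X]
      · rw [totalDegree_C]; exact zero_le_one
    have := hτ G.1
    rw [h3, map_zero] at this
    exact Subtype.ext this.symm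
  have hdisj : Disjoint (linSub Z U' ^ (m + 1)) (LinearMap.range L) := by
    rw [Submodule.disjoint_def]
    rintro _ h1 ⟨G, rfl⟩
    rw [hL0 G (linSub_pow_le_mI_pow hx hxU' _ h1), map_zero]
  have hinj : Function.Injective L := by
    refine (injective_iff_map_eq_zero _).2 fun G hG => hL0 G ?_
    rw [hG]; exact Ideal.zero_mem _
  have : FiniteDimensional k (homogeneousSubmodule (Fin (n + 1)) k m) :=
    Module.Finite.of_fg (homogeneousSubmodule_fg _ _ _)
  have h1 := Submodule.finrank_sup_add_finrank_inf_eq (linSub Z U' ^ (m + 1)) (LinearMap.range L)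
  rw [hdisj.eq_bot, finrank_bot, LinearMap.finrank_range_of_inj hinj, finrank_homogeneousSubmodule,
    Fintype.card_fin, add_zero] at h1
  rw [← h1]
  exact Submodule.finrank_mono (sup_le (pow_le_pow_left' (linSub_anti le_sup_left) _) hLU)

end Setup

end PaperQuadrics

namespace PaperQuadrics

section Setup

variable {k : Type} [Field k] {ι : Type} [Fintype ι] [DecidableEq ι] {Z : Set (ι → k)}

/-- The restriction of a polynomial to the parametrized line `t ↦ a + t b`. -/
def onLine (a b : ι → k) : MvPolynomial ι k →ₐ[k] Polynomial k :=
  aeval fun i => Polynomial.C (a i) + Polynomial.C (b i) * Polynomial.X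

theorem eval_onLine (a b : ι → k) (f : MvPolynomial ι k) (t : k) :
    (onLine a b f).eval t = eval (a + t • b) f := by
  have : (Polynomial.aeval t).comp (onLine a b) = aeval (a + t • b) := by
    ext i; simp [onLine]; ring
  have := DFunLike.congr_fun this f
  simpa [aeval_eq_eval] using this

theorem eval_derivative_onLine (a b : ι → k) (f : MvPolynomial ι k) (t : k) :
    (Polynomial.derivative (onLine a b f)).eval t = dif (a + t • b) f b := by
  induction f using MvPolynomial.induction_on with
  | C c =>
    rw [dif_C, ← algebraMap_eq, AlgHom.commutes]
    simp [← Polynomial.algebraMap_eq]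
  | add f g hf hg => simp [hf, hg]
  | mul_X f i hf =>
    rw [map_mul, Polynomial.derivative_mul, Polynomial.eval_add, Polynomial.eval_mul,
      Polynomial.eval_mul, hf, dif_mul, dif_X, eval_onLine, eval_onLine]
    simp [onLine]
    ring

theorem onLine_eq_zero_iff [Infinite k] {a b : ι → k} {f : MvPolynomial ι k} :
    onLine a b f = 0 ↔ ∀ t : k, eval (a + t • b) f = 0 := by
  constructor
  · intro h t; rw [← eval_onLine, h, Polynomial.eval_zero]
  · intro h; exact Polynomial.funext fun t => by rw [eval_onLine, h, Polynomial.eval_zero]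

theorem mem_tang_self [Infinite k] (hZ : IsProjVariety k ι Z) {x : ι → k} (hx : x ∈ Z) :
    x ∈ tang Z x := by
  rw [mem_tang]
  intro f hf
  have h : onLine 0 x f = 0 :=
    onLine_eq_zero_iff.2 fun t => mem_vanIdeal.1 hf _ (by simpa using hZ.smul_mem x hx t)
  have := eval_derivative_onLine 0 x f 1
  rw [h] at this
  simpa using this.symm

theorem IsSmoothMinimal.eval_quadric_eq_zero [IsAlgClosed k] {n e : ℕ}
    (h : IsSmoothMinimal Z n e) {x : ι → k} (hx : x ∈ Z) (hx0 : x ≠ 0) {q : MvPolynomial ι k}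
    (hq : q.IsHomogeneous 2) (hqI : q ∈ vanIdeal k ι Z) (hinv : ∀ v, eval (v - x) q = eval v q)
    {v : ι → k} (hv : v ∈ tang Z x) : eval v q = 0 := by
  have : Infinite k := IsAlgClosed.instInfinite
  refine h.eval_eq_zero_of_mem_pow hx hx0 hq ?_ hv
  have h1 : aeval (fun i => (X i : MvPolynomial ι k) - C (x i)) q = q := by
    refine MvPolynomial.funext fun v => ?_
    rw [← hinv, ← aeval_eq_eval, comp_aeval_apply, ← aeval_eq_eval]
    congr 2
    funext i
    simp
  have h2 : aeval (fun i => clin Z x (LinearMap.proj i)) q = 0 := by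
    rw [← mkR_eq_zero] at hqI
    rw [← h1, comp_aeval_apply] at hqI
    rw [← hqI]
    congr 2
    funext i
    rw [clin_apply, ← mk_linForm, linForm_proj, map_sub, ← algebraMap_eq, AlgHom.commutes]
    rfl
  rw [h2]
  exact Ideal.zero_mem _

theorem coeff_onLine_zero (x : ι → k) (f : MvPolynomial ι k) (j : ℕ) :
    (onLine 0 x f).coeff j = eval x (homogeneousComponent j f) := by
  have key : ∀ j (g : MvPolynomial ι k), g.IsHomogeneous j →
      onLine 0 x g = Polynomial.C (eval x g) * Polynomial.X ^ j := by
    intro j g hg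
    have := aeval_mul_const hg (fun i => Polynomial.C (x i)) Polynomial.X
    have h2 : aeval (fun i => Polynomial.C (x i)) g = Polynomial.C (eval x g) := by
      rw [← aeval_eq_eval]; exact aeval_algebraMap_apply _ x g
    rw [h2] at this
    rw [← this, onLine]
    simp
  conv_lhs => rw [← sum_homogeneousComponent f]
  rw [map_sum, Polynomial.finsetSum_coeff]
  simp_rw [key _ _ (homogeneousComponent_isHomogeneous _ f), Polynomial.coeff_C_mul_X_pow]
  rw [Finset.sum_ite_eq]
  split_ifs with h
  · rfl
  · rw [homogeneousComponent_eq_zero, map_zero]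
    simp at h; omega

theorem homogeneousComponent_mem_vanIdeal [Infinite k] (hZ : IsProjVariety k ι Z)
    {f : MvPolynomial ι k} (hf : f ∈ vanIdeal k ι Z) (j : ℕ) :
    homogeneousComponent j f ∈ vanIdeal k ι Z := by
  refine mem_vanIdeal.2 fun x hx => ?_
  have h : onLine 0 x f = 0 :=
    onLine_eq_zero_iff.2 fun t => mem_vanIdeal.1 hf _ (by simpa using hZ.smul_mem x hx t)
  rw [← coeff_onLine_zero, h, Polynomial.coeff_zero]

theorem linSub_bot_pow_le (m : ℕ) :
    linSub Z ⊥ ^ m ≤ (homogeneousSubmodule ι k m).map (mkR Z).toLinearMap := by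
  have h1 : linSub Z ⊥ ≤ (homogeneousSubmodule ι k 1).map (mkR Z).toLinearMap := by
    rintro _ ⟨φ, -, rfl⟩
    exact ⟨linForm φ, linForm_isHomogeneous φ, rfl⟩
  calc _ ≤ ((homogeneousSubmodule ι k 1).map (mkR Z).toLinearMap) ^ m := pow_le_pow_left' h1 m
    _ = _ := by rw [← Submodule.map_pow, homogeneousSubmodule_one_pow]

theorem finrank_linSub_bot_pow_le (m : ℕ) :
    Module.finrank k ↥(linSub Z ⊥ ^ m) ≤ hilb k ι Z m := by
  have : FiniteDimensional k (homogeneousSubmodule ι k m) :=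
    Module.Finite.of_fg (homogeneousSubmodule_fg _ _ _)
  refine (Submodule.finrank_mono (linSub_bot_pow_le m)).trans ?_
  let L := (mkR Z).toLinearMap ∘ₗ (homogeneousSubmodule ι k m).subtype
  have h1 : (homogeneousSubmodule ι k m).map (mkR Z).toLinearMap = LinearMap.range L := by
    rw [LinearMap.range_comp, Submodule.range_subtype]
  have h2 := LinearMap.finrank_range_add_finrank_ker L
  have h3 : (LinearMap.ker L).map (homogeneousSubmodule ι k m).subtype
      = idealPiece k ι (vanIdeal k ι Z) m := by
    ext f
    constructor
    · rintro ⟨g, hg, rfl⟩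
      exact ⟨mkR_eq_zero.1 hg, g.2⟩
    · rintro ⟨hf1, hf2⟩
      exact ⟨⟨f, hf2⟩, mkR_eq_zero.2 hf1, rfl⟩
  have h4 : Module.finrank k (LinearMap.ker L) =
      Module.finrank k (idealPiece k ι (vanIdeal k ι Z) m) := by
    rw [← h3]
    exact (Submodule.equivMapOfInjective _ (Submodule.subtype_injective _) _).finrank_eq
  rw [h1, hilb, idealHilb]
  omega

theorem IsSmoothMinimal.exists_finrank_lt {n e : ℕ} (h : IsSmoothMinimal Z n e) (s m₀ : ℕ) :
    ∃ m ≥ m₀, Module.finrank k ↥(linSub Z ⊥ ^ (m + s)) < (e + 2) * formDim (n + 1) m := by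
  by_contra! hcon
  have h1 : Filter.Tendsto (fun m : ℕ => (e + 2 : ℝ) * ((m : ℝ) / (m + s : ℕ)) ^ n) Filter.atTop
      (nhds ((e + 2) * 1 ^ n)) := by
    refine Filter.Tendsto.const_mul _ (Filter.Tendsto.pow ?_ n)
    have := tendsto_natCast_div_add_atTop (𝕜 := ℝ) (s : ℝ)
    simpa using this
  have h2 := h.deg.comp (Filter.tendsto_add_atTop_nat s)
  have h3 := le_of_tendsto_of_tendsto h1 h2 ?_
  · simp at h3
  · filter_upwards [Filter.eventually_ge_atTop (max m₀ 1)] with m hm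
    have hm0 : m₀ ≤ m := (le_max_left _ _).trans hm
    have hm1 : 1 ≤ m := (le_max_right _ _).trans hm
    have h4 : (e + 2) * formDim (n + 1) m ≤ hilb k ι Z (m + s) :=
      (hcon m hm0).trans (finrank_linSub_bot_pow_le _)
    have h5 : ((e : ℝ) + 2) * formDim (n + 1) m ≤ hilb k ι Z (m + s) := by exact_mod_cast h4
    have h6 := pow_le_formDim n m
    simp only [Function.comp_apply]
    have h7 : (0 : ℝ) < ((m + s : ℕ) : ℝ) ^ n := by
      have : 0 < m + s := by omega
      positivity
    rw [div_pow, mul_div_assoc', div_le_div_iff_of_pos_right h7]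
    calc ((e : ℝ) + 2) * (m : ℝ) ^ n ≤ (e + 2) * (n.factorial * formDim (n + 1) m) := by gcongr
      _ = ((e + 2) * formDim (n + 1) m) * n.factorial := by ring
      _ ≤ _ := by gcongr

end Setup

end PaperQuadrics

namespace PaperQuadrics

section Setup

variable {k : Type} [Field k] {ι : Type} [Fintype ι] [DecidableEq ι] {Z : Set (ι → k)}

theorem disjoint_sup_span_singleton {V : Type*} [AddCommGroup V] [Module k V] {S T : Submodule k V}
    (h : Disjoint S T) {x : V} (hx : x ∉ S ⊔ T) : Disjoint S (T ⊔ Submodule.span k {x}) := by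
  refine h.disjoint_sup_right_of_disjoint_sup_left ?_
  refine (Submodule.disjoint_span_singleton' fun h0 => hx ?_).2 hx
  rw [h0]; exact Submodule.zero_mem _

theorem finrank_sup_span_singleton_le {V : Type*} [AddCommGroup V] [Module k V]
    [FiniteDimensional k V] (S : Submodule k V) (x : V) :
    Module.finrank k ↥(S ⊔ Submodule.span k {x}) ≤ Module.finrank k S + 1 := by
  have h1 := Submodule.finrank_add_le_finrank_add_finrank S (Submodule.span k {x})
  have h2 : Module.finrank k (Submodule.span k {x}) ≤ 1 := by
    simpa using finrank_span_le_card (R := k) ({x} : Set V)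
  omega

/-- A property holding at the general point of a cone. -/
def Gen (Z : Set (ι → k)) (P : (ι → k) → Prop) : Prop :=
  ∃ g ∉ vanIdeal k ι Z, ∀ x ∈ Z, eval x g ≠ 0 → P x

theorem Gen.mono {P Q : (ι → k) → Prop} (h : Gen Z P) (hPQ : ∀ x, P x → Q x) : Gen Z Q := by
  obtain ⟨g, hg, h⟩ := h
  exact ⟨g, hg, fun x hx hgx => hPQ x (h x hx hgx)⟩

theorem Gen.and {P Q : (ι → k) → Prop} (hZ : (vanIdeal k ι Z).IsPrime) (hP : Gen Z P)
    (hQ : Gen Z Q) : Gen Z fun x => P x ∧ Q x := by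
  obtain ⟨g, hg, hP⟩ := hP
  obtain ⟨f, hf, hQ⟩ := hQ
  refine ⟨g * f, fun h => (hZ.mem_or_mem h).elim hg hf, fun x hx hgf => ?_⟩
  rw [map_mul] at hgf
  exact ⟨hP x hx (left_ne_zero_of_mul hgf), hQ x hx (right_ne_zero_of_mul hgf)⟩

theorem Gen.exists {P : (ι → k) → Prop} (hP : Gen Z P) : ∃ x ∈ Z, P x := by
  obtain ⟨g, hg, hP⟩ := hP
  rw [mem_vanIdeal] at hg
  push Not at hg
  obtain ⟨x, hx, hgx⟩ := hg
  exact ⟨x, hx, hP x hx hgx⟩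

theorem gen_true (hZ : (vanIdeal k ι Z).IsPrime) : Gen Z fun _ => True :=
  ⟨1, fun h => hZ.ne_top ((Ideal.eq_top_iff_one _).2 h), fun _ _ _ => trivial⟩

theorem gen_mem (hZ : (vanIdeal k ι Z).IsPrime) : Gen Z fun x => x ∈ Z :=
  ⟨1, fun h => hZ.ne_top ((Ideal.eq_top_iff_one _).2 h), fun _ hx _ => hx⟩

theorem gen_ev_ne_zero {a : CoordRing Z} (ha : a ≠ 0) :
    Gen Z fun x => ∀ hx : x ∈ Z, ev hx a ≠ 0 := by
  obtain ⟨f, rfl⟩ := mkR_surjective Z a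
  refine ⟨f, fun h => ha (mkR_eq_zero.2 h), fun x _ hx hxZ => ?_⟩
  rwa [ev_mk]

theorem gen_notMem (hZ : Nondeg k ι Z) {S : Submodule k (ι → k)}
    (hS : Module.finrank k S < Fintype.card ι) : Gen Z fun x => x ∉ S := by
  obtain ⟨v, hv⟩ : ∃ v, v ∉ S := by
    by_contra! h
    rw [(Submodule.eq_top_iff'.2 h), finrank_top, Module.finrank_fintype_fun_eq_card] at hS
    exact lt_irrefl _ hS
  obtain ⟨φ, hφ, hφv⟩ := exists_dual_eq_one hv
  have h0 : lin Z φ ≠ 0 := fun h0 => by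
    rw [(injective_iff_map_eq_zero _).1 (lin_injective hZ) φ h0] at hφv
    exact zero_ne_one hφv
  rw [← mk_linForm, Ne, mkR_eq_zero] at h0
  refine ⟨linForm φ, h0, fun x _ hx hxS => hx ?_⟩
  rw [eval_linForm]
  exact (Submodule.mem_dualAnnihilator _).1 hφ x hxS

end Setup

section CountGood

variable {k : Type} [Field k] {ι : Type} [Fintype ι] [DecidableEq ι] {Z : Set (ι → k)}

/-- The span of the vectors in a list. -/
def spanL (l : List (ι → k)) : Submodule k (ι → k) := Submodule.span k {x | x ∈ l}

theorem spanL_nil : spanL ([] : List (ι → k)) = ⊥ := by simp [spanL]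

theorem spanL_cons (x : ι → k) (l : List (ι → k)) :
    spanL (x :: l) = Submodule.span k {x} ⊔ spanL l := by
  rw [spanL, spanL, ← Submodule.span_union]
  congr 1
  ext y
  simp

theorem finrank_spanL_le (l : List (ι → k)) : Module.finrank k (spanL l) ≤ l.length := by
  induction l with
  | nil => simp [spanL_nil]
  | cons x l ih =>
    rw [spanL_cons, sup_comm, List.length_cons]
    exact (finrank_sup_span_singleton_le _ _).trans (by omega)

variable (Z) in
/-- Successive points of a list have tangent space disjoint from the span of the previous ones
together with `U`. -/
def CountGood : Submodule k (ι → k) → List (ι → k) → Prop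
  | _, [] => True
  | U, z :: l => (z ∈ Z ∧ z ≠ 0 ∧ Disjoint (tang Z z) U) ∧ CountGood (U ⊔ Submodule.span k {z}) l

theorem IsSmoothMinimal.finrank_ge_of_countGood [IsAlgClosed k] {n e : ℕ}
    (h : IsSmoothMinimal Z n e) {U : Submodule k (ι → k)} {l : List (ι → k)}
    (hl : CountGood Z U l) (m : ℕ) :
    Module.finrank k ↥(linSub Z (U ⊔ spanL l) ^ (m + 1)) + l.length * formDim (n + 1) m ≤
      Module.finrank k ↥(linSub Z U ^ (m + 1)) := by
  have : Infinite k := IsAlgClosed.instInfinite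
  induction l generalizing U with
  | nil => rw [spanL_nil, sup_bot_eq]; simp
  | cons z l ih =>
    obtain ⟨⟨h1, h2, h3⟩, h4⟩ := hl
    have := ih h4
    have h5 := h.finrank_linSub_pow_ge h1 h2 (mem_tang_self h.proj h1) h3 m
    rw [sup_assoc, ← spanL_cons] at this
    rw [List.length_cons, add_mul, one_mul]
    omega

theorem IsSmoothMinimal.gen_countGood_sup {n e : ℕ}
    (h : IsSmoothMinimal Z n e) {U : Submodule k (ι → k)} {l : List (ι → k)}
    (hl : CountGood Z U l) (hUl : Module.finrank k U + l.length ≤ e) :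
    Gen Z fun z => CountGood Z (U ⊔ Submodule.span k {z}) l := by
  induction l generalizing U with
  | nil => exact (gen_true h.proj.prime).mono fun _ _ => trivial
  | cons w l ih =>
    obtain ⟨⟨h1, h2, h3⟩, h4⟩ := hl
    rw [List.length_cons] at hUl
    have hw := finrank_sup_span_singleton_le U w
    have h5 := ih h4 (by omega)
    have h6 : Gen Z fun z => z ∉ tang Z w ⊔ U := by
      refine gen_notMem h.nondeg ?_
      have := Submodule.finrank_add_le_finrank_add_finrank (tang Z w) U
      rw [h.finrank_tang h1 h2] at this
      rw [h.card]; omega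
    refine (h5.and h.proj.prime h6).mono ?_
    rintro z ⟨h7, h8⟩
    refine ⟨⟨h1, h2, disjoint_sup_span_singleton h3 h8⟩, ?_⟩
    rwa [sup_right_comm]

theorem IsSmoothMinimal.gen_countGood_cons {n e : ℕ}
    (h : IsSmoothMinimal Z n e) {l : List (ι → k)}
    (hl : CountGood Z ⊥ l) (hle : l.length ≤ e) :
    Gen Z fun z => CountGood Z ⊥ (z :: l) := by
  have h0 : Gen Z fun z => z ∉ (⊥ : Submodule k (ι → k)) :=
    gen_notMem h.nondeg (by rw [finrank_bot, h.card]; omega)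
  refine (((h.gen_countGood_sup hl (by simpa using hle)).and h.proj.prime h0).and h.proj.prime
    (gen_mem h.proj.prime)).mono ?_
  rintro z ⟨⟨h1, h2⟩, h3⟩
  exact ⟨⟨h3, fun h => h2 (by simp [h]), disjoint_bot_right⟩, h1⟩

end CountGood

end PaperQuadrics

namespace PaperQuadrics

section Integral

variable {k : Type} [Field k] {A : Type} [CommRing A] [IsDomain A] [Algebra k A]

theorem isIntegral_of_pow_succ_le {S : Type*} [CommRing S] [Algebra k S] [Algebra S A]
    [IsScalarTower k S A] {W W3 : Submodule k A} (hfg : W.FG) (hW : W ≠ ⊥) {M : ℕ}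
    (hM : W ^ (M + 1) ≤ W3 * W ^ M) (h3 : ∀ u ∈ W3, ∃ s : S, algebraMap S A s = u) {w : A}
    (hw : w ∈ W) : IsIntegral S w := by
  obtain ⟨a, ha, ha0⟩ := Submodule.exists_mem_ne_zero_of_ne_bot hW
  refine isIntegral_of_smul_mem_submodule (M := A) (Submodule.span S (↑(W ^ M) : Set A)) ?_ ?_ w ?_
  · rw [Submodule.ne_bot_iff]
    exact ⟨a ^ M, Submodule.subset_span (Submodule.pow_mem_pow _ ha _), pow_ne_zero _ ha0⟩
  · obtain ⟨s, hs⟩ := hfg.pow M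
    refine ⟨s, ?_⟩
    rw [← hs, Submodule.span_span_of_tower]
  · intro b hb
    induction hb using Submodule.span_induction with
    | mem b hb =>
      have h1 : w * b ∈ W3 * W ^ M := hM (by
        rw [pow_succ']; exact Submodule.mul_mem_mul hw hb)
      rw [smul_eq_mul]
      refine Submodule.mul_induction_on h1 (fun u hu v hv => ?_) fun x y hx hy =>
        Submodule.add_mem _ hx hy
      obtain ⟨s, rfl⟩ := h3 u hu
      rw [← Algebra.smul_def]
      exact Submodule.smul_mem _ _ (Submodule.subset_span hv)
    | zero => simp
    | add x y _ _ hx hy => rw [smul_add]; exact Submodule.add_mem _ hx hy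
    | smul s x _ hx => rw [smul_comm]; exact Submodule.smul_mem _ _ hx

theorem proj_aeval_mul_mem {W W3 : Submodule k A} (h3W : W3 ≤ W) {σ : Type*} {t : σ → A}
    (ht : ∀ i, t i ∈ W3) {π : ℕ → A →ₗ[k] A}
    (hπ : ∀ i j a, a ∈ W ^ j → π i a = if i = j then a else 0) {w : A} (hw : w ∈ W)
    (a : MvPolynomial σ k) {i r : ℕ} (hir : i < r) :
    π r (aeval t a * w ^ i) ∈ W3 * W ^ (r - 1) := by
  rw [← sum_homogeneousComponent a, map_sum, Finset.sum_mul, map_sum]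
  refine Submodule.sum_mem _ fun j _ => ?_
  have h1 : aeval t (homogeneousComponent j a) ∈ W3 ^ j :=
    aeval_mem_pow W3 ht (homogeneousComponent_isHomogeneous j a)
  have h2 : aeval t (homogeneousComponent j a) * w ^ i ∈ W ^ (j + i) := by
    rw [pow_add]
    exact Submodule.mul_mem_mul (pow_le_pow_left' h3W _ h1) (Submodule.pow_mem_pow _ hw _)
  rw [hπ r _ _ h2]
  split_ifs with h
  · obtain ⟨j, rfl⟩ : ∃ j', j = j' + 1 := ⟨j - 1, by omega⟩
    have h4 : r - 1 = j + i := by omega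
    rw [h4, pow_add, ← mul_assoc]
    refine Submodule.mul_mem_mul ?_ (Submodule.pow_mem_pow _ hw _)
    rw [pow_succ'] at h1
    exact mul_le_mul' le_rfl (pow_le_pow_left' h3W j) h1
  · exact Submodule.zero_mem _

theorem exists_polynomial_of_finrank_lt {W : Submodule k A} (hfg : W.FG) {n : ℕ}
    {t : Fin (n + 1) → A} (htW : ∀ i, t i ∈ W) {w : A} (hw : w ∈ W)
    {d m : ℕ} (hm : Module.finrank k ↥(W ^ (m + d)) < d * formDim (n + 1) m) :
    ∃ p : Polynomial (MvPolynomial (Fin (n + 1)) k), p.degree < d ∧ p ≠ 0 ∧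
      p.eval₂ (aeval t).toRingHom w = 0 := by
  let F : (Fin d → homogeneousSubmodule (Fin (n + 1)) k m) →ₗ[k] A :=
    ∑ i : Fin d, (LinearMap.mulRight k (t 0 ^ (d - i : ℕ) * w ^ (i : ℕ))).comp
      ((aeval t).toLinearMap.comp ((Submodule.subtype _).comp (LinearMap.proj i)))
  have hF : ∀ G, F G = ∑ i : Fin d, aeval t (G i : MvPolynomial (Fin (n + 1)) k) *
      (t 0 ^ (d - i : ℕ) * w ^ (i : ℕ)) := fun G => by
    simp only [F, LinearMap.sum_apply]; rfl
  have hFW : ∀ G, F G ∈ W ^ (m + d) := by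
    intro G
    rw [hF]
    refine Submodule.sum_mem _ fun i _ => ?_
    have : W ^ (m + d) = W ^ m * (W ^ (d - i : ℕ) * W ^ (i : ℕ)) := by
      rw [← pow_add, ← pow_add]; congr 1; omega
    rw [this]
    exact Submodule.mul_mem_mul (aeval_mem_pow W htW (G i).2)
      (Submodule.mul_mem_mul (Submodule.pow_mem_pow _ ((htW 0)) _)
        (Submodule.pow_mem_pow _ hw _))
  have hninj : ¬ Function.Injective F := by
    intro hinj
    have : Module.Finite k ↥(W ^ (m + d)) := Module.Finite.of_fg (hfg.pow _)
    have : Module.Finite k (homogeneousSubmodule (Fin (n + 1)) k m) :=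
      Module.Finite.of_fg (homogeneousSubmodule_fg _ _ _)
    have := LinearMap.finrank_le_finrank_of_injective (f := F.codRestrict _ hFW) (by
      intro a b hab
      exact hinj (congrArg Subtype.val hab))
    rw [Module.finrank_pi_fintype, Finset.sum_const, Finset.card_univ, Fintype.card_fin,
      finrank_homogeneousSubmodule, Fintype.card_fin, smul_eq_mul] at this
    omega
  obtain ⟨G, hG, hG0⟩ : ∃ G, F G = 0 ∧ G ≠ 0 := by
    rw [injective_iff_map_eq_zero] at hninj
    push Not at hninj
    exact hninj
  let p : Polynomial (MvPolynomial (Fin (n + 1)) k) :=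
    ∑ i : Fin d, Polynomial.C ((G i : MvPolynomial (Fin (n + 1)) k) * X 0 ^ (d - i : ℕ)) *
      Polynomial.X ^ (i : ℕ)
  have hpd : p.degree < d := Polynomial.degree_sum_fin_lt _
  have hp0 : p ≠ 0 := by
    intro h0
    refine hG0 (funext fun i => Subtype.ext ?_)
    have : p.coeff i = (G i : MvPolynomial (Fin (n + 1)) k) * X 0 ^ (d - i : ℕ) := by
      simp only [p, Polynomial.finsetSum_coeff, Polynomial.coeff_C_mul_X_pow]
      rw [Finset.sum_eq_single i]
      · simp
      · intro j _ hj
        rw [if_neg (fun h => hj (Fin.ext h.symm))]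
      · simp
    rw [h0, Polynomial.coeff_zero] at this
    exact (mul_eq_zero.1 this.symm).resolve_right (pow_ne_zero _ (X_ne_zero 0))
  refine ⟨p, hpd, hp0, ?_⟩
  rw [← hG, hF, Polynomial.eval₂_finsetSum]
  refine Finset.sum_congr rfl fun i _ => ?_
  rw [Polynomial.eval₂_mul, Polynomial.eval₂_C, Polynomial.eval₂_X_pow]
  simp [mul_assoc]

theorem exists_monic_of_relation {R : Type*} [CommRing R] [IsDomain R] [IsIntegrallyClosed R]
    [Algebra R A] [Module.IsTorsionFree R A] {w : A} (hw : IsIntegral R w) {p : Polynomial R}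
    (hp0 : p ≠ 0) (hp : p.eval₂ (algebraMap R A) w = 0) :
    ∃ (r : ℕ) (a : ℕ → R), ((r + 1 : ℕ) : WithBot ℕ) ≤ p.degree ∧
      w ^ (r + 1) = -∑ i ∈ Finset.range (r + 1), algebraMap R A (a i) * w ^ i := by
  have hdeg := minpoly.IsIntegrallyClosed.degree_le_of_ne_zero hp0 hp
  have hmon := minpoly.monic hw
  have hpos := minpoly.natDegree_pos hw
  obtain ⟨r, hr⟩ : ∃ r, (minpoly R w).natDegree = r + 1 := ⟨(minpoly R w).natDegree - 1, by omega⟩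
  refine ⟨r, (minpoly R w).coeff, ?_, ?_⟩
  · rwa [Polynomial.degree_eq_natDegree hmon.ne_zero, hr] at hdeg
  · have h1 := minpoly.aeval R w
    rw [Polynomial.aeval_eq_sum_range, Finset.sum_range_succ, hmon.coeff_natDegree, one_smul,
      hr] at h1
    rw [eq_neg_of_add_eq_zero_right h1]
    simp only [Algebra.smul_def]

theorem exists_pow_mem_or_le_finrank {W W3 : Submodule k A} (hfg : W.FG) (h3W : W3 ≤ W) {M : ℕ}
    (hM : W ^ (M + 1) ≤ W3 * W ^ M) {n : ℕ} {t : Fin (n + 1) → A} (ht : AlgebraicIndependent k t)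
    (ht3 : W3 = Submodule.span k (Set.range t)) {π : ℕ → A →ₗ[k] A}
    (hπ : ∀ i j a, a ∈ W ^ j → π i a = if i = j then a else 0) {w : A} (hw : w ∈ W) (d : ℕ) :
    (∃ r, r + 1 < d ∧ w ^ (r + 1) ∈ W3 * W ^ r) ∨
      ∀ m, d * formDim (n + 1) m ≤ Module.finrank k ↥(W ^ (m + d)) := by
  have ht3' : ∀ i, t i ∈ W3 := fun i => ht3 ▸ Submodule.subset_span ⟨i, rfl⟩
  let _ : Algebra (MvPolynomial (Fin (n + 1)) k) A := (aeval t).toAlgebra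
  have halg : ∀ s, algebraMap (MvPolynomial (Fin (n + 1)) k) A s = aeval t s := fun _ => rfl
  have : IsScalarTower k (MvPolynomial (Fin (n + 1)) k) A :=
    IsScalarTower.of_algebraMap_eq fun x => by rw [halg, AlgHom.commutes]
  have : FaithfulSMul (MvPolynomial (Fin (n + 1)) k) A :=
    (faithfulSMul_iff_algebraMap_injective _ _).2 ht
  have : Module.IsTorsionFree (MvPolynomial (Fin (n + 1)) k) A := inferInstance
  have hW : W ≠ ⊥ := by
    rw [Submodule.ne_bot_iff]
    exact ⟨t 0, h3W (ht3' 0), ht.ne_zero 0⟩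
  have hintegral : IsIntegral (MvPolynomial (Fin (n + 1)) k) w := by
    refine isIntegral_of_pow_succ_le hfg hW hM (fun u hu => ?_) hw
    rw [ht3, Submodule.mem_span_range_iff_exists_fun] at hu
    obtain ⟨c, rfl⟩ := hu
    refine ⟨∑ i, c i • X i, ?_⟩
    rw [halg, map_sum]
    simp
  rw [or_iff_not_imp_right]
  intro hm
  push Not at hm
  obtain ⟨m, hm⟩ := hm
  obtain ⟨p, hpd, hp0, hpw⟩ :=
    exists_polynomial_of_finrank_lt hfg (fun i => h3W (ht3' i)) hw hm
  have halg' : algebraMap (MvPolynomial (Fin (n + 1)) k) A = (aeval t).toRingHom := RingHom.ext halg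
  rw [← halg'] at hpw
  obtain ⟨r, a, hr, h1⟩ := exists_monic_of_relation hintegral hp0 hpw
  refine ⟨r, by exact_mod_cast hr.trans_lt hpd, ?_⟩
  have h2 := congrArg (π (r + 1)) h1
  rw [hπ (r + 1) (r + 1) _ (Submodule.pow_mem_pow _ hw _), if_pos rfl, map_neg, map_sum] at h2
  rw [h2]
  refine Submodule.neg_mem _ (Submodule.sum_mem _ fun i hi => ?_)
  rw [halg]
  have h3 := proj_aeval_mul_mem h3W ht3' hπ hw (a i) (Finset.mem_range.1 hi)
  rwa [Nat.add_sub_cancel] at h3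

end Integral

end PaperQuadrics

namespace PaperQuadrics

section Relations

variable {k : Type} [Field k] {ι : Type} [Fintype ι] [DecidableEq ι] {Z : Set (ι → k)}

theorem pow_succ_le_of_le_sup_span {A : Type*} [CommRing A] [Algebra k A] {W W3 : Submodule k A}
    {z : A} (h : W ≤ W3 ⊔ Submodule.span k {z}) (hz : z ∈ W) (m : ℕ) :
    W ^ (m + 1) ≤ W3 * W ^ m ⊔ Submodule.span k {z ^ (m + 1)} := by
  induction m with
  | zero => simpa using h
  | succ m ih =>
    rw [pow_succ' W (m + 1)]
    calc W * W ^ (m + 1) ≤ (W3 ⊔ Submodule.span k {z}) * W ^ (m + 1) := mul_le_mul' h le_rfl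
      _ = W3 * W ^ (m + 1) ⊔ Submodule.span k {z} * W ^ (m + 1) := Submodule.sup_mul _ _ _
      _ ≤ _ := sup_le le_sup_left ?_
    calc Submodule.span k {z} * W ^ (m + 1) ≤
        Submodule.span k {z} * (W3 * W ^ m ⊔ Submodule.span k {z ^ (m + 1)}) :=
          mul_le_mul' le_rfl ih
      _ = W3 * (Submodule.span k {z} * W ^ m) ⊔ Submodule.span k {z ^ (m + 1 + 1)} := by
          rw [Submodule.mul_sup, Submodule.span_mul_span, Set.singleton_mul_singleton,
            ← pow_succ', mul_left_comm]
      _ ≤ _ := by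
          refine sup_le_sup_right (mul_le_mul' le_rfl ?_) _
          rw [pow_succ']
          exact mul_le_mul' ((Submodule.span_singleton_le_iff_mem _ _).2 hz) le_rfl

/-- The linear forms vanishing on `U`. -/
def linR (U : Submodule k (ι → k)) : Submodule k (MvPolynomial ι k) := U.dualAnnihilator.map linForm

theorem map_linR (U : Submodule k (ι → k)) : (linR U).map (mkR Z).toLinearMap = linSub Z U := by
  rw [linR, ← Submodule.map_comp]; rfl

theorem linForm_mem_linR {U : Submodule k (ι → k)} {φ : Module.Dual k (ι → k)}
    (h : φ ∈ U.dualAnnihilator) : linForm φ ∈ linR U := Submodule.mem_map_of_mem h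

theorem linR_anti {U U' : Submodule k (ι → k)} (h : U ≤ U') : linR U' ≤ linR U :=
  Submodule.map_mono (Submodule.dualAnnihilator_anti h)

theorem linR_bot_pow (m : ℕ) : (linR (⊥ : Submodule k (ι → k))) ^ m =
    homogeneousSubmodule ι k m := by
  rw [← homogeneousSubmodule_one_pow]
  congr 1
  refine le_antisymm ?_ ?_
  · rintro _ ⟨φ, -, rfl⟩
    exact linForm_isHomogeneous φ
  · rw [homogeneousSubmodule_one_eq_span_X, Submodule.span_le]
    rintro _ ⟨i, rfl⟩
    rw [← linForm_proj]
    exact linForm_mem_linR (by simp)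

theorem eval_eq_zero_of_mem_linR_mul {U : Submodule k (ι → k)} {u : ι → k} (hu : u ∈ U)
    {N : Submodule k (MvPolynomial ι k)} {f : MvPolynomial ι k} (hf : f ∈ linR U * N) :
    eval u f = 0 := by
  refine Submodule.mul_induction_on hf ?_ fun x y hx hy => by rw [map_add, hx, hy, add_zero]
  rintro _ ⟨φ, hφ, rfl⟩ b -
  rw [map_mul, eval_linForm, (Submodule.mem_dualAnnihilator _).1 hφ u hu, zero_mul]

theorem mem_dualAnnihilator_sup_span_iff {U : Submodule k (ι → k)} {u : ι → k}
    {φ : Module.Dual k (ι → k)} :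
    φ ∈ (U ⊔ Submodule.span k {u}).dualAnnihilator ↔ φ ∈ U.dualAnnihilator ∧ φ u = 0 := by
  rw [Submodule.dualAnnihilator_sup_eq, Submodule.mem_inf]
  refine and_congr_right fun _ => ?_
  rw [Submodule.mem_dualAnnihilator]
  refine ⟨fun h => h u (Submodule.mem_span_singleton_self u), fun h w hw => ?_⟩
  obtain ⟨c, rfl⟩ := Submodule.mem_span_singleton.1 hw
  rw [map_smul, h, smul_zero]

theorem linR_le_sup_span {U : Submodule k (ι → k)} {u : ι → k} {z : Module.Dual k (ι → k)}
    (hz : z ∈ U.dualAnnihilator) (hzu : z u = 1) :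
    linR U ≤ linR (U ⊔ Submodule.span k {u}) ⊔ Submodule.span k {linForm z} := by
  rintro _ ⟨φ, hφ, rfl⟩
  have h1 : φ = (φ - φ u • z) + φ u • z := by abel
  have h2 : φ - φ u • z ∈ (U ⊔ Submodule.span k {u}).dualAnnihilator := by
    refine mem_dualAnnihilator_sup_span_iff.2
      ⟨Submodule.sub_mem _ hφ (Submodule.smul_mem _ _ hz), ?_⟩
    simp [hzu]
  rw [h1, map_add, map_smul]
  exact Submodule.add_mem_sup (linForm_mem_linR h2)
    (Submodule.smul_mem _ _ (Submodule.mem_span_singleton_self _))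

theorem linSub_le_sup_span {U : Submodule k (ι → k)} {u : ι → k} {z : Module.Dual k (ι → k)}
    (hz : z ∈ U.dualAnnihilator) (hzu : z u = 1) :
    linSub Z U ≤ linSub Z (U ⊔ Submodule.span k {u}) ⊔ Submodule.span k {lin Z z} := by
  have := Submodule.map_mono (f := (mkR Z).toLinearMap) (linR_le_sup_span hz hzu)
  rw [Submodule.map_sup, map_linR, map_linR, Submodule.map_span, Set.image_singleton] at this
  exact this

theorem linSub_pow_succ_le_of_eval_ne_zero {U : Submodule k (ι → k)} {u : ι → k} {m : ℕ}
    {f : MvPolynomial ι k} (hf : f ∈ linR U ^ (m + 1)) (hfI : f ∈ vanIdeal k ι Z)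
    (hfu : eval u f ≠ 0) :
    linSub Z U ^ (m + 1) ≤ linSub Z (U ⊔ Submodule.span k {u}) * linSub Z U ^ m := by
  have hu : u ∉ U := fun hu => hfu (eval_eq_zero_of_mem_linR_mul hu (by rwa [← pow_succ']))
  obtain ⟨z, hz, hzu⟩ := exists_dual_eq_one hu
  have h1 := pow_succ_le_of_le_sup_span (linR_le_sup_span hz hzu) (linForm_mem_linR hz) m hf
  obtain ⟨r, hr, s, hs, hrs⟩ := Submodule.mem_sup.1 h1
  obtain ⟨β, rfl⟩ := Submodule.mem_span_singleton.1 hs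
  have hβ : β ≠ 0 := by
    rintro rfl
    apply hfu
    rw [← hrs, zero_smul, add_zero]
    exact eval_eq_zero_of_mem_linR_mul
      (Submodule.mem_sup_right (Submodule.mem_span_singleton_self u)) hr
  have h2 : mkR Z r ∈ linSub Z (U ⊔ Submodule.span k {u}) * linSub Z U ^ m := by
    rw [← map_linR, ← map_linR U, ← Submodule.map_pow, ← Submodule.map_mul]
    exact Submodule.mem_map_of_mem hr
  have h3 : lin Z z ^ (m + 1) ∈ linSub Z (U ⊔ Submodule.span k {u}) * linSub Z U ^ m := by
    have h4 := mkR_eq_zero.2 hfI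
    rw [← hrs, map_add, map_smul, map_pow, mk_linForm] at h4
    have h5 : lin Z z ^ (m + 1) = -(β⁻¹ • mkR Z r) := by
      rw [eq_neg_iff_add_eq_zero, ← smul_right_injective _ hβ |>.eq_iff, smul_zero, smul_add,
        smul_inv_smul₀ hβ, add_comm, h4]
    rw [h5]
    exact Submodule.neg_mem _ (Submodule.smul_mem _ _ h2)
  refine (pow_succ_le_of_le_sup_span (linSub_le_sup_span hz hzu) (lin_mem_linSub hz) m).trans
    (sup_le le_rfl ?_)
  rwa [Submodule.span_singleton_le_iff_mem]

end Relations

end PaperQuadrics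

namespace PaperQuadrics

section Hyperplane

variable {k : Type} [Field k] {ι : Type} [Fintype ι] [DecidableEq ι] {Z : Set (ι → k)}

theorem exists_gradedProj [Infinite k] (hZ : IsProjVariety k ι Z) :
    ∃ π : ℕ → CoordRing Z →ₗ[k] CoordRing Z,
      ∀ j f, π j (mkR Z f) = mkR Z (homogeneousComponent j f) := by
  obtain ⟨s, hs⟩ := LinearMap.exists_rightInverse_of_surjective (mkR Z).toLinearMap
    (LinearMap.range_eq_top.2 (mkR_surjective Z))
  refine ⟨fun j => (mkR Z).toLinearMap ∘ₗ homogeneousComponent j ∘ₗ s, fun j f => ?_⟩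
  have h1 : mkR Z (s (mkR Z f)) = mkR Z f := LinearMap.congr_fun hs (mkR Z f)
  rw [← sub_eq_zero, ← map_sub, mkR_eq_zero] at h1
  have h2 := homogeneousComponent_mem_vanIdeal hZ h1 j
  rw [map_sub, ← mkR_eq_zero, map_sub, sub_eq_zero] at h2
  exact h2

theorem gradedProj_of_mem {π : ℕ → CoordRing Z →ₗ[k] CoordRing Z}
    (hπ : ∀ j f, π j (mkR Z f) = mkR Z (homogeneousComponent j f)) (U : Submodule k (ι → k))
    (i j : ℕ) (a : CoordRing Z) (ha : a ∈ linSub Z U ^ j) : π i a = if i = j then a else 0 := by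
  obtain ⟨f, hf, rfl⟩ := linSub_bot_pow_le j (pow_le_pow_left' (linSub_anti bot_le) j ha)
  have := hπ i f
  rw [homogeneousComponent_of_mem hf] at this
  rw [AlgHom.toLinearMap_apply, this]
  split_ifs <;> simp

theorem IsSmoothMinimal.algebraicIndependent_lin [IsAlgClosed k] {n e : ℕ}
    (h : IsSmoothMinimal Z n e) {σ : Type*} {x : ι → k} (hx : x ∈ Z) (hx0 : x ≠ 0)
    (φ : σ → Module.Dual k (ι → k)) (hφ : ∀ w : σ → k, ∃ v ∈ tang Z x, ∀ i, φ i v = w i) :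
    AlgebraicIndependent k fun i => lin Z (φ i) := by
  rw [algebraicIndependent_iff]
  intro P hP
  have h1 : aeval (fun i => clin Z x (φ i)) (aeval (fun i => X i + C (φ i x)) P) = 0 := by
    rw [comp_aeval_apply, ← hP]
    congr 2
    funext i
    rw [map_add, aeval_X, aeval_C, clin_apply, sub_add_cancel]
  have h2 := h.eq_zero_of_aeval_clin_mem hx hx0 φ hφ (Nat.lt_succ_self _)
    (h1 ▸ Submodule.zero_mem _)
  have h3 : aeval (fun i => X i - C (φ i x)) (aeval (fun i => X i + C (φ i x)) P) = P := by
    rw [comp_aeval_apply]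
    have : (fun i => aeval (fun i => X i - C (φ i x)) (X i + C (φ i x))) =
        (X : σ → MvPolynomial σ k) := by
      funext i
      rw [map_add, aeval_X, ← MvPolynomial.algebraMap_eq, AlgHom.commutes, sub_add_cancel]
    rw [this, aeval_X_left_apply]
  rw [← h3, h2, map_zero]

theorem dualAnnihilator_eq_span {V : Type*} [AddCommGroup V] [Module k V] [FiniteDimensional k V]
    {U : Submodule k V} {r : ℕ} {φ : Fin r → Module.Dual k V} (hφU : ∀ i, φ i ∈ U.dualAnnihilator)
    (hφ : ∀ w : Fin r → k, ∃ v, ∀ i, φ i v = w i)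
    (hr : Module.finrank k U + r = Module.finrank k V) :
    U.dualAnnihilator = Submodule.span k (Set.range φ) := by
  symm
  refine Submodule.eq_of_le_of_finrank_eq (Submodule.span_le.2 ?_) ?_
  · rintro _ ⟨i, rfl⟩
    exact hφU i
  · have h1 : LinearIndependent k φ := by
      rw [Fintype.linearIndependent_iff]
      intro g hg i
      obtain ⟨v, hv⟩ := hφ (Pi.single i 1)
      have := LinearMap.congr_fun hg v
      simpa [LinearMap.sum_apply, hv, Pi.single_apply] using this
    rw [finrank_span_eq_card h1, Fintype.card_fin]
    have := Subspace.finrank_add_finrank_dualAnnihilator_eq U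
    omega

theorem linSub_eq_span {U : Submodule k (ι → k)} {r : ℕ} {φ : Fin r → Module.Dual k (ι → k)}
    (hU : U.dualAnnihilator = Submodule.span k (Set.range φ)) :
    linSub Z U = Submodule.span k (Set.range fun i => lin Z (φ i)) := by
  rw [linSub, hU, Submodule.map_span, ← Set.range_comp]
  rfl

theorem linSub_fg (U : Submodule k (ι → k)) : (linSub Z U).FG :=
  (IsNoetherian.noetherian U.dualAnnihilator).map _

theorem IsSmoothMinimal.exists_pow_mem_or_le_finrank [IsAlgClosed k] {n e : ℕ}
    (h : IsSmoothMinimal Z n e) {y : ι → k} (hy : y ∈ Z) (hy0 : y ≠ 0)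
    {U U' : Submodule k (ι → k)} (hUU : U ≤ U') (hdisj : Disjoint (tang Z y) U')
    (hU' : Module.finrank k U' = e) {M : ℕ}
    (hM : linSub Z U ^ (M + 1) ≤ linSub Z U' * linSub Z U ^ M) {w : CoordRing Z}
    (hw : w ∈ linSub Z U) (d : ℕ) :
    (∃ r, r + 1 < d ∧ w ^ (r + 1) ∈ linSub Z U' * linSub Z U ^ r) ∨
      ∀ m, d * formDim (n + 1) m ≤ Module.finrank k ↥(linSub Z U ^ (m + d)) := by
  have : Infinite k := IsAlgClosed.instInfinite
  have := h.isDomain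
  obtain ⟨φ, hφU, hφ⟩ := exists_dual_family (tang Z y) U' hdisj (h.finrank_tang hy hy0)
  have h1 := dualAnnihilator_eq_span hφU (fun w => (hφ w).imp fun _ => And.right)
    (by rw [hU', Module.finrank_fintype_fun_eq_card, h.card]; omega)
  obtain ⟨π, hπ⟩ := exists_gradedProj h.proj
  exact PaperQuadrics.exists_pow_mem_or_le_finrank (linSub_fg U) (linSub_anti hUU) hM
    (h.algebraicIndependent_lin hy hy0 φ hφ) (linSub_eq_span h1) (gradedProj_of_mem hπ U) hw d

theorem le_formDim_succ (n e m : ℕ) (hm : (e + 2) * (n + 1) ≤ m) :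
    (e + 2) * formDim (n + 1) m ≤ formDim (n + 2) m := by
  have h1 : formDim (n + 1) m = (n + m).choose n := by
    rw [formDim, show n + 1 + m - 1 = n + m by omega, Nat.choose_symm_add]
  have h2 : formDim (n + 2) m = (n + m + 1).choose (n + 1) := by
    rw [formDim, show n + 2 + m - 1 = (n + 1) + m by omega, ← Nat.choose_symm_add]
    congr 1; omega
  have h3 := Nat.add_one_mul_choose_eq (n + m) n
  rw [h1, h2]
  refine Nat.le_of_mul_le_mul_right ?_ (Nat.succ_pos n)
  calc (e + 2) * (n + m).choose n * (n + 1) = ((e + 2) * (n + 1)) * (n + m).choose n := by ring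
    _ ≤ (n + m + 1) * (n + m).choose n := Nat.mul_le_mul_right _ (by omega)
    _ = _ := h3

theorem IsSmoothMinimal.exists_hyperplane [IsAlgClosed k] {n e : ℕ}
    (h : IsSmoothMinimal Z n e) {T U : Submodule k (ι → k)} (hT : Module.finrank k T = n + 1)
    (hTU : Disjoint T U) (hU : Module.finrank k U + 1 = e) :
    ∃ u M, Disjoint T (U ⊔ Submodule.span k {u}) ∧
      Module.finrank k ↥(U ⊔ Submodule.span k {u}) = e ∧
      linSub Z U ^ (M + 1) ≤ linSub Z (U ⊔ Submodule.span k {u}) * linSub Z U ^ M := by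
  have : Infinite k := IsAlgClosed.instInfinite
  have hV : Module.finrank k (ι → k) = n + e + 1 := by
    rw [Module.finrank_fintype_fun_eq_card, h.card]
  obtain ⟨Q, hQ⟩ := U.exists_isCompl
  have hQr : Module.finrank k Q = n + 2 := by
    have := Submodule.finrank_add_eq_of_isCompl hQ
    omega
  obtain ⟨ψ, hψU, hψ⟩ := exists_dual_family Q U hQ.disjoint.symm hQr
  have hspan := dualAnnihilator_eq_span hψU (fun w => (hψ w).imp fun _ => And.right) (by omega)
  -- a relation between the forms
  obtain ⟨m, hm, hlt⟩ := h.exists_finrank_lt 0 ((e + 2) * (n + 1) + 1)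
  obtain ⟨m, rfl⟩ : ∃ m', m = m' + 1 := ⟨m - 1, by omega⟩
  obtain ⟨F, hFh, hF0, hF⟩ : ∃ F : MvPolynomial (Fin (n + 2)) k, F.IsHomogeneous (m + 1) ∧ F ≠ 0 ∧
      aeval (fun i => lin Z (ψ i)) F = 0 := by
    let L : homogeneousSubmodule (Fin (n + 2)) k (m + 1) →ₗ[k] ↥(linSub Z ⊥ ^ (m + 1)) :=
      ((aeval fun i => lin Z (ψ i)).toLinearMap ∘ₗ
        (homogeneousSubmodule (Fin (n + 2)) k (m + 1)).subtype).codRestrict _ fun F =>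
          aeval_mem_pow _ (fun i => lin_mem_linSub (by simp)) F.2
    have hL : ¬ Function.Injective L := by
      intro hL
      have h1 := LinearMap.finrank_le_finrank_of_injective hL
      rw [finrank_homogeneousSubmodule, Fintype.card_fin] at h1
      have h2 := le_formDim_succ n e (m + 1) (by omega)
      rw [add_zero] at hlt
      omega
    rw [injective_iff_map_eq_zero] at hL
    push Not at hL
    obtain ⟨F, hF, hF0⟩ := hL
    exact ⟨F, F.2, fun h => hF0 (Subtype.ext h), congrArg Subtype.val hF⟩
  -- a form vanishing on `T ⊔ U`
  obtain ⟨ℓ, hℓ, hℓ0⟩ : ∃ ℓ ∈ (T ⊔ U).dualAnnihilator, ℓ ≠ 0 := by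
    rw [← Submodule.ne_bot_iff]
    intro h0
    have h1 := Subspace.finrank_add_finrank_dualAnnihilator_eq (T ⊔ U)
    rw [h0, finrank_bot] at h1
    have h2 := Submodule.finrank_add_le_finrank_add_finrank T U
    omega
  have hℓU : ℓ ∈ U.dualAnnihilator := Submodule.dualAnnihilator_anti le_sup_right hℓ
  obtain ⟨c, hc⟩ := (Submodule.mem_span_range_iff_exists_fun k).1 (hspan ▸ hℓU)
  have hc0 : (∑ i, c i • X i : MvPolynomial (Fin (n + 2)) k) ≠ 0 := by
    intro h0
    apply hℓ0
    have : ∀ i, c i = 0 := by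
      intro i
      have := congrArg (eval (Pi.single i (1 : k))) h0
      simpa [smul_eval, Pi.single_apply] using this
    rw [← hc]
    simp [this]
  obtain ⟨w, hw⟩ : ∃ w, eval w (F * ∑ i, c i • X i) ≠ 0 := by
    by_contra! hcon
    exact mul_ne_zero hF0 hc0 (MvPolynomial.funext fun x => by rw [hcon, map_zero])
  rw [map_mul] at hw
  obtain ⟨u, -, hu⟩ := hψ w
  have hℓu : ℓ u ≠ 0 := by
    rw [← hc]
    simpa [LinearMap.sum_apply, hu, smul_eval] using right_ne_zero_of_mul hw
  have huTU : u ∉ T ⊔ U := fun h1 => hℓu ((Submodule.mem_dualAnnihilator _).1 hℓ u h1)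
  refine ⟨u, m, disjoint_sup_span_singleton hTU huTU, ?_, ?_⟩
  · rw [Submodule.finrank_sup_span_singleton fun h1 => huTU (Submodule.mem_sup_right h1), hU]
  · refine linSub_pow_succ_le_of_eval_ne_zero (f := aeval (fun i => linForm (ψ i)) F)
      (aeval_mem_pow _ (fun i => linForm_mem_linR (hψU i)) hFh) ?_ ?_
    · rw [← mkR_eq_zero, comp_aeval_apply, ← hF]
      rfl
    · rw [← aeval_eq_eval, comp_aeval_apply]
      have : (fun i => aeval u (linForm (ψ i))) = w := by
        funext i
        rw [aeval_eq_eval, ← hu i, eval_linForm]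
      rw [this, aeval_eq_eval]
      exact left_ne_zero_of_mul hw

end Hyperplane

end PaperQuadrics

namespace PaperQuadrics

section Frac

variable {k : Type} [Field k] {ι : Type} [Fintype ι] [DecidableEq ι] {Z : Set (ι → k)}

/-- A list of points of `Z` in general position with respect to `p` and the tangent space
at `y`. -/
structure Good (Z : Set (ι → k)) (p y : ι → k) (l : List (ι → k)) : Prop where
  count : CountGood Z ⊥ l
  disj : Disjoint (tang Z y) (spanL l ⊔ Submodule.span k {p})
  card : Module.finrank k ↥(spanL l ⊔ Submodule.span k {p}) = l.length + 1

variable {n e : ℕ} {p y : ι → k}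

theorem Good.notMem {l : List (ι → k)} (hl : Good Z p y l) : p ∉ spanL l := by
  intro hp
  have h1 : spanL l ⊔ Submodule.span k {p} = spanL l :=
    sup_eq_left.2 ((Submodule.span_singleton_le_iff_mem _ _).2 hp)
  have h2 := hl.card
  rw [h1] at h2
  have := finrank_spanL_le l
  omega

theorem Good.cons (h : IsSmoothMinimal Z n e) (hy : y ∈ Z) (hy0 : y ≠ 0) {l : List (ι → k)}
    (hl : Good Z p y l) (hle : l.length + 1 < e) : Gen Z fun z => Good Z p y (z :: l) := by
  have h1 : Gen Z fun z => z ∉ tang Z y ⊔ (spanL l ⊔ Submodule.span k {p}) := by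
    refine gen_notMem h.nondeg ?_
    have h2 := Submodule.finrank_add_le_finrank_add_finrank (tang Z y)
      (spanL l ⊔ Submodule.span k {p})
    rw [h.finrank_tang hy hy0, hl.card] at h2
    rw [h.card]
    omega
  refine ((h.gen_countGood_cons hl.count (by omega)).and h.proj.prime h1).mono ?_
  rintro z ⟨h2, h3⟩
  have h4 : spanL (z :: l) ⊔ Submodule.span k {p} =
      (spanL l ⊔ Submodule.span k {p}) ⊔ Submodule.span k {z} := by
    rw [spanL_cons]; ac_rfl
  refine ⟨h2, ?_, ?_⟩
  · rw [h4]
    exact disjoint_sup_span_singleton hl.disj h3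
  · rw [h4, Submodule.finrank_sup_span_singleton fun h5 => h3 (Submodule.mem_sup_right h5), hl.card,
      List.length_cons]

theorem Good.extend (h : IsSmoothMinimal Z n e) (hy : y ∈ Z) (hy0 : y ≠ 0) {l : List (ι → k)}
    (hl : Good Z p y l) {s : ℕ} (hle : l.length + s < e) :
    ∃ l' : List (ι → k), Good Z p y (l' ++ l) ∧ l'.length = s := by
  induction s with
  | zero => exact ⟨[], hl, rfl⟩
  | succ s ih =>
    obtain ⟨l', hl', hs⟩ := ih (by omega)
    obtain ⟨z, -, hz⟩ := (hl'.cons h hy hy0 (by rw [List.length_append]; omega)).exists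
    exact ⟨z :: l', hz, by simp [hs]⟩

theorem finrank_mul_left {A : Type*} [CommRing A] [IsDomain A] [Algebra k A] {z : A} (hz : z ≠ 0)
    (W : Submodule k A) : Module.finrank k ↥(W.map (LinearMap.mulLeft k z)) = Module.finrank k W :=
  LinearEquiv.finrank_eq
    (Submodule.equivMapOfInjective _ (fun _ _ hab => mul_left_cancel₀ hz hab) W).symm

theorem Good.exists_frac [IsAlgClosed k] (h : IsSmoothMinimal Z n e) (hy : y ∈ Z)
    (hy0 : y ≠ 0) {l : List (ι → k)} (hl : Good Z p y l) (hle : l.length + 2 ≤ e) :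
    ∃ d, ∃ b ∈ linSub Z (spanL l ⊔ Submodule.span k {p}) ^ d, b ≠ 0 ∧
      ∀ a ∈ linSub Z (spanL l), b * a ∈ linSub Z (spanL l ⊔ Submodule.span k {p}) ^ (d + 1) := by
  have := h.isDomain
  obtain ⟨l', hl', hs⟩ := hl.extend h hy hy0 (s := e - 2 - l.length) (by omega)
  have hlen : (l' ++ l).length + 2 = e := by rw [List.length_append]; omega
  have hsub : spanL l ≤ spanL (l' ++ l) :=
    Submodule.span_mono fun x hx => List.mem_append_right _ hx
  set U := spanL (l' ++ l) with hU
  obtain ⟨z, hzU, hzp⟩ := exists_dual_eq_one hl'.notMem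
  have hz0 : lin Z z ≠ 0 := fun h0 => by
    rw [(lin_injective h.nondeg) (h0.trans (map_zero _).symm)] at hzp
    simp at hzp
  suffices hsuff : ∃ d, ∃ b ∈ linSub Z (U ⊔ Submodule.span k {p}) ^ d, b ≠ 0 ∧
      lin Z z * b ∈ linSub Z (U ⊔ Submodule.span k {p}) ^ (d + 1) by
    obtain ⟨d, b, hb, hb0, hzb⟩ := hsuff
    have hle' : linSub Z (U ⊔ Submodule.span k {p}) ≤ linSub Z (spanL l ⊔ Submodule.span k {p}) :=
      linSub_anti (sup_le_sup_right hsub _)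
    have hb' := pow_le_pow_left' hle' d hb
    have hzb' := pow_le_pow_left' hle' (d + 1) hzb
    refine ⟨d, b, hb', hb0, fun a ha => ?_⟩
    obtain ⟨a', ha', c, hc, rfl⟩ := Submodule.mem_sup.1
      (linSub_le_sup_span (Submodule.dualAnnihilator_anti hsub hzU) hzp ha)
    obtain ⟨β, rfl⟩ := Submodule.mem_span_singleton.1 hc
    rw [mul_add]
    refine Submodule.add_mem _ (by rw [pow_succ]; exact Submodule.mul_mem_mul hb' ha') ?_
    rw [mul_smul_comm, mul_comm]
    exact Submodule.smul_mem _ _ hzb'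
  by_contra! hcon
  obtain ⟨u, M, hu1, hu2, hu3⟩ := h.exists_hyperplane (h.finrank_tang hy hy0) hl'.disj
    (by rw [hl'.card]; omega)
  set W := linSub Z (U ⊔ Submodule.span k {p}) with hW
  obtain ⟨w, hwU, hwu⟩ := exists_dual_eq_one (U := U ⊔ Submodule.span k {p}) (x := u) (by
    intro hmem
    rw [sup_eq_left.2 ((Submodule.span_singleton_le_iff_mem _ _).2 hmem), hl'.card] at hu2
    omega)
  have hrank : ∀ m, 2 * formDim (n + 1) m ≤ Module.finrank k ↥(W ^ (m + 2)) := by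
    refine (h.exists_pow_mem_or_le_finrank hy hy0 le_sup_left hu1 hu2 hu3
      (lin_mem_linSub hwU) 2).resolve_left ?_
    rintro ⟨r, hr, hr'⟩
    obtain rfl : r = 0 := by omega
    rw [pow_zero, mul_one, zero_add, pow_one] at hr'
    obtain ⟨w', hw', hww⟩ := hr'
    rw [lin_injective h.nondeg hww] at hw'
    rw [(mem_dualAnnihilator_sup_span_iff.1 hw').2] at hwu
    exact zero_ne_one hwu
  obtain ⟨m, -, hm⟩ := h.exists_finrank_lt 3 0
  have h1 := h.finrank_ge_of_countGood hl'.count (m + 2)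
  rw [bot_sup_eq, ← hU] at h1
  have h2 : Module.finrank k ↥(W ^ (m + 3)) + Module.finrank k ↥(W ^ (m + 2)) ≤
      Module.finrank k ↥(linSub Z U ^ (m + 3)) := by
    have hle1 : W ^ (m + 3) ≤ linSub Z U ^ (m + 3) := pow_le_pow_left' (linSub_anti le_sup_left) _
    have hle2 : (W ^ (m + 2)).map (LinearMap.mulLeft k (lin Z z)) ≤ linSub Z U ^ (m + 3) := by
      rintro _ ⟨b, hb, rfl⟩
      rw [pow_succ']
      exact Submodule.mul_mem_mul (lin_mem_linSub hzU)
        (pow_le_pow_left' (linSub_anti le_sup_left) _ hb)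
    have hdis : W ^ (m + 3) ⊓ (W ^ (m + 2)).map (LinearMap.mulLeft k (lin Z z)) = ⊥ := by
      rw [eq_bot_iff]
      rintro _ ⟨h3, b, hb, rfl⟩
      by_cases hb0 : b = 0
      · simp [hb0]
      · exact absurd h3 (hcon _ b hb hb0)
    have h3 := Submodule.finrank_sup_add_finrank_inf_eq (W ^ (m + 3))
      ((W ^ (m + 2)).map (LinearMap.mulLeft k (lin Z z)))
    rw [hdis, finrank_bot, finrank_mul_left hz0] at h3
    rw [← h3, add_zero]
    exact Submodule.finrank_mono (sup_le hle1 hle2)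
  have h3 := hrank m
  have h4 := hrank (m + 1)
  have h5 := formDim_succ_mono n (show m ≤ m + 1 by omega)
  have h6 := formDim_succ_mono n (show m ≤ m + 2 by omega)
  have h7 : (l' ++ l).length * formDim (n + 1) m ≤ (l' ++ l).length * formDim (n + 1) (m + 2) :=
    Nat.mul_le_mul_left _ h6
  have h8 : (e + 2) * formDim (n + 1) m =
      (l' ++ l).length * formDim (n + 1) m + 4 * formDim (n + 1) m := by
    rw [← hlen]; ring
  have h9 : m + 1 + 2 = m + 3 := rfl
  have h10 : m + 2 + 1 = m + 3 := rfl
  rw [h9] at h4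
  rw [h10] at h1
  omega

end Frac

end PaperQuadrics

namespace PaperQuadrics

section Integral

variable {k : Type} [Field k] {A : Type} [CommRing A] [Algebra k A]

theorem exists_coeff_of_mem_mul_span {W : Submodule k A} {r : ℕ} {b : Fin r → A} {a : A}
    (ha : a ∈ W * Submodule.span k (Set.range b)) : ∃ ω : Fin r → A, (∀ j, ω j ∈ W) ∧
      a = ∑ j, ω j * b j := by
  refine Submodule.mul_induction_on ha ?_ ?_
  · intro w hw c hc
    obtain ⟨γ, rfl⟩ := (Submodule.mem_span_range_iff_exists_fun k).1 hc
    refine ⟨fun j => γ j • w, fun j => Submodule.smul_mem _ _ hw, ?_⟩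
    rw [Finset.mul_sum]
    exact Finset.sum_congr rfl fun j _ => by rw [mul_smul_comm, smul_mul_assoc]
  · rintro _ _ ⟨ω, hω, rfl⟩ ⟨ω', hω', rfl⟩
    refine ⟨fun j => ω j + ω' j, fun j => Submodule.add_mem _ (hω j) (hω' j), ?_⟩
    rw [← Finset.sum_add_distrib]
    exact Finset.sum_congr rfl fun j _ => by rw [add_mul]

theorem exists_prod_sub_eq {W W' : Submodule k A} (hW : W' ≤ W) {z : A} (hz : z ∈ W) {κ : Type*}
    (s : Finset κ) (δ : κ → k) (ω : κ → A) (hω : ∀ i, ω i ∈ W') :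
    ∃ t, (∀ m, s.card = m + 1 → t ∈ W' * W ^ m) ∧ (s.card = 0 → t = 0) ∧
      ∏ i ∈ s, (δ i • z - ω i) = (∏ i ∈ s, δ i) • z ^ s.card + t := by
  classical
  induction s using Finset.induction_on with
  | empty => exact ⟨0, by simp, by simp, by simp⟩
  | insert i s hi ih =>
    obtain ⟨t, ht, ht0, hts⟩ := ih
    refine ⟨(δ i • z - ω i) * t - (∏ i ∈ s, δ i) • (ω i * z ^ s.card), ?_, ?_, ?_⟩
    · intro m hm
      rw [Finset.card_insert_of_notMem hi] at hm
      obtain rfl : s.card = m := by omega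
      refine Submodule.sub_mem _ ?_ (Submodule.smul_mem _ _
        (Submodule.mul_mem_mul (hω i) (Submodule.pow_mem_pow _ hz _)))
      rcases hs : s.card with _ | m
      · rw [ht0 hs, mul_zero]; exact Submodule.zero_mem _
      · have := Submodule.mul_mem_mul (Submodule.sub_mem _ (Submodule.smul_mem _ (δ i) hz)
          (hW (hω i))) (ht m hs)
        rwa [mul_left_comm, ← pow_succ'] at this
    · intro h0; rw [Finset.card_insert_of_notMem hi] at h0; omega
    · rw [Finset.prod_insert hi, Finset.prod_insert hi, hts, Finset.card_insert_of_notMem hi,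
        mul_add, sub_mul, mul_smul_comm, smul_mul_assoc, mul_smul_comm, pow_succ', smul_smul,
        mul_comm (∏ i ∈ s, δ i)]
      ring

theorem exists_pow_mem_of_mul_mem [IsDomain A] {W W' N : Submodule k A} (hW : W' ≤ W) {z : A}
    (hz : z ∈ W) (hN : N.FG) (hN0 : N ≠ ⊥) (h : ∀ b ∈ N, z * b ∈ W' * N) :
    ∃ m, z ^ (m + 1) ∈ W' * W ^ m := by
  obtain ⟨r, b, rfl⟩ := Submodule.fg_iff_exists_fin_generating_family.1 hN
  choose ω hω hωb using fun i => exists_coeff_of_mem_mul_span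
    (h (b i) (Submodule.subset_span ⟨i, rfl⟩))
  let M : Matrix (Fin r) (Fin r) A := fun i j => (if i = j then (1 : k) else 0) • z - ω i j
  have hdet : M.det = 0 := by
    refine Matrix.exists_mulVec_eq_zero_iff.1 ⟨b, ?_, ?_⟩
    · rintro rfl
      apply hN0
      rw [Submodule.span_eq_bot]
      rintro _ ⟨i, rfl⟩; rfl
    · funext i
      simp only [Matrix.mulVec, dotProduct, M, sub_mul, Finset.sum_sub_distrib, Pi.zero_apply]
      rw [← hωb i, sub_eq_zero]
      rw [Finset.sum_eq_single i]
      · simp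
      · intro j _ hj; simp [Ne.symm hj]
      · simp
  obtain ⟨m, rfl⟩ : ∃ m, r = m + 1 := by
    rcases r with _ | m
    · simp at hN0
    · exact ⟨m, rfl⟩
  refine ⟨m, ?_⟩
  choose t ht _ htM using fun σ : Equiv.Perm (Fin (m + 1)) => exists_prod_sub_eq hW hz
    Finset.univ (fun i => if σ i = i then (1 : k) else 0)
    (fun i => ω (σ i) i) fun i => hω _ _
  have h1 : M.det = z ^ (m + 1) + ∑ σ : Equiv.Perm (Fin (m + 1)), ((σ.sign : ℤ) : A) * t σ := by
    rw [Matrix.det_apply']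
    simp only [M, htM, Finset.card_univ, Fintype.card_fin, mul_add, Finset.sum_add_distrib]
    congr 1
    rw [Finset.sum_eq_single 1]
    · simp
    · intro σ _ hσ
      obtain ⟨i, hi⟩ : ∃ i, σ i ≠ i := by
        by_contra! hcon
        exact hσ (Equiv.ext hcon)
      rw [Finset.prod_eq_zero (Finset.mem_univ i) (if_neg hi), zero_smul, mul_zero]
    · simp
  rw [hdet] at h1
  rw [eq_neg_of_add_eq_zero_left h1.symm]
  refine Submodule.neg_mem _ (Submodule.sum_mem _ fun σ _ => ?_)
  have h2 := ht σ m (by simp)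
  rcases Int.units_eq_one_or σ.sign with hs | hs <;> rw [hs]
  · simpa using h2
  · simpa using h2

theorem pow_add_le_of_pow_succ_le {W W' : Submodule k A} {M : ℕ} (h : W ^ (M + 1) ≤ W' * W ^ M)
    (j : ℕ) : W ^ (M + j) ≤ W' ^ j * W ^ M := by
  induction j with
  | zero => simp
  | succ j ih =>
    calc W ^ (M + (j + 1)) = W * W ^ (M + j) := by rw [← pow_succ', add_assoc]
      _ ≤ W * (W' ^ j * W ^ M) := mul_le_mul' le_rfl ih
      _ = W' ^ j * W ^ (M + 1) := by rw [mul_left_comm, ← pow_succ']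
      _ ≤ W' ^ j * (W' * W ^ M) := mul_le_mul' le_rfl h
      _ = _ := by rw [← mul_assoc, ← pow_succ]

/-- Propagation of integrality from a projection to a further projection. -/
theorem exists_pow_succ_le_of_conductor [IsDomain A] {W Wp Wx Wpx : Submodule k A} (hWfg : W.FG)
    (hWp : Wp ≤ W) (hWx : Wx ≤ W) (hpx : Wpx ≤ Wx) {y z : A} (hy : y ∈ Wp) (hy0 : y ≠ 0)
    (hz : z ∈ Wx) (h2 : Wx ≤ Wpx ⊔ Submodule.span k {z})
    {M : ℕ} (hM : W ^ (M + 1) ≤ Wp * W ^ M) {d : ℕ} (hzy : z * y ^ d ∈ Wpx * W ^ d)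
    (hd : Wp ^ d ≤ Wpx * W ^ (d - 1) ⊔ Submodule.span k {y ^ d}) (hd0 : 0 < d) :
    ∃ m, Wx ^ (m + 1) ≤ Wpx * Wx ^ m := by
  obtain ⟨d, rfl⟩ : ∃ d', d = d' + 1 := ⟨d - 1, by omega⟩
  rw [Nat.add_sub_cancel] at hd
  have hN : W ^ (M + (d + 1)) ≤ Wpx * W ^ (M + d) ⊔ Submodule.span k {y ^ (d + 1)} * W ^ M := by
    calc _ ≤ Wp ^ (d + 1) * W ^ M := pow_add_le_of_pow_succ_le hM _
      _ ≤ (Wpx * W ^ d ⊔ Submodule.span k {y ^ (d + 1)}) * W ^ M := mul_le_mul' hd le_rfl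
      _ = _ := by rw [Submodule.sup_mul, mul_assoc, ← pow_add, add_comm d]
  obtain ⟨m, hm⟩ := exists_pow_mem_of_mul_mem (N := W ^ (M + (d + 1))) hpx hz (hWfg.pow _)
    (fun h0 => pow_ne_zero (M + (d + 1)) hy0 (by
      rw [← Submodule.mem_bot k, ← h0]; exact Submodule.pow_mem_pow _ (hWp hy) _)) (by
    intro b hb
    have h3 : z * b ∈ Submodule.span k {z} * W ^ (M + (d + 1)) :=
      Submodule.mul_mem_mul (Submodule.mem_span_singleton_self z) hb
    refine (show Submodule.span k {z} * W ^ (M + (d + 1)) ≤ Wpx * W ^ (M + (d + 1)) from ?_) h3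
    calc _ ≤ Submodule.span k {z} * (Wpx * W ^ (M + d) ⊔ Submodule.span k {y ^ (d + 1)} * W ^ M) :=
          mul_le_mul' le_rfl hN
      _ = Wpx * (Submodule.span k {z} * W ^ (M + d)) ⊔
          Submodule.span k {z * y ^ (d + 1)} * W ^ M := by
          rw [Submodule.mul_sup, mul_left_comm,
              ← mul_assoc (Submodule.span k {z}) (Submodule.span k _), Submodule.span_mul_span,
            Set.singleton_mul_singleton]
      _ ≤ Wpx * W ^ (M + (d + 1)) := sup_le (mul_le_mul' le_rfl ?_) ?_
    · rw [← add_assoc, pow_succ']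
      exact mul_le_mul' ((Submodule.span_singleton_le_iff_mem _ _).2 (hWx hz)) le_rfl
    · calc _ ≤ Wpx * W ^ (d + 1) * W ^ M :=
            mul_le_mul' ((Submodule.span_singleton_le_iff_mem _ _).2 hzy) le_rfl
        _ = _ := by rw [mul_assoc, ← pow_add, add_comm (d + 1)])
  exact ⟨m, (pow_succ_le_of_le_sup_span h2 hz m).trans
    (sup_le le_rfl ((Submodule.span_singleton_le_iff_mem _ _).2 hm))⟩

end Integral

section Propagate

variable {k : Type} [Field k] {ι : Type} [Fintype ι] [DecidableEq ι] {Z : Set (ι → k)}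

theorem exists_pow_succ_le_sup (hZ : IsProjVariety k ι Z) {U : Submodule k (ι → k)} {p x : ι → k}
    {M d : ℕ} {b : CoordRing Z}
    (hM : linSub Z U ^ (M + 1) ≤ linSub Z (U ⊔ Submodule.span k {p}) * linSub Z U ^ M)
    (hb : b ∈ linSub Z (U ⊔ Submodule.span k {p}) ^ d)
    (hbU : ∀ a ∈ linSub Z U, b * a ∈ linSub Z (U ⊔ Submodule.span k {p}) ^ (d + 1))
    (hx : x ∈ Z) (hbx : ev hx b ≠ 0) (hxU : x ∉ U ⊔ Submodule.span k {p})
    (hp : p ∉ U ⊔ Submodule.span k {x}) :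
    ∃ m, linSub Z (U ⊔ Submodule.span k {x}) ^ (m + 1) ≤
      linSub Z (U ⊔ Submodule.span k {x} ⊔ Submodule.span k {p}) *
        linSub Z (U ⊔ Submodule.span k {x}) ^ m := by
  have := isDomain_coordRing hZ.prime
  have hcomm : U ⊔ Submodule.span k {x} ⊔ Submodule.span k {p} =
      U ⊔ Submodule.span k {p} ⊔ Submodule.span k {x} := by ac_rfl
  obtain ⟨y, hyU, hyx⟩ := exists_dual_eq_one hxU
  obtain ⟨z, hzU, hzp⟩ := exists_dual_eq_one hp
  have hzx : z x = 0 := (mem_dualAnnihilator_sup_span_iff.1 hzU).2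
  have h1 := linSub_le_sup_span (Z := Z) hyU hyx
  have h2 := linSub_le_sup_span (Z := Z) hzU hzp
  rw [← hcomm] at h1
  have hyW := lin_mem_linSub (Z := Z) hyU
  have hzW := lin_mem_linSub (Z := Z) hzU
  have hy0 : lin Z y ≠ 0 := fun h0 => by
    have := congrArg (ev hx) h0
    rw [ev_lin, hyx, map_zero] at this
    exact one_ne_zero this
  have hWp : linSub Z (U ⊔ Submodule.span k {p}) ≤ linSub Z U := linSub_anti le_sup_left
  have hWx : linSub Z (U ⊔ Submodule.span k {x}) ≤ linSub Z U := linSub_anti le_sup_left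
  have hpx : linSub Z (U ⊔ Submodule.span k {x} ⊔ Submodule.span k {p}) ≤
      linSub Z (U ⊔ Submodule.span k {x}) := linSub_anti le_sup_left
  have hvan : ∀ N : Submodule k (CoordRing Z), ∀ a ∈
      linSub Z (U ⊔ Submodule.span k {x} ⊔ Submodule.span k {p}) * N, ev hx a = 0 := by
    intro N a ha
    refine Submodule.mul_induction_on ha ?_ fun _ _ h h' => by rw [map_add, h, h', add_zero]
    rintro _ ⟨φ, hφ, rfl⟩ c -
    rw [map_mul, ev_lin, (mem_dualAnnihilator_sup_span_iff.1
      (mem_dualAnnihilator_sup_span_iff.1 hφ).1).2, zero_mul]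
  have hexp : ∀ m, linSub Z (U ⊔ Submodule.span k {p}) ^ (m + 1) ≤
      linSub Z (U ⊔ Submodule.span k {x} ⊔ Submodule.span k {p}) * linSub Z U ^ m ⊔
        Submodule.span k {lin Z y ^ (m + 1)} := fun m =>
    (pow_succ_le_of_le_sup_span h1 hyW m).trans
      (sup_le_sup_right (mul_le_mul' le_rfl (pow_le_pow_left' hWp m)) _)
  refine exists_pow_succ_le_of_conductor (d := d + 1) (linSub_fg U) hWp hWx hpx hyW hy0 hzW h2
    hM ?_ (by rw [Nat.add_sub_cancel]; exact hexp d) (by omega)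
  have hyb : lin Z y * b ∈ linSub Z (U ⊔ Submodule.span k {p}) ^ (d + 1) := by
    rw [pow_succ']; exact Submodule.mul_mem_mul hyW hb
  have hzb : lin Z y * (b * lin Z z) ∈ linSub Z (U ⊔ Submodule.span k {p}) ^ (d + 1 + 1) := by
    rw [pow_succ' _ (d + 1)]; exact Submodule.mul_mem_mul hyW (hbU _ (hWx hzW))
  obtain ⟨r, hr, s, hs, hrs⟩ := Submodule.mem_sup.1 (hexp d hyb)
  obtain ⟨β, rfl⟩ := Submodule.mem_span_singleton.1 hs
  obtain ⟨r', hr', s', hs', hrs'⟩ := Submodule.mem_sup.1 (hexp (d + 1) hzb)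
  obtain ⟨β', rfl⟩ := Submodule.mem_span_singleton.1 hs'
  have hβ : β = ev hx b := by
    have := congrArg (ev hx) hrs
    rw [map_add, hvan _ _ hr, map_smul, map_pow, map_mul, ev_lin, hyx] at this
    simpa using this
  have hβ' : β' = 0 := by
    have := congrArg (ev hx) hrs'
    rw [map_add, hvan _ _ hr', map_smul, map_pow, map_mul, map_mul, ev_lin, ev_lin, hyx,
        hzx] at this
    simpa using this
  rw [hβ', zero_smul, add_zero] at hrs'
  have hβ0 : β ≠ 0 := hβ ▸ hbx
  have h3 : lin Z z * lin Z y ^ (d + 1) = β⁻¹ • (r' - lin Z z * r) := by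
    rw [eq_inv_smul_iff₀ hβ0, hrs', ← mul_smul_comm, eq_sub_of_add_eq' hrs]
    ring
  rw [h3]
  refine Submodule.smul_mem _ _ (Submodule.sub_mem _ hr' ?_)
  have h4 := Submodule.mul_mem_mul (hWx hzW) hr
  rwa [mul_left_comm, ← pow_succ'] at h4

end Propagate

end PaperQuadrics

namespace PaperQuadrics

section Chain

variable {k : Type} [Field k] {ι : Type} [Fintype ι] [DecidableEq ι] {Z : Set (ι → k)}
variable {n e : ℕ} {p y : ι → k}

theorem exists_notMem_tang [CharZero k] (hZ : IsProjVariety k ι Z) (hZ0 : ∃ i, X i ∉ vanIdeal k ι Z)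
    (hp : p ∉ Z) : ∃ y ∈ Z, y ≠ 0 ∧ p ∉ tang Z y := by
  by_contra! hcon
  have hprime := hZ.prime
  obtain ⟨i, hi⟩ := hZ0
  have hder : ∀ f ∈ vanIdeal k ι Z, ∑ j, C (p j) * pderiv j f ∈ vanIdeal k ι Z := by
    intro f hf
    refine (hprime.mem_or_mem (x := X i) (y := ∑ j, C (p j) * pderiv j f) ?_).resolve_left hi
    rw [mem_vanIdeal]
    intro x hx
    rw [map_mul, eval_X]
    by_cases hx0 : x = 0
    · simp [hx0]
    · have h1 := mem_tang.1 (hcon x hx hx0) f hf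
      rw [dif_apply] at h1
      have h2 : eval x (∑ j, C (p j) * pderiv j f) = 0 := by
        rw [map_sum, ← h1]
        exact Finset.sum_congr rfl fun j _ => by rw [map_mul, eval_C, mul_comm]
      rw [h2, mul_zero]
  have hcomp : ∀ f, Polynomial.derivative (onLine 0 p f) =
      onLine 0 p (∑ j, C (p j) * pderiv j f) := by
    intro f
    refine Polynomial.funext fun t => ?_
    rw [eval_derivative_onLine, eval_onLine, dif_apply, map_sum]
    exact Finset.sum_congr rfl fun j _ => by rw [map_mul, eval_C, mul_comm]
  have hzero : ∀ N, ∀ f ∈ vanIdeal k ι Z, (onLine 0 p f).natDegree ≤ N → onLine 0 p f = 0 := by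
    intro N
    induction N with
    | zero =>
      intro f hf hN
      have h1 := mem_vanIdeal.1 hf 0 hZ.zero_mem
      have h2 := eval_onLine 0 p f 0
      rw [zero_smul, add_zero, h1, Polynomial.eq_C_of_natDegree_le_zero hN, Polynomial.eval_C] at h2
      rw [Polynomial.eq_C_of_natDegree_le_zero hN, h2, map_zero]
    | succ N ih =>
      intro f hf hN
      have h1 := ih _ (hder f hf) (by
        rw [← hcomp]
        exact (Polynomial.natDegree_derivative_le _).trans (by omega))
      rw [← hcomp] at h1
      have h3 := Polynomial.derivative_eq_zero.1 h1
      have h4 := mem_vanIdeal.1 hf 0 hZ.zero_mem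
      have h2 := eval_onLine 0 p f 0
      rw [zero_smul, add_zero, h4, Polynomial.eq_C_of_natDegree_le_zero h3.le,
        Polynomial.eval_C] at h2
      rw [Polynomial.eq_C_of_natDegree_le_zero h3.le, h2, map_zero]
  apply hp
  rw [hZ.closed]
  intro f hf
  have h1 := eval_onLine 0 p f 1
  rw [hzero _ f hf le_rfl, Polynomial.eval_zero, one_smul, zero_add] at h1
  exact h1.symm

theorem good_nil (hp0 : p ≠ 0) (hpy : p ∉ tang Z y) : Good Z p y [] := by
  refine ⟨trivial, ?_, ?_⟩
  · rw [spanL_nil, bot_sup_eq, Submodule.disjoint_span_singleton' hp0]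
    exact hpy
  · rw [spanL_nil, bot_sup_eq, finrank_span_singleton hp0, List.length_nil]

theorem exists_pow_succ_le_bot [Infinite k] (hZ : IsProjVariety k ι Z) (hp : p ∉ Z) :
    ∃ m, linSub Z (spanL []) ^ (m + 1) ≤
      linSub Z (spanL [] ⊔ Submodule.span k {p}) * linSub Z (spanL []) ^ m := by
  obtain ⟨f, hf, hfp⟩ : ∃ f ∈ vanIdeal k ι Z, eval p f ≠ 0 := by
    by_contra! hcon
    exact hp (by rw [hZ.closed]; exact hcon)
  obtain ⟨j, hj⟩ : ∃ j, eval p (homogeneousComponent j f) ≠ 0 := by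
    by_contra! hcon
    apply hfp
    rw [← sum_homogeneousComponent f, map_sum]
    exact Finset.sum_eq_zero fun j _ => hcon j
  have hjI := homogeneousComponent_mem_vanIdeal hZ hf j
  rcases j with _ | j
  · exfalso
    have := mem_vanIdeal.1 hjI 0 hZ.zero_mem
    rw [homogeneousComponent_zero, eval_C] at this hj
    exact hj this
  · rw [spanL_nil]
    refine ⟨j, linSub_pow_succ_le_of_eval_ne_zero ?_ hjI hj⟩
    rw [linR_bot_pow]
    exact homogeneousComponent_isHomogeneous _ _

theorem exists_good_chain [IsAlgClosed k] (h : IsSmoothMinimal Z n e) (hy : y ∈ Z) (hy0 : y ≠ 0)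
    (hp : p ∉ Z) (hpy : p ∉ tang Z y) {s : ℕ} (hs : s + 1 ≤ e) :
    ∃ l : List (ι → k), Good Z p y l ∧ l.length = s ∧ ∃ m, linSub Z (spanL l) ^ (m + 1) ≤
      linSub Z (spanL l ⊔ Submodule.span k {p}) * linSub Z (spanL l) ^ m := by
  have := IsAlgClosed.instInfinite (K := k)
  have hp0 : p ≠ 0 := fun h0 => hp (h0 ▸ h.proj.zero_mem)
  induction s with
  | zero => exact ⟨[], good_nil hp0 hpy, rfl, exists_pow_succ_le_bot h.proj hp⟩
  | succ s ih =>
    obtain ⟨l, hl, hls, m, hm⟩ := ih (by omega)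
    obtain ⟨d, b, hb, hb0, hbl⟩ := hl.exists_frac h hy hy0 (by omega)
    obtain ⟨z, hzZ, hzg, hzb⟩ := ((hl.cons h hy hy0 (by omega)).and h.proj.prime
      (gen_ev_ne_zero hb0)).exists
    refine ⟨z :: l, hzg, by simp [hls], ?_⟩
    have hcons : spanL (z :: l) = spanL l ⊔ Submodule.span k {z} := by rw [spanL_cons, sup_comm]
    have hpn := hzg.notMem
    rw [hcons] at hpn ⊢
    refine exists_pow_succ_le_sup h.proj hm hb hbl hzZ (hzb hzZ) ?_ hpn
    intro hmem
    have h1 := hzg.card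
    have h2 := hl.card
    have h3 : spanL (z :: l) ⊔ Submodule.span k {p} = spanL l ⊔ Submodule.span k {p} := by
      rw [hcons, sup_right_comm]
      exact sup_eq_left.2 ((Submodule.span_singleton_le_iff_mem _ _).2 hmem)
    rw [h3, h2, List.length_cons] at h1
    omega

theorem IsSmoothMinimal.exists_X_notMem (h : IsSmoothMinimal Z n e) :
    ∃ i, X i ∉ vanIdeal k ι Z := by
  have : Nonempty ι := Fintype.card_pos_iff.1 (by rw [h.card]; omega)
  refine ⟨Classical.arbitrary ι, fun hi => ?_⟩
  exact X_ne_zero _ (h.nondeg _ (isHomogeneous_X _ _) (mem_vanIdeal.1 hi))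

/-- The quadric detecting that the generic projection of `p` has length two. -/
theorem IsSmoothMinimal.exists_quadric [IsAlgClosed k] [CharZero k] (h : IsSmoothMinimal Z n e)
    (he : 2 ≤ e) (hp : p ∉ Z) : ∃ (l : List (ι → k)) (z : Module.Dual k (ι → k))
      (q : MvPolynomial ι k), CountGood Z ⊥ l ∧ l.length = e - 1 ∧ p ∉ spanL l ∧
      Module.finrank k (spanL l) = e - 1 ∧ z p = 1 ∧ q ∈ linR (spanL l) ^ 2 ∧
      q ∈ vanIdeal k ι Z ∧
      q - linForm z ^ 2 ∈ linR (spanL l ⊔ Submodule.span k {p}) * linR (spanL l) := by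
  obtain ⟨y, hy, hy0, hpy⟩ := exists_notMem_tang h.proj h.exists_X_notMem hp
  obtain ⟨l, hl, hls, M, hM⟩ := exists_good_chain h hy hy0 hp hpy (s := e - 1) (by omega)
  have hpl := hl.notMem
  obtain ⟨z, hz, hzp⟩ := exists_dual_eq_one hpl
  have hrank : Module.finrank k (spanL l) = e - 1 := by
    have h1 := hl.card
    rw [Submodule.finrank_sup_span_singleton hpl] at h1
    omega
  obtain hr | hr := h.exists_pow_mem_or_le_finrank hy hy0 le_sup_left hl.disj
      (by rw [hl.card]; omega)
    hM (lin_mem_linSub hz) 3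
  swap
  · exfalso
    obtain ⟨m, -, hm⟩ := h.exists_finrank_lt 3 0
    have h1 := h.finrank_ge_of_countGood hl.count (m + 2)
    rw [bot_sup_eq] at h1
    have h2 := hr m
    have h6 := formDim_succ_mono n (show m ≤ m + 2 by omega)
    have h7 : l.length * formDim (n + 1) m ≤ l.length * formDim (n + 1) (m + 2) :=
      Nat.mul_le_mul_left _ h6
    have h8 : (e + 2) * formDim (n + 1) m =
        l.length * formDim (n + 1) m + 3 * formDim (n + 1) m := by
      rw [hls, ← add_mul]; congr 1; omega
    have h10 : m + 2 + 1 = m + 3 := rfl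
    rw [h10] at h1
    omega
  obtain ⟨r, hr, hzr⟩ := hr
  refine ⟨l, z, ?_⟩
  obtain rfl | rfl : r = 0 ∨ r = 1 := by omega
  · exfalso
    rw [pow_zero, mul_one, zero_add, pow_one] at hzr
    obtain ⟨w', hw', hww⟩ := hzr
    rw [lin_injective h.nondeg hww] at hw'
    rw [(mem_dualAnnihilator_sup_span_iff.1 hw').2] at hzp
    exact zero_ne_one hzp
  · rw [pow_one, ← map_linR, ← map_linR (spanL l), ← Submodule.map_mul] at hzr
    obtain ⟨s, hs, hsz⟩ := hzr
    refine ⟨linForm z ^ 2 - s, hl.count, hls, hpl, hrank, hzp, ?_, ?_, ?_⟩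
    · refine Submodule.sub_mem _ (Submodule.pow_mem_pow _ (linForm_mem_linR hz) 2) ?_
      rw [pow_two]
      exact mul_le_mul' (linR_anti le_sup_left) le_rfl hs
    · rw [← mkR_eq_zero, map_sub, map_pow, mk_linForm]
      exact sub_eq_zero.2 hsz.symm
    · rw [sub_sub_cancel_left]
      exact Submodule.neg_mem _ hs

end Chain

end PaperQuadrics

namespace PaperQuadrics

section Quadric

variable {k : Type} [Field k] {ι : Type} [Fintype ι] [DecidableEq ι] {Z : Set (ι → k)}
variable {n e : ℕ} {p : ι → k}

theorem dif_linForm (x : ι → k) (φ : Module.Dual k (ι → k)) : dif x (linForm φ) = φ := by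
  ext i
  simp [dif, linForm, Pi.single_apply, pderiv_X]

theorem linR_mul_le_homogeneous (U U' : Submodule k (ι → k)) :
    linR U * linR U' ≤ homogeneousSubmodule ι k 2 := by
  rw [← linR_bot_pow, pow_two]
  exact mul_le_mul' (linR_anti bot_le) (linR_anti bot_le)

theorem exists_polar {U : Submodule k (ι → k)} {q : MvPolynomial ι k} (hq : q ∈ linR U * linR U) :
    ∃ B : (ι → k) →ₗ[k] Module.Dual k (ι → k),
      (∀ v w, eval (v + w) q = eval v q + eval w q + B v w) ∧ (∀ u ∈ U, B u = 0) ∧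
      (∀ v w, B v w = B w v) ∧ (∀ v, B v v = 2 * eval v q) ∧ ∀ v, dif v q = B v := by
  refine Submodule.mul_induction_on hq ?_ ?_
  · rintro _ ⟨φ, hφ, rfl⟩ _ ⟨ψ, hψ, rfl⟩
    refine ⟨φ.smulRight ψ + ψ.smulRight φ, fun v w => ?_, fun u hu => ?_, fun v w => ?_,
        fun v => ?_,
      fun v => ?_⟩
    · simp only [map_mul, eval_linForm, map_add, LinearMap.add_apply, LinearMap.smulRight_apply,
        LinearMap.smul_apply, smul_eq_mul]
      ring
    · simp [(Submodule.mem_dualAnnihilator _).1 hφ u hu,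
        (Submodule.mem_dualAnnihilator _).1 hψ u hu]
    · simp; ring
    · simp; ring
    · simp [dif_mul, dif_linForm]
  · rintro f g ⟨B, h1, h2, h3, h4, h5⟩ ⟨B', h1', h2', h3', h4', h5'⟩
    refine ⟨B + B', fun v w => ?_, fun u hu => ?_, fun v w => ?_, fun v => ?_, fun v => ?_⟩
    · simp only [map_add, LinearMap.add_apply, h1, h1']; ring
    · simp [h2 u hu, h2' u hu]
    · simp [h3 v w, h3' v w]
    · simp only [map_add, LinearMap.add_apply, h4, h4']; ring
    · simp [h5, h5']

theorem CountGood.last {U : Submodule k (ι → k)} {l : List (ι → k)} {x : ι → k}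
    (h : CountGood Z U (l ++ [x])) : x ∈ Z ∧ x ≠ 0 ∧ Disjoint (tang Z x) (U ⊔ spanL l) := by
  induction l generalizing U with
  | nil => rw [spanL_nil, sup_bot_eq]; exact h.1
  | cons z l ih => rw [spanL_cons, ← sup_assoc]; exact ih h.2

theorem IsSmoothMinimal.exists_quadric_ker [IsAlgClosed k] [CharZero k] (h : IsSmoothMinimal Z n e)
    (he : 2 ≤ e) (hp : p ∉ Z) : ∃ (z : Module.Dual k (ι → k)) (q : MvPolynomial ι k)
      (K : Submodule k (ι → k)), z p = 1 ∧ q.IsHomogeneous 2 ∧ q ∈ vanIdeal k ι Z ∧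
      q - linForm z ^ 2 ∈ linR (Submodule.span k {p}) * linR ⊥ ∧ p ∉ K ∧
      n + e ≤ Module.finrank k K + 3 ∧
      ∀ x ∈ K, eval x q = 0 ∧ dif x q p = 0 ∧ ∀ v, eval (v - x) q = eval v q := by
  have := IsAlgClosed.instInfinite (K := k)
  obtain ⟨l, z, q, hl, hls, -, hrank, hzp, hq, hqI, hqz⟩ := h.exists_quadric he hp
  rw [pow_two] at hq
  have hq2 := linR_mul_le_homogeneous _ _ hq
  obtain ⟨B, hB, hBU, hBs, hBq, hBd⟩ := exists_polar hq
  have hqp : eval p q = 1 := by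
    have h1 := eval_eq_zero_of_mem_linR_mul
      (Submodule.mem_sup_right (Submodule.mem_span_singleton_self p)) hqz
    rw [map_sub, map_pow, eval_linForm, hzp, one_pow, sub_eq_zero] at h1
    exact h1
  have hker : ∀ x, B x = 0 → eval x q = 0 := fun x hx => by
    have h1 := hBq x
    rw [hx, LinearMap.zero_apply] at h1
    exact (mul_eq_zero.1 h1.symm).resolve_left two_ne_zero
  have hinv : ∀ x, B x = 0 → ∀ v, eval (v - x) q = eval v q := fun x hx v => by
    have h1 := hB (v - x) x
    rw [sub_add_cancel, hker x hx, hBs, hx, LinearMap.zero_apply, add_zero, add_zero] at h1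
    exact h1.symm
  refine ⟨z, q, LinearMap.ker B, hzp, hq2, hqI,
    mul_le_mul' (linR_anti le_sup_right) (linR_anti bot_le) hqz, ?_, ?_, fun x hx =>
    ⟨hker x hx, by rw [hBd, LinearMap.mem_ker.1 hx, LinearMap.zero_apply], hinv x hx⟩⟩
  · intro hpK
    have := hker p hpK
    rw [hqp] at this
    exact one_ne_zero this
  obtain ⟨l', x, rfl⟩ : ∃ l' x, l = l' ++ [x] :=
    ⟨_, _, (List.dropLast_append_getLast (by rintro rfl; simp at hls; omega)).symm⟩
  obtain ⟨hx, hx0, hdis⟩ := hl.last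
  rw [bot_sup_eq] at hdis
  have hsub : spanL l' ≤ spanL (l' ++ [x]) := Submodule.span_mono fun y hy => List.mem_append_left _ hy
  have hBx : B x = 0 := hBU x (Submodule.subset_span (by simp))
  have hT : ∀ v ∈ tang Z x, eval v q = 0 := fun v hv =>
    h.eval_quadric_eq_zero hx hx0 hq2 hqI (hinv x hBx) hv
  set K := tang Z x ⊔ spanL l' with hK
  have hBK : ∀ a ∈ K, ∀ b ∈ K, B a b = 0 := by
    intro a ha b hb
    obtain ⟨t, ht, u, hu, rfl⟩ := Submodule.mem_sup.1 ha
    obtain ⟨t', ht', u', hu', rfl⟩ := Submodule.mem_sup.1 hb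
    rw [map_add B, hBU u (hsub hu), add_zero, map_add, hBs t u', hBU u' (hsub hu'),
      LinearMap.zero_apply, add_zero]
    have h1 := hB t t'
    rw [hT t ht, hT t' ht', hT _ (Submodule.add_mem _ ht ht')] at h1
    simpa using h1.symm
  have hKrank : n + e ≤ Module.finrank k K + 1 := by
    have h1 := Submodule.finrank_sup_add_finrank_inf_eq (tang Z x) (spanL l')
    rw [disjoint_iff.1 hdis, finrank_bot, add_zero, h.finrank_tang hx hx0, ← hK] at h1
    have h2 : spanL (l' ++ [x]) ≤ spanL l' ⊔ Submodule.span k {x} := by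
      rw [spanL, Submodule.span_le]
      intro y hy
      rcases List.mem_append.1 hy with hy | hy
      · exact Submodule.mem_sup_left (Submodule.subset_span hy)
      · rw [List.mem_singleton.1 hy]
        exact Submodule.mem_sup_right (Submodule.mem_span_singleton_self x)
    have h3 := (Submodule.finrank_mono h2).trans (finrank_sup_span_singleton_le _ _)
    omega
  have h1 := LinearMap.finrank_range_add_finrank_ker (B.domRestrict K)
  have h2 : Module.finrank k (LinearMap.range (B.domRestrict K)) ≤
      Module.finrank k K.dualAnnihilator := by
    refine Submodule.finrank_mono ?_
    rintro _ ⟨a, rfl⟩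
    rw [Submodule.mem_dualAnnihilator]
    exact fun b hb => hBK a a.2 b hb
  have h3 := Subspace.finrank_add_finrank_dualAnnihilator_eq K
  rw [Module.finrank_fintype_fun_eq_card, h.card] at h3
  have h4 : Module.finrank k (LinearMap.ker (B.domRestrict K)) ≤
      Module.finrank k (LinearMap.ker B) := by
    refine LinearMap.finrank_le_finrank_of_injective
      (f := (K.subtype.comp (LinearMap.ker
          (B.domRestrict K)).subtype).codRestrict _ fun a => a.2) ?_
    intro a b hab
    have := congrArg Subtype.val hab
    exact Subtype.ext (Subtype.ext this)
  omega

end Quadric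

end PaperQuadrics

namespace PaperQuadrics

section LocalAlgebra

variable {R : Type*} [CommRing R]

/-- `f` is a nonzerodivisor modulo `J`. -/
def RegMod (J : Ideal R) (f : R) : Prop := ∀ a, f * a ∈ J → a ∈ J

/-- A weakly regular sequence modulo `J`. -/
def RegSeq : Ideal R → List R → Prop
  | _, [] => True
  | J, f :: fs => RegMod J f ∧ RegSeq (J ⊔ Ideal.span {f}) fs

/-- `P` is an associated prime of `R ⧸ J`. -/
def AssMod (J P : Ideal R) : Prop := P.IsPrime ∧ ∃ u, ∀ a, a ∈ P ↔ a * u ∈ J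

/-- No element outside `J` is killed by `m` modulo `J`. -/
def NoSoc (m J : Ideal R) : Prop := ∀ u, (∀ a ∈ m, a * u ∈ J) → u ∈ J

theorem RegMod.noSoc {m J : Ideal R} {f : R} (h : RegMod J f) (hf : f ∈ m) : NoSoc m J :=
  fun u hu => h u (hu f hf)

theorem mem_sup_span_singleton_iff {J : Ideal R} {f a : R} :
    a ∈ J ⊔ Ideal.span {f} ↔ ∃ c, a - f * c ∈ J := by
  rw [sup_comm, Ideal.mem_span_singleton_sup]
  constructor
  · rintro ⟨c, b, hb, rfl⟩
    exact ⟨c, by rwa [mul_comm f c, add_sub_cancel_left]⟩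
  · rintro ⟨c, hc⟩
    exact ⟨c, _, hc, by ring⟩

theorem RegMod.exchange {J : Ideal R} {f h : R} (hf : RegMod J f)
    (hh : RegMod (J ⊔ Ideal.span {f}) h) : RegMod (J ⊔ Ideal.span {h}) f := by
  intro a ha
  obtain ⟨b, hb⟩ := mem_sup_span_singleton_iff.1 ha
  obtain ⟨c, hc⟩ := mem_sup_span_singleton_iff.1 (hh b (mem_sup_span_singleton_iff.2
    ⟨a, by rw [← neg_mem_iff, neg_sub]; exact hb⟩))
  refine mem_sup_span_singleton_iff.2 ⟨c, hf _ ?_⟩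
  have := J.add_mem hb (J.mul_mem_left h hc)
  convert this using 1
  ring

theorem noSoc_exchange {m J : Ideal R} {f g : R} (hf : RegMod J f) (hfm : f ∈ m)
    (hs : NoSoc m (J ⊔ Ideal.span {f})) (hg : RegMod J g) : NoSoc m (J ⊔ Ideal.span {g}) := by
  intro u hu
  obtain ⟨v, hv⟩ := mem_sup_span_singleton_iff.1 (hu f hfm)
  obtain ⟨w, hw⟩ := mem_sup_span_singleton_iff.1 (hs v fun a ha => by
    obtain ⟨w, hw⟩ := mem_sup_span_singleton_iff.1 (hu a ha)
    refine mem_sup_span_singleton_iff.2 ⟨w, hg _ ?_⟩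
    have := J.sub_mem (J.mul_mem_left f hw) (J.mul_mem_left a hv)
    convert this using 1
    ring)
  refine mem_sup_span_singleton_iff.2 ⟨w, hf _ ?_⟩
  have := J.add_mem hv (J.mul_mem_left g hw)
  convert this using 1
  ring

theorem exists_assMod [IsNoetherianRing R] {J : Ideal R} {u : R} (hu : u ∉ J) :
    ∃ P, AssMod J P ∧ ∀ a, a * u ∈ J → a ∈ P := by
  obtain ⟨P, hP, hle⟩ := exists_le_isAssociatedPrime_of_isNoetherianRing R
    (Ideal.Quotient.mk J u) (by rwa [Ne, Ideal.Quotient.eq_zero_iff_mem])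
  obtain ⟨hP1, x, hx⟩ := (isAssociatedPrime_iff).1 hP
  obtain ⟨v, rfl⟩ := Ideal.Quotient.mk_surjective x
  have key : ∀ w a : R, a ∈ (⊥ : Submodule R (R ⧸ J)).colon {Ideal.Quotient.mk J w} ↔
      a * w ∈ J := by
    intro w a
    rw [Submodule.mem_colon_singleton, Submodule.mem_bot, ← Ideal.Quotient.eq_zero_iff_mem, map_mul,
      Algebra.smul_def, Ideal.Quotient.algebraMap_eq]
  exact ⟨P, ⟨hP1, v, fun a => by rw [hx, key]⟩, fun a ha => hle ((key u a).2 ha)⟩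

theorem exists_regMod_of_noSoc [IsNoetherianRing R] {m : Ideal R} {s : Set (Ideal R)}
    (hs : s.Finite) (h : ∀ J ∈ s, NoSoc m J) : ∃ f ∈ m, ∀ J ∈ s, RegMod J f := by
  have hfin : (⋃ J ∈ s, associatedPrimes R (R ⧸ J)).Finite :=
    hs.biUnion fun J _ => associatedPrimes.finite R (R ⧸ J)
  have key : ∀ J w a : _, a ∈ (⊥ : Submodule R (R ⧸ J)).colon {Ideal.Quotient.mk J w} ↔
      a * w ∈ J := by
    intro J w a
    rw [Submodule.mem_colon_singleton, Submodule.mem_bot, ← Ideal.Quotient.eq_zero_iff_mem, map_mul,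
      Algebra.smul_def, Ideal.Quotient.algebraMap_eq]
  by_contra! hcon
  have hsub : (m : Set R) ⊆ ⋃ P ∈ (⋃ J ∈ s, associatedPrimes R (R ⧸ J)),
      ((id P : Ideal R) : Set R) := by
    intro f hf
    obtain ⟨J, hJ, hJf⟩ := hcon f hf
    unfold RegMod at hJf
    push Not at hJf
    obtain ⟨a, ha, haJ⟩ := hJf
    have h1 : f ∈ {r : R | ∃ x : R ⧸ J, x ≠ 0 ∧ r • x = 0} :=
      ⟨Ideal.Quotient.mk J a, by rwa [Ne, Ideal.Quotient.eq_zero_iff_mem], by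
        rw [Algebra.smul_def, Ideal.Quotient.algebraMap_eq, ← map_mul,
          Ideal.Quotient.eq_zero_iff_mem]; exact ha⟩
    rw [← biUnion_associatedPrimes_eq_zero_divisors] at h1
    obtain ⟨P, hP, hfP⟩ := Set.mem_iUnion₂.1 h1
    exact Set.mem_iUnion₂.2 ⟨P, Set.mem_iUnion₂.2 ⟨J, hJ, hP⟩, hfP⟩
  obtain ⟨P, hP, hmP⟩ := (Ideal.subset_union_prime_finite hfin (f := id) ⊤ ⊤ (fun P hP _ _ => by
    obtain ⟨J, -, hJ⟩ := Set.mem_iUnion₂.1 hP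
    exact hJ.isPrime)).1 hsub
  obtain ⟨J, hJ, hPJ⟩ := Set.mem_iUnion₂.1 hP
  obtain ⟨hP1, x, hx⟩ := (isAssociatedPrime_iff).1 hPJ
  obtain ⟨v, rfl⟩ := Ideal.Quotient.mk_surjective x
  apply hP1.ne_top
  rw [Ideal.eq_top_iff_one, hx, key, one_mul]
  refine h J hJ v fun a ha => ?_
  have := hmP ha
  rwa [id, hx, key] at this

theorem RegSeq.exists_finite_exchange {m J : Ideal R} {fs : List R} (h : RegSeq J fs)
    (hfs : ∀ f ∈ fs, f ∈ m) : ∃ s : Set (Ideal R), s.Finite ∧ (∀ J' ∈ s, NoSoc m J') ∧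
      ∀ a, (∀ J' ∈ s, RegMod J' a) → RegSeq (J ⊔ Ideal.span {a}) fs.dropLast := by
  induction fs generalizing J with
  | nil => exact ⟨∅, Set.finite_empty, by simp, fun _ _ => trivial⟩
  | cons f fs ih =>
    rcases fs with _ | ⟨f', fs⟩
    · exact ⟨∅, Set.finite_empty, by simp, fun _ _ => trivial⟩
    · obtain ⟨s, hs, hs1, hs2⟩ := ih h.2 fun g hg => hfs g (List.mem_cons_of_mem _ hg)
      refine ⟨insert (J ⊔ Ideal.span {f}) s, hs.insert _, ?_, fun a ha => ⟨?_, ?_⟩⟩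
      · rintro J' (rfl | hJ')
        · exact h.2.1.noSoc (hfs f' (by simp))
        · exact hs1 J' hJ'
      · exact h.1.exchange (ha _ (Set.mem_insert _ _))
      · rw [sup_right_comm]
        exact hs2 a fun J' hJ' => ha J' (Set.mem_insert_of_mem _ hJ')

theorem ringKrullDim_succ_le_of_lt {P P' : Ideal R} [P.IsPrime] (h : P ≤ P') {f : R} (hf : f ∉ P)
    (hf' : f ∈ P') : ringKrullDim (R ⧸ P') + 1 ≤ ringKrullDim (R ⧸ P) :=
  ringKrullDim_succ_le_of_surjective (Ideal.Quotient.factor h) (Ideal.Quotient.factor_surjective h)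
    (r := Ideal.Quotient.mk P f)
    (mem_nonZeroDivisors_of_ne_zero (by rwa [Ne, Ideal.Quotient.eq_zero_iff_mem]))
    (by rw [Ideal.Quotient.factor_mk, Ideal.Quotient.eq_zero_iff_mem]; exact hf')

theorem AssMod.exists_le [IsNoetherianRing R] [IsLocalRing R] {J P : Ideal R} (hP : AssMod J P)
    {h : R} (hh : RegMod J h) (hm : h ∈ IsLocalRing.maximalIdeal R) :
    ∃ P', AssMod (J ⊔ Ideal.span {h}) P' ∧ P ≤ P' ∧ h ∈ P' ∧ h ∉ P := by
  obtain ⟨hprime, hne⟩ := hP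
  have hwf : WellFounded ((· > ·) : Ideal R → Ideal R → Prop) := wellFounded_gt
  obtain ⟨I, ⟨u, hu, rfl⟩, hmax⟩ := hwf.has_min
    {I | ∃ u, (∀ a, a ∈ P ↔ a * u ∈ J) ∧ J ⊔ Ideal.span {u} = I} (by
      obtain ⟨u, hu⟩ := hne
      exact ⟨_, u, hu, rfl⟩)
  have huJ : u ∉ J := fun h1 => hprime.ne_top
    (P.eq_top_iff_one.2 ((hu 1).2 (by rwa [one_mul])))
  have hu' : u ∉ J ⊔ Ideal.span {h} := by
    intro hmem
    obtain ⟨v, hv⟩ := mem_sup_span_singleton_iff.1 hmem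
    have hvP : ∀ a, a ∈ P ↔ a * v ∈ J := by
      intro a
      have h1 := J.mul_mem_left a hv
      have h2 : a * u = a * (u - h * v) + h * (a * v) := by ring
      rw [hu]
      constructor
      · intro h3
        rw [h2] at h3
        exact hh _ ((J.add_mem_iff_right h1).1 h3)
      · intro h3
        rw [h2]
        exact J.add_mem h1 (J.mul_mem_left h h3)
    refine hmax _ ⟨v, hvP, rfl⟩ (lt_of_le_of_ne ?_ ?_)
    · refine sup_le le_sup_left ((Ideal.span_singleton_le_iff_mem _).2 ?_)
      exact mem_sup_span_singleton_iff.2 ⟨h, by rwa [mul_comm v h]⟩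
    · intro heq
      have h1 : v ∈ J ⊔ Ideal.span {u} := by
        rw [heq]
        exact Ideal.mem_sup_right (Ideal.mem_span_singleton_self v)
      obtain ⟨s, hs⟩ := mem_sup_span_singleton_iff.1 h1
      have h2 : 1 - h * s ∈ P := by
        rw [hu]
        have := J.add_mem hv (J.mul_mem_left h hs)
        convert this using 1
        ring
      have h3 := IsLocalRing.le_maximalIdeal hprime.ne_top h2
      have h4 := Ideal.add_mem _ h3 (Ideal.mul_mem_right s _ hm)
      rw [sub_add_cancel] at h4
      exact (Ideal.ne_top_iff_one _).1 (IsLocalRing.maximalIdeal.isMaximal R).ne_top h4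
  obtain ⟨P', hP', hle⟩ := exists_assMod hu'
  refine ⟨P', hP', fun a ha => hle a (Ideal.mem_sup_left ((hu a).1 ha)), hle h ?_, fun hhP => ?_⟩
  · exact Ideal.mem_sup_right (Ideal.mul_mem_right _ _ (Ideal.mem_span_singleton_self h))
  · exact huJ (hh u ((hu h).1 hhP))

/-- Depth bounds the dimension of the primes associated to a hypersurface section. -/
theorem RegSeq.le_ringKrullDim [IsNoetherianRing R] [IsLocalRing R] {N : ℕ} {I P : Ideal R}
    {fs : List R} {g : R} (hfs : RegSeq I fs) (hm : ∀ f ∈ fs, f ∈ IsLocalRing.maximalIdeal R)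
    (hN : fs.length = N + 1) (hg : RegMod I g)
    (hP : AssMod (I ⊔ Ideal.span {g}) P) : (N : WithBot ℕ∞) ≤ ringKrullDim (R ⧸ P) := by
  induction N generalizing I P fs with
  | zero =>
    have := Ideal.Quotient.nontrivial_iff.2 hP.1.ne_top
    exact_mod_cast ringKrullDim_nonneg_of_nontrivial
  | succ N ih =>
    obtain ⟨s, hs, hs1, hs2⟩ := hfs.exists_finite_exchange hm
    have hsoc : NoSoc (IsLocalRing.maximalIdeal R) (I ⊔ Ideal.span {g}) := by
      match fs, hfs, hm, hN with
      | f :: f' :: fs, hfs, hm, hN =>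
        exact noSoc_exchange hfs.1 (hm f (by simp)) (hfs.2.1.noSoc (hm f' (by simp))) hg
    obtain ⟨h, hhm, hh⟩ := exists_regMod_of_noSoc (hs.insert (I ⊔ Ideal.span {g})) (by
      rintro J (rfl | hJ)
      · exact hsoc
      · exact hs1 J hJ)
    have hhg := hh _ (Set.mem_insert _ _)
    obtain ⟨P', hP', hle, hhP', hhP⟩ := hP.exists_le hhg hhm
    have := hP.1
    rw [sup_right_comm] at hP'
    have h1 := ih (hs2 h fun J hJ => hh J (Set.mem_insert_of_mem _ hJ))
      (fun f hf => hm f (List.dropLast_subset _ hf)) (by simp [hN]) (hg.exchange hhg) hP'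
    have h2 := ringKrullDim_succ_le_of_lt hle hhP hhP'
    refine le_trans ?_ h2
    push_cast
    gcongr

end LocalAlgebra

end PaperQuadrics

namespace PaperQuadrics

section Localize

variable {S : Type*} [CommRing S]

theorem regSeq_of_forall {I : Ideal S} {fs : List S}
    (h : ∀ i : Fin fs.length, RegMod (I ⊔ Ideal.span {x | ∃ j : Fin fs.length,
        j < i ∧ fs.get j = x})
      (fs.get i)) : RegSeq I fs := by
  induction fs generalizing I with
  | nil => trivial
  | cons f fs ih =>
    refine ⟨?_, ih fun i => ?_⟩
    · have := h ⟨0, by simp⟩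
      have h1 : {x | ∃ j : Fin (f :: fs).length, j < ⟨0, by simp⟩ ∧ (f :: fs).get j = x} = ∅ := by
        ext x
        simp
      rw [h1, Ideal.span_empty, sup_bot_eq] at this
      exact this
    · have := h i.succ
      have h1 : {x | ∃ j : Fin (f :: fs).length, j < i.succ ∧ (f :: fs).get j = x} =
          {f} ∪ {x | ∃ j : Fin fs.length, j < i ∧ fs.get j = x} := by
        ext x
        simp only [Set.mem_ofPred_eq, Set.mem_union, Set.mem_singleton_iff]
        constructor
        · rintro ⟨j, hj, rfl⟩
          refine Fin.cases (motive := fun j : Fin (fs.length + 1) => j < i.succ →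
            (f :: fs).get j = f ∨ ∃ j' : Fin fs.length, j' < i ∧ fs.get j' = (f :: fs).get j)
            (fun _ => Or.inl rfl) (fun j hj => Or.inr ⟨j, ?_, rfl⟩) j hj
          exact Fin.succ_lt_succ_iff.1 hj
        · rintro (rfl | ⟨j, hj, rfl⟩)
          · exact ⟨⟨0, by simp⟩, Fin.succ_pos i, rfl⟩
          · exact ⟨j.succ, Fin.succ_lt_succ_iff.2 hj, rfl⟩
      rw [h1, Ideal.span_union, ← sup_assoc] at this
      exact this

variable {R : Type*} [CommRing R] [Algebra S R] (M : Submonoid S) [IsLocalization M R]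

include M in
theorem RegMod.map_localization {J : Ideal S} {f : S} (h : RegMod J f) :
    RegMod (J.map (algebraMap S R)) (algebraMap S R f) := by
  intro a ha
  obtain ⟨⟨x, s⟩, hx⟩ := IsLocalization.surj M a
  have h1 : algebraMap S R (f * x) ∈ J.map (algebraMap S R) := by
    rw [map_mul, ← hx, ← mul_assoc]
    exact Ideal.mul_mem_right _ _ ha
  obtain ⟨m, hm, hmx⟩ := (IsLocalization.algebraMap_mem_map_algebraMap_iff M R J _).1 h1
  have h2 : algebraMap S R x ∈ J.map (algebraMap S R) :=
    (IsLocalization.algebraMap_mem_map_algebraMap_iff M R J _).2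
      ⟨m, hm, h _ (by rwa [mul_left_comm])⟩
  rw [← hx] at h2
  obtain ⟨t, ht⟩ := (IsLocalization.map_units R s).exists_right_inv
  have h3 := Ideal.mul_mem_right t _ h2
  rwa [mul_assoc, ht, mul_one] at h3

theorem map_sup_span_singleton (J : Ideal S) (f : S) :
    (J ⊔ Ideal.span {f}).map (algebraMap S R) =
      J.map (algebraMap S R) ⊔ Ideal.span {algebraMap S R f} := by
  rw [Ideal.map_sup, Ideal.map_span, Set.image_singleton]

include M in
theorem RegSeq.map_localization {J : Ideal S} {fs : List S} (h : RegSeq J fs) :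
    RegSeq (J.map (algebraMap S R)) (fs.map (algebraMap S R)) := by
  induction fs generalizing J with
  | nil => trivial
  | cons f fs ih =>
    refine ⟨h.1.map_localization M, ?_⟩
    rw [← map_sup_span_singleton]
    exact ih h.2

theorem ringKrullDim_quotient_le_of_pow_mem [IsNoetherianRing R] [IsLocalRing R] {P : Ideal R}
    [P.IsPrime] (T : Finset R) (hT : ∀ t ∈ T, t ∈ IsLocalRing.maximalIdeal R)
    (h : ∀ x ∈ IsLocalRing.maximalIdeal R, ∃ m : ℕ, x ^ m ∈ P ⊔ Ideal.span (T : Set R)) :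
    ringKrullDim (R ⧸ P) ≤ T.card := by
  classical
  have hloc : IsLocalRing (R ⧸ P) :=
    IsLocalRing.of_surjective' (Ideal.Quotient.mk P) Ideal.Quotient.mk_surjective
  rw [← IsLocalRing.maximalIdeal_height_eq_ringKrullDim]
  have hmax : ∀ x, Ideal.Quotient.mk P x ∈ IsLocalRing.maximalIdeal (R ⧸ P) ↔
      x ∈ IsLocalRing.maximalIdeal R := by
    intro x
    have : IsLocalHom (Ideal.Quotient.mk P) :=
      IsLocalHom.of_surjective _ Ideal.Quotient.mk_surjective
    exact not_iff_not.1 (by simp)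
  have hmin : IsLocalRing.maximalIdeal (R ⧸ P) ∈
      (Ideal.span ((T.image (Ideal.Quotient.mk P) : Finset (R ⧸ P)) :
          Set (R ⧸ P))).minimalPrimes := by
    refine ⟨⟨inferInstance, ?_⟩, fun Q hQ _ => ?_⟩
    · rw [Ideal.span_le]
      intro y hy
      obtain ⟨t, ht, rfl⟩ := Finset.mem_image.1 hy
      exact (hmax t).2 (hT t ht)
    · intro y hy
      obtain ⟨x, rfl⟩ := Ideal.Quotient.mk_surjective y
      obtain ⟨m, hm⟩ := h x ((hmax x).1 hy)
      have h1 := Ideal.mem_map_of_mem (Ideal.Quotient.mk P) hm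
      rw [Ideal.map_sup, Ideal.map_quotient_self, bot_sup_eq, Ideal.map_span,
        ← Finset.coe_image, map_pow] at h1
      exact hQ.1.mem_of_pow_mem m (hQ.2 h1)
  have h1 := Ideal.height_le_card_of_mem_minimalPrimes_span_finset hmin
  exact_mod_cast h1.trans (by exact_mod_cast Finset.card_image_le)

end Localize

end PaperQuadrics

namespace PaperQuadrics

theorem exists_ne_zero_of_regSeq {k σ : Type} [Field k] [IsAlgClosed k] [Fintype σ]
    {I : Ideal (MvPolynomial σ k)} {fs : List (MvPolynomial σ k)} {N : ℕ} (hfs : RegSeq I fs)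
    (hm : ∀ f ∈ fs, eval 0 f = 0) (hN : fs.length = N + 1) {g s : MvPolynomial σ k}
    (hg : RegMod I g) (hs : ∀ a, a * s ∈ I ⊔ Ideal.span {g} → eval 0 a = 0)
    (T : Finset (MvPolynomial σ k)) (hT : ∀ t ∈ T, eval 0 t = 0) (hTN : T.card < N) :
    ∃ y : σ → k, y ≠ 0 ∧ (∀ a, a * s ∈ I ⊔ Ideal.span {g} → eval y a = 0) ∧
      ∀ t ∈ T, eval y t = 0 := by
  classical
  have hprime : (RingHom.ker (eval (0 : σ → k))).IsPrime := RingHom.ker_isPrime _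
  let m₀ : Ideal (MvPolynomial σ k) := RingHom.ker (eval (0 : σ → k))
  have : m₀.IsPrime := hprime
  let R := Localization.AtPrime m₀
  let φ : MvPolynomial σ k →+* R := algebraMap _ R
  have hφ : ∀ f, φ f ∈ IsLocalRing.maximalIdeal R ↔ eval 0 f = 0 := fun f =>
    IsLocalization.AtPrime.to_map_mem_maximal_iff R m₀ f
  have hs0 : φ s ∉ (I ⊔ Ideal.span {g}).map φ := by
    intro h
    obtain ⟨u, hu, hus⟩ :=
      (IsLocalization.algebraMap_mem_map_algebraMap_iff m₀.primeCompl R _ _).1 h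
    exact hu (hs u hus)
  obtain ⟨P, hP, hPs⟩ := exists_assMod hs0
  have hPp := hP.1
  have hdim : (N : WithBot ℕ∞) ≤ ringKrullDim (R ⧸ P) := by
    refine RegSeq.le_ringKrullDim (hfs.map_localization (R := R) m₀.primeCompl) ?_ (by simpa)
      (hg.map_localization (R := R) m₀.primeCompl) (map_sup_span_singleton (R := R) I g ▸ hP)
    intro f hf
    obtain ⟨f', hf', rfl⟩ := List.mem_map.1 hf
    exact (hφ f').2 (hm f' hf')
  by_contra! hcon
  let Q : Ideal (MvPolynomial σ k) := P.comap φ ⊔ Ideal.span (T : Set (MvPolynomial σ k))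
  have hQ : ∀ f, eval 0 f = 0 → f ∈ Q.radical := by
    intro f hf
    rw [← vanishingIdeal_zeroLocus_eq_radical (K := k), mem_vanishingIdeal_iff]
    intro y hy
    rw [mem_zeroLocus_iff] at hy
    simp only [aeval_eq_eval] at hy ⊢
    by_cases hy0 : y = 0
    · rwa [hy0]
    · obtain ⟨t, ht, hyt⟩ := hcon y hy0 fun a ha => hy a <| Ideal.mem_sup_left <| by
        rw [Ideal.mem_comap]
        apply hPs
        rw [← map_mul]
        exact Ideal.mem_map_of_mem φ ha
      exact absurd (hy t (Ideal.mem_sup_right (Ideal.subset_span ht))) hyt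
  have h1 : ringKrullDim (R ⧸ P) ≤ (T.image φ).card := by
    refine ringKrullDim_quotient_le_of_pow_mem (T.image φ) ?_ ?_
    · intro t ht
      obtain ⟨t', ht', rfl⟩ := Finset.mem_image.1 ht
      exact (hφ t').2 (hT t' ht')
    · intro x hx
      obtain ⟨⟨f, u⟩, hf⟩ := IsLocalization.surj m₀.primeCompl x
      have hf0 : eval 0 f = 0 := by
        rw [← hφ]
        change algebraMap _ R f ∈ _
        rw [← hf]
        exact Ideal.mul_mem_right _ _ hx
      obtain ⟨m, hm⟩ := hQ f hf0
      refine ⟨m, ?_⟩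
      have h2 : φ (f ^ m) ∈ P ⊔ Ideal.span ((T.image φ : Finset R) : Set R) := by
        have h3 := Ideal.mem_map_of_mem φ hm
        rw [Ideal.map_sup, Ideal.map_span, ← Finset.coe_image] at h3
        exact (sup_le_sup_right (α := Ideal R) Ideal.map_comap_le _) h3
      obtain ⟨t, ht⟩ := (IsLocalization.map_units R u).exists_right_inv
      have h4 : x = φ f * t := by
        change x = algebraMap _ R f * t
        rw [← hf, mul_assoc, ht, mul_one]
      rw [h4, mul_pow, ← map_pow]
      exact Ideal.mul_mem_right _ _ h2
  have h2 : (N : WithBot ℕ∞) ≤ (T.card : ℕ) :=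
    (hdim.trans h1).trans (by exact_mod_cast Finset.card_image_le)
  exact absurd (by exact_mod_cast h2 : N ≤ T.card) (by omega)

end PaperQuadrics

namespace PaperQuadrics

variable {k : Type} [Field k] {ι κ : Type} [Fintype ι] [DecidableEq ι] [Fintype κ] [DecidableEq κ]
  {Z : Set (ι → k)} {n e : ℕ} {p : ι → k} {pr : (ι → k) →ₗ[k] (κ → k)}

/-- The comorphism of a linear map of affine spaces. -/
def comorph (pr : (ι → k) →ₗ[k] (κ → k)) : MvPolynomial κ k →ₐ[k] MvPolynomial ι k :=
  aeval fun j => linForm (LinearMap.proj j ∘ₗ pr)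

@[simp] theorem eval_comorph (x : ι → k) (f : MvPolynomial κ k) :
    eval x (comorph pr f) = eval (pr x) f := by
  rw [comorph, ← aeval_eq_eval, comp_aeval_apply, ← aeval_eq_eval]
  congr 2
  funext j
  simp

theorem comorph_linForm [Infinite k] (φ : Module.Dual k (κ → k)) :
    comorph pr (linForm φ) = linForm (φ ∘ₗ pr) :=
  MvPolynomial.funext fun x => by simp

theorem dif_comorph {x v : ι → k} (hv : pr v = 0) (f : MvPolynomial κ k) :
    dif x (comorph pr f) v = 0 := by
  induction f using MvPolynomial.induction_on with
  | C c =>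
    rw [← algebraMap_eq, AlgHom.commutes, algebraMap_eq, dif_C, LinearMap.zero_apply]
  | add f g hf hg => rw [map_add, map_add, LinearMap.add_apply, hf, hg, add_zero]
  | mul_X f i hf =>
    have h1 : comorph pr (X i) = linForm (LinearMap.proj i ∘ₗ pr) := by simp [comorph]
    rw [map_mul, dif_mul, h1, dif_linForm]
    simp [hf, hv]

theorem comorph_mem_vanIdeal {f : MvPolynomial κ k} :
    comorph pr f ∈ vanIdeal k ι Z ↔ f ∈ vanIdeal k κ (pr '' Z) := by
  simp [mem_vanIdeal]

theorem exists_comorph_linForm [Infinite k] (hker : LinearMap.ker pr = Submodule.span k {p})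
    (hsurj : Function.Surjective pr) {φ : Module.Dual k (ι → k)} (hφ : φ p = 0) :
    ∃ ψ, linForm φ = comorph pr (linForm ψ) := by
  obtain ⟨s, hs⟩ := pr.exists_rightInverse_of_surjective (LinearMap.range_eq_top.2 hsurj)
  refine ⟨φ ∘ₗ s, ?_⟩
  rw [comorph_linForm]
  congr 1
  refine LinearMap.ext fun x => ?_
  have h1 : x - s (pr x) ∈ Submodule.span k {p} := by
    rw [← hker, LinearMap.mem_ker, map_sub, sub_eq_zero]
    exact (LinearMap.congr_fun hs (pr x)).symm
  obtain ⟨c, hc⟩ := Submodule.mem_span_singleton.1 h1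
  have h2 : φ (x - s (pr x)) = 0 := by rw [← hc, map_smul, hφ, smul_zero]
  rw [map_sub, sub_eq_zero] at h2
  simpa using h2

theorem linR_span_le_range [Infinite k] (hker : LinearMap.ker pr = Submodule.span k {p})
    (hsurj : Function.Surjective pr) :
    linR (Submodule.span k {p}) ≤ Subalgebra.toSubmodule (comorph pr).range := by
  rintro _ ⟨φ, hφ, rfl⟩
  obtain ⟨ψ, hψ⟩ := exists_comorph_linForm hker hsurj
    ((Submodule.mem_dualAnnihilator _).1 hφ p (Submodule.mem_span_singleton_self p))
  exact ⟨_, hψ.symm⟩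

theorem dif_zero_eq_zero [Infinite k] (hZ : IsProjVariety k ι Z) (hnd : Nondeg k ι Z)
    {f : MvPolynomial ι k} (hf : f ∈ vanIdeal k ι Z) : dif 0 f = 0 := by
  have h : linForm (dif 0 f) = 0 := by
    refine hnd _ (linForm_isHomogeneous _) fun x hx => ?_
    have h : onLine 0 x f = 0 :=
      onLine_eq_zero_iff.2 fun t => mem_vanIdeal.1 hf _ (by simpa using hZ.smul_mem x hx t)
    have := eval_derivative_onLine 0 x f 0
    rw [h] at this
    simpa using this.symm
  refine LinearMap.ext fun x => ?_
  rw [← eval_linForm, h, map_zero, LinearMap.zero_apply]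

/-- A linear form not vanishing at the centre of projection is not a fraction with denominator
nonvanishing at the vertex. -/
theorem eval_zero_eq_zero_of_mem [Infinite k] (hZ : IsProjVariety k ι Z) (hnd : Nondeg k ι Z)
    (hp : pr p = 0) {z : Module.Dual k (ι → k)} (hz : z p = 1) {a b : MvPolynomial κ k}
    (h : linForm z * comorph pr b - comorph pr a ∈ vanIdeal k ι Z) : eval 0 b = 0 := by
  have h1 := LinearMap.congr_fun (dif_zero_eq_zero hZ hnd h) p
  rw [map_sub, dif_mul, dif_linForm, LinearMap.sub_apply, dif_comorph hp, eval_linForm, map_zero,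
    eval_comorph, map_zero, LinearMap.add_apply, LinearMap.smul_apply, LinearMap.smul_apply, hz]
    at h1
  simpa only [zero_mul, zero_add, sub_zero, smul_eq_mul, mul_one, LinearMap.zero_apply] using h1

theorem IsSmoothMinimal.exists_fraction [IsAlgClosed k] [CharZero k] (h : IsSmoothMinimal Z n e)
    (he : 2 ≤ e) (hp : p ∉ Z) (hker : LinearMap.ker pr = Submodule.span k {p})
    (hsurj : Function.Surjective pr) (z : Module.Dual k (ι → k)) :
    ∃ a b : MvPolynomial κ k, b ∉ vanIdeal k κ (pr '' Z) ∧
      linForm z * comorph pr b - comorph pr a ∈ vanIdeal k ι Z := by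
  have hp0 : p ≠ 0 := fun h0 => hp (h0 ▸ h.proj.zero_mem)
  obtain ⟨y, hy, hy0, hpy⟩ := exists_notMem_tang h.proj h.exists_X_notMem hp
  obtain ⟨d, b, hb, hb0, hbz⟩ := (good_nil hp0 hpy).exists_frac h hy hy0 (by simpa)
  rw [spanL_nil, bot_sup_eq] at hb hbz
  have hle : ∀ m, ∀ f ∈ linSub Z (Submodule.span k {p}) ^ m, ∃ g, mkR Z (comorph pr g) = f := by
    intro m f hf
    rw [← map_linR, ← Submodule.map_pow] at hf
    obtain ⟨f', hf', rfl⟩ := hf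
    have h1 : (linR (Submodule.span k {p})) ^ m ≤ Subalgebra.toSubmodule (comorph pr).range := by
      refine (pow_le_pow_left' (linR_span_le_range hker hsurj) m).trans ?_
      clear * -
      induction m with
      | zero =>
        rw [pow_zero]
        exact Submodule.one_le.2 (one_mem (comorph pr).range)
      | succ m ih =>
        rw [pow_succ]
        exact Submodule.mul_le.2 fun a ha b hb => (comorph pr).range.mul_mem (ih ha) hb
    obtain ⟨g, hg⟩ := h1 hf'
    exact ⟨g, congrArg _ hg⟩
  obtain ⟨b', rfl⟩ := hle d b hb
  obtain ⟨a', ha'⟩ := hle _ _ (hbz (lin Z z) (lin_mem_linSub (by simp)))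
  refine ⟨a', b', ?_, ?_⟩
  · rwa [← comorph_mem_vanIdeal, ← mkR_eq_zero]
  · rw [← mkR_eq_zero, map_sub, map_mul, mk_linForm, ha', mul_comm, sub_self]

theorem IsSmoothMinimal.exists_point_of_regSeq [IsAlgClosed k] [CharZero k]
    (h : IsSmoothMinimal Z n e) (he : 2 ≤ e) (hp : p ∉ Z)
    (hker : LinearMap.ker pr = Submodule.span k {p}) (hsurj : Function.Surjective pr)
    {z : Module.Dual k (ι → k)} (hz : z p = 1) {fs : List (MvPolynomial κ k)} {N : ℕ}
    (hfs : RegSeq (vanIdeal k κ (pr '' Z)) fs) (hm : ∀ f ∈ fs, eval 0 f = 0)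
    (hN : fs.length = N + 1) (T : Finset (MvPolynomial κ k)) (hT : ∀ t ∈ T, eval 0 t = 0)
    (hTN : T.card < N) :
    ∃ y : κ → k, y ≠ 0 ∧ (∀ a b : MvPolynomial κ k,
      linForm z * comorph pr b - comorph pr a ∈ vanIdeal k ι Z → eval y b = 0) ∧
      ∀ t ∈ T, eval y t = 0 := by
  have hpr : pr p = 0 := by
    rw [← LinearMap.mem_ker, hker]
    exact Submodule.mem_span_singleton_self p
  have hprime := h.proj.prime
  obtain ⟨s, g, hg, hs⟩ := h.exists_fraction he hp hker hsurj z
  have hg' : comorph pr g ∉ vanIdeal k ι Z := fun h1 => hg (comorph_mem_vanIdeal.1 h1)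
  have hiff : ∀ b, b * s ∈ vanIdeal k κ (pr '' Z) ⊔ Ideal.span {g} ↔
      ∃ a, linForm z * comorph pr b - comorph pr a ∈ vanIdeal k ι Z := by
    intro b
    rw [mem_sup_span_singleton_iff]
    refine exists_congr fun a => ?_
    rw [← comorph_mem_vanIdeal, map_sub, map_mul, map_mul]
    have h1 : comorph pr b * comorph pr s - comorph pr g * comorph pr a =
        comorph pr g * (linForm z * comorph pr b - comorph pr a) -
          comorph pr b * (linForm z * comorph pr g - comorph pr s) := by ring
    rw [h1, Submodule.sub_mem_iff_left _ (Ideal.mul_mem_left _ _ hs)]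
    exact ⟨fun h2 => (hprime.mem_or_mem h2).resolve_left hg', fun h2 => Ideal.mul_mem_left _ _ h2⟩
  have hreg : RegMod (vanIdeal k κ (pr '' Z)) g := by
    intro a ha
    rw [← comorph_mem_vanIdeal, map_mul] at ha
    exact comorph_mem_vanIdeal.1 ((hprime.mem_or_mem ha).resolve_left hg')
  obtain ⟨y, hy0, hy, hyT⟩ := exists_ne_zero_of_regSeq hfs hm hN hreg (s := s) (fun b hb => by
    obtain ⟨a, ha⟩ := (hiff b).1 hb
    exact eval_zero_eq_zero_of_mem h.proj h.nondeg hpr hz ha) T hT hTN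
  exact ⟨y, hy0, fun a b hab => hy b ((hiff b).2 ⟨a, hab⟩), hyT⟩

end PaperQuadrics

namespace PaperQuadrics

variable {k : Type} [Field k] {ι κ : Type} [Fintype ι] [DecidableEq ι] [Fintype κ] [DecidableEq κ]
  {Z : Set (ι → k)} {n e : ℕ} {p : ι → k} {pr : (ι → k) →ₗ[k] (κ → k)}

theorem exists_finset_linear_equations (U : Submodule k (κ → k)) :
    ∃ T : Finset (MvPolynomial κ k), T.card + Module.finrank k U ≤ Fintype.card κ ∧
      (∀ t ∈ T, eval 0 t = 0) ∧ ∀ y, (∀ t ∈ T, eval y t = 0) → y ∈ U := by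
  classical
  let B := Module.finBasis k ((κ → k) ⧸ U)
  refine ⟨Finset.univ.image fun i => linForm (B.coord i ∘ₗ U.mkQ), ?_, ?_, ?_⟩
  · have h1 := U.finrank_quotient_add_finrank
    rw [Module.finrank_fintype_fun_eq_card] at h1
    have h2 := Finset.card_image_le (s := Finset.univ) (f := fun i => linForm (B.coord i ∘ₗ U.mkQ))
    rw [Finset.card_univ, Fintype.card_fin] at h2
    omega
  · intro t ht
    obtain ⟨i, -, rfl⟩ := Finset.mem_image.1 ht
    rw [eval_linForm, map_zero]
  · intro y hy
    rw [← Submodule.Quotient.mk_eq_zero]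
    refine B.forall_coord_eq_zero_iff.1 fun i => ?_
    have h3 := hy _ (Finset.mem_image_of_mem _ (Finset.mem_univ i))
    rwa [eval_linForm] at h3

theorem linForm_eq_add_comorph [Infinite k] (hker : LinearMap.ker pr = Submodule.span k {p})
    (hsurj : Function.Surjective pr) {z : Module.Dual k (ι → k)} (hz : z p = 1)
    (φ : Module.Dual k (ι → k)) :
    ∃ b, linForm φ = C (φ p) * linForm z + comorph pr b := by
  obtain ⟨ψ, hψ⟩ := exists_comorph_linForm hker hsurj (φ := φ - φ p • z) (by simp [hz])
  refine ⟨linForm ψ, ?_⟩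
  rw [← hψ, map_sub, map_smul, smul_eq_C_mul]
  ring

theorem exists_comorph_of_mem_linR_mul [Infinite k]
    (hker : LinearMap.ker pr = Submodule.span k {p})
    (hsurj : Function.Surjective pr) {z : Module.Dual k (ι → k)} (hz : z p = 1)
    {f : MvPolynomial ι k} (hf : f ∈ linR (Submodule.span k {p}) * linR (⊥ : Submodule k (ι → k))) :
    ∃ a b, f = comorph pr a + linForm z * comorph pr b := by
  refine Submodule.mul_induction_on hf ?_ ?_
  · rintro x hx _ ⟨φ, -, rfl⟩
    obtain ⟨m, hm⟩ := linR_span_le_range hker hsurj hx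
    obtain ⟨b, hb⟩ := linForm_eq_add_comorph hker hsurj hz φ
    change comorph pr m = x at hm
    refine ⟨m * b, C (φ p) * m, ?_⟩
    rw [hb, ← hm, map_mul, map_mul, ← algebraMap_eq k κ, AlgHom.commutes, algebraMap_eq]
    ring
  · rintro _ _ ⟨a, b, rfl⟩ ⟨a', b', rfl⟩
    refine ⟨a + a', b + b', ?_⟩
    rw [map_add, map_add]
    ring

theorem exists_eq_mul_add_comorph [Infinite k] (hker : LinearMap.ker pr = Submodule.span k {p})
    (hsurj : Function.Surjective pr) {z : Module.Dual k (ι → k)} (hz : z p = 1)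
    {q : MvPolynomial ι k} {s t : MvPolynomial κ k}
    (hq : q - linForm z ^ 2 = comorph pr s + linForm z * comorph pr t) (f : MvPolynomial ι k) :
    ∃ g a b, f = g * q + comorph pr a + linForm z * comorph pr b := by
  induction f using MvPolynomial.induction_on with
  | C c =>
    refine ⟨0, C c, 0, ?_⟩
    rw [← algebraMap_eq k κ, AlgHom.commutes, algebraMap_eq, map_zero]
    ring
  | add f f' hf hf' =>
    obtain ⟨g, a, b, rfl⟩ := hf
    obtain ⟨g', a', b', rfl⟩ := hf'
    refine ⟨g + g', a + a', b + b', ?_⟩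
    rw [map_add, map_add]
    ring
  | mul_X f i hf =>
    obtain ⟨g, a, b, rfl⟩ := hf
    obtain ⟨m, hm⟩ := linForm_eq_add_comorph hker hsurj hz (LinearMap.proj i)
    rw [linForm_proj] at hm
    set α := (LinearMap.proj i : Module.Dual k (ι → k)) p
    have hC : comorph pr (C α) = C α := by
      rw [← algebraMap_eq k κ, AlgHom.commutes, algebraMap_eq]
    refine ⟨g * X i + C α * comorph pr b, a * m - C α * s * b,
      b * m + C α * a - C α * t * b, ?_⟩
    simp only [map_add, map_sub, map_mul, hC]
    linear_combination (comorph pr a + linForm z * comorph pr b) * hm -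
      C α * comorph pr b * hq

theorem IsSmoothMinimal.le_of_regSeq [IsAlgClosed k] [CharZero k]
    (h : IsSmoothMinimal Z n e) (he : 2 ≤ e) (hp : p ∉ Z)
    (hker : LinearMap.ker pr = Submodule.span k {p}) (hsurj : Function.Surjective pr)
    (hκ : Fintype.card κ = n + e) {fs : List (MvPolynomial κ k)}
    (hfs : RegSeq (vanIdeal k κ (pr '' Z)) fs) (hm : ∀ f ∈ fs, eval 0 f = 0) :
    fs.length ≤ 4 := by
  by_contra! hlen
  obtain ⟨N, hN⟩ : ∃ N, fs.length = N + 1 := ⟨fs.length - 1, by omega⟩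
  have hpr : pr p = 0 := by
    rw [← LinearMap.mem_ker, hker]
    exact Submodule.mem_span_singleton_self p
  have : Infinite k := IsAlgClosed.instInfinite
  obtain ⟨z, q, K, hz, hq, hqI, hqz, hpK, hK, hKq⟩ := h.exists_quadric_ker he hp
  have hqp : eval p q = 1 := by
    have := eval_eq_zero_of_mem_linR_mul (Submodule.mem_span_singleton_self p) hqz
    rw [map_sub, map_pow, eval_linForm, hz, one_pow, sub_eq_zero] at this
    exact this
  obtain ⟨s, t, hst⟩ := exists_comorph_of_mem_linR_mul hker hsurj hz hqz
  have hfin : Module.finrank k (K.map pr) = Module.finrank k K := by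
    rw [← LinearMap.range_domRestrict]
    refine LinearMap.finrank_range_of_inj ((injective_iff_map_eq_zero _).2 fun x hx => ?_)
    have h1 : (x : ι → k) ∈ LinearMap.ker pr := hx
    rw [hker] at h1
    obtain ⟨c, hc⟩ := Submodule.mem_span_singleton.1 h1
    by_cases hc0 : c = 0
    · rw [hc0, zero_smul] at hc
      exact Subtype.ext hc.symm
    · exact absurd ((Submodule.smul_mem_iff K hc0).1 (hc ▸ x.2)) hpK
  obtain ⟨T, hTcard, hT0, hT⟩ := exists_finset_linear_equations (K.map pr)
  obtain ⟨y, hy0, hyJ, hyT⟩ := h.exists_point_of_regSeq he hp hker hsurj hz hfs hm hN T hT0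
    (by omega)
  obtain ⟨x, hxK, rfl⟩ := hT y hyT
  have hx0 : x ≠ 0 := by
    rintro rfl
    exact hy0 (map_zero pr)
  obtain ⟨hxq, hxqp, hinv⟩ := hKq x hxK
  have key : ∀ f ∈ vanIdeal k ι Z, eval x f = 0 ∧ dif x f p = 0 := by
    intro f hf
    obtain ⟨g, a, b, rfl⟩ := exists_eq_mul_add_comorph hker hsurj hz hst f
    have h1 : comorph pr a + linForm z * comorph pr b ∈ vanIdeal k ι Z := by
      rw [add_assoc] at hf
      exact (Submodule.add_mem_iff_right _ (Ideal.mul_mem_left _ g hqI)).1 hf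
    have hb : eval (pr x) b = 0 := by
      refine hyJ (-a) b ?_
      rw [map_neg, sub_neg_eq_add, add_comm]
      exact h1
    have ha : eval (pr x) a = 0 := by
      refine hyJ (s * b - t * a) a ?_
      rw [map_sub, map_mul, map_mul]
      have h2 : linForm z * comorph pr a -
          (comorph pr s * comorph pr b - comorph pr t * comorph pr a) =
          (linForm z + comorph pr t) * (comorph pr a + linForm z * comorph pr b) -
            comorph pr b * q := by
        linear_combination comorph pr b * hst
      rw [h2]
      exact Ideal.sub_mem _ (Ideal.mul_mem_left _ _ h1) (Ideal.mul_mem_left _ _ hqI)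
    refine ⟨by simp [hxq, ha, hb], ?_⟩
    rw [map_add, map_add, dif_mul, dif_mul]
    simp [hxq, hxqp, dif_comorph hpr, hb]
  have hxZ : x ∈ Z := by
    rw [h.proj.closed]
    exact fun f hf => (key f hf).1
  have := h.eval_quadric_eq_zero hxZ hx0 hq hqI hinv (mem_tang.2 fun f hf => (key f hf).2)
  exact one_ne_zero (hqp.symm.trans this)

end PaperQuadrics

open PaperQuadrics

/-- Corollary 2.2.(1). Let `X = π_p(X̃) ⊆ ℙ^{n+c}` (degree `c + 2`) be
the projection of a smooth `n`-dimensional variety of minimal degree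
`X̃ ⊆ ℙ^{n+c+1}` (not a cone) from a point `p ∉ X̃`, `c ≥ 3`.
If `depth(X) = n`, then `n ≤ 4`. -/
theorem stmt_4 {k : Type} [Field k] [IsAlgClosed k] [CharZero k]
    (n c : ℕ) (hc : 3 ≤ c)
    (Ct : Set (Fin (n + c + 2) → k)) (C : Set (Fin (n + c + 1) → k))
    (hVt : IsProjVariety k (Fin (n + c + 2)) Ct)
    (hndt : Nondeg k (Fin (n + c + 2)) Ct)
    (hdimt : HasDim k (Fin (n + c + 2)) Ct n)
    (hdegt : HasDegree k (Fin (n + c + 2)) Ct n (c + 2))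
    (hsmooth : IsSmoothOfCodim k (Fin (n + c + 2)) Ct (c + 1))
    (hnotcone : ¬ IsConeVariety k (Fin (n + c + 2)) Ct)
    (p : Fin (n + c + 2) → k) (hp0 : p ≠ 0) (hpC : p ∉ Ct)
    (pr : (Fin (n + c + 2) → k) →ₗ[k] (Fin (n + c + 1) → k))
    (hker : LinearMap.ker pr = Submodule.span k {p})
    (hsurj : Function.Surjective pr)
    (hproj : C = pr '' Ct)
    (hdeg : HasDegree k (Fin (n + c + 1)) C n (c + 2))
    (hdepth : arithDepth k (Fin (n + c + 1)) C = n) :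
    n ≤ 4 := by
  have hZ : IsSmoothMinimal Ct n (c + 1) := ⟨hVt, hndt, hdimt, hdegt, hsmooth, by simp; omega⟩
  by_contra! hn
  obtain ⟨fs, hlen, hcoeff, hreg⟩ : arithDepth k (Fin (n + c + 1)) C ∈
      {l : ℕ | ∃ fs : List (MvPolynomial (Fin (n + c + 1)) k), fs.length = l ∧
        (∀ f ∈ fs, MvPolynomial.coeff 0 f = 0) ∧
          IsRegSeqOn k (Fin (n + c + 1)) (vanIdeal k (Fin (n + c + 1)) C) fs} := by
    have hpos : arithDepth k (Fin (n + c + 1)) C ≠ 0 := by omega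
    refine Nat.sSup_mem ?_ ?_
    · by_contra hne
      refine hpos ?_
      rw [arithDepth, Set.not_nonempty_iff_eq_empty.1 hne, csSup_empty, bot_eq_zero]
    · by_contra hbdd
      exact hpos (csSup_of_not_bddAbove hbdd |>.trans (by simp))
  subst hproj
  have h4 := hZ.le_of_regSeq (by omega) hpC hker hsurj (by simp; omega)
    (regSeq_of_forall hreg.1) fun f hf => by
      rw [← hcoeff f hf, ← constantCoeff_eq, eval_zero]
  omega
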